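/- Sharpness of the condition γ(t) → ∞: Suppose p ≥ 1, r ≥ q > 1, k(x,y,t) ≡ 0, a(x,t) ≡ a̲(t) and b(x,t) ≡ b̄(t), where a̲(t) = γ exp[λ₁(r+p−q)t] b̄(t) for a fixed constant γ > 0. Let φ be the first Dirichlet eigenfunction of −Δ on Ω, normalized by ∫_Ω φ dx = 1. Then for all sufficiently small β > 0, the function ū(x,t) = β φ(x) e^{−λ₁ t} is a supersolution of problem (P) in Q_T for every T > 0 whenever u₀(x) ≤ β φ(x); consequently problem (P) with these coefficients has global solutions for such initial data. -/

import Mathlib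

open Set MeasureTheory Real Filter

noncomputable section

/-- The Laplacian of `f : ℝⁿ → ℝ`, written as the sum of second directional
derivatives along the coordinate directions. -/
def lap {n : ℕ} (f : EuclideanSpace ℝ (Fin n) → ℝ) (x : EuclideanSpace ℝ (Fin n)) : ℝ :=
  ∑ i : Fin n,
    fderiv ℝ (fun y => fderiv ℝ f y (EuclideanSpace.single i 1)) x (EuclideanSpace.single i 1)

/-- Local Hölder continuity on `closure Ω × [0,∞)` (with exponent `α ∈ (0,1)`). -/
def LocHolder {n : ℕ} (Ω : Set (EuclideanSpace ℝ (Fin n)))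
    (f : EuclideanSpace ℝ (Fin n) → ℝ → ℝ) : Prop :=
  ∃ α : ℝ, 0 < α ∧ α < 1 ∧ ∀ M : ℝ, 0 < M → ∃ C : ℝ,
    ∀ x ∈ closure Ω, ∀ y ∈ closure Ω, ∀ s ∈ Icc (0:ℝ) M, ∀ t ∈ Icc (0:ℝ) M,
      |f x s - f y t| ≤ C * (dist x y + |s - t|) ^ α

/-- Structural hypotheses on the domain `Ω` and the coefficients `a`, `b`, `k`
of problem (P): `Ω` is a nonempty bounded open set, `a, b` are nonnegative and locally
Hölder continuous on `closure Ω × [0,∞)`, and `k` is nonnegative and continuous on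
`∂Ω × closure Ω × [0,∞)`. -/
def GoodData {n : ℕ} (Ω : Set (EuclideanSpace ℝ (Fin n)))
    (a b : EuclideanSpace ℝ (Fin n) → ℝ → ℝ)
    (k : EuclideanSpace ℝ (Fin n) → EuclideanSpace ℝ (Fin n) → ℝ → ℝ) : Prop :=
  IsOpen Ω ∧ Bornology.IsBounded Ω ∧ Ω.Nonempty ∧
  LocHolder Ω a ∧ LocHolder Ω b ∧
  (∀ x ∈ closure Ω, ∀ t : ℝ, 0 ≤ t → 0 ≤ a x t ∧ 0 ≤ b x t) ∧
  ContinuousOn (fun z : (EuclideanSpace ℝ (Fin n) × EuclideanSpace ℝ (Fin n)) × ℝ =>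
      k z.1.1 z.1.2 z.2) ((frontier Ω ×ˢ closure Ω) ×ˢ Ici 0) ∧
  (∀ x ∈ frontier Ω, ∀ y ∈ closure Ω, ∀ t : ℝ, 0 ≤ t → 0 ≤ k x y t)

/-- Admissible initial datum for problem (P): nonnegative, continuous on `closure Ω`,
and compatible with the nonlocal boundary condition at `t = 0`. -/
def GoodInit {n : ℕ} (Ω : Set (EuclideanSpace ℝ (Fin n)))
    (k : EuclideanSpace ℝ (Fin n) → EuclideanSpace ℝ (Fin n) → ℝ → ℝ) (l : ℝ)
    (u0 : EuclideanSpace ℝ (Fin n) → ℝ) : Prop :=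
  ContinuousOn u0 (closure Ω) ∧ (∀ x ∈ closure Ω, 0 ≤ u0 x) ∧
  ∀ x ∈ frontier Ω, u0 x = ∫ y in Ω, k x y 0 * u0 y ^ l

/-- Regularity required of sub/supersolutions in `Q_T`: continuity on
`Q_T ∪ Γ_T = closure Ω × [0,T)`, `C²` in space and differentiability in time inside `Q_T`. -/
def RegQ {n : ℕ} (Ω : Set (EuclideanSpace ℝ (Fin n))) (T : ℝ)
    (u : EuclideanSpace ℝ (Fin n) → ℝ → ℝ) : Prop :=
  ContinuousOn (fun z : EuclideanSpace ℝ (Fin n) × ℝ => u z.1 z.2) (closure Ω ×ˢ Ico 0 T) ∧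
  (∀ t ∈ Ioo (0:ℝ) T, ContDiffOn ℝ 2 (fun x => u x t) Ω) ∧
  (∀ x ∈ Ω, ∀ t ∈ Ioo (0:ℝ) T, DifferentiableAt ℝ (u x) t)

/-- `u` is a supersolution of problem (P) in `Q_T`. -/
def IsSuperSol {n : ℕ} (r p q l : ℝ) (Ω : Set (EuclideanSpace ℝ (Fin n)))
    (a b : EuclideanSpace ℝ (Fin n) → ℝ → ℝ)
    (k : EuclideanSpace ℝ (Fin n) → EuclideanSpace ℝ (Fin n) → ℝ → ℝ)
    (u0 : EuclideanSpace ℝ (Fin n) → ℝ) (T : ℝ)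
    (u : EuclideanSpace ℝ (Fin n) → ℝ → ℝ) : Prop :=
  RegQ Ω T u ∧ (∀ x ∈ closure Ω, ∀ t ∈ Ico (0:ℝ) T, 0 ≤ u x t) ∧
  (∀ x ∈ Ω, ∀ t ∈ Ioo (0:ℝ) T,
    deriv (u x) t ≥ lap (fun y => u y t) x
      + a x t * u x t ^ r * (∫ y in Ω, u y t ^ p) - b x t * u x t ^ q) ∧
  (∀ x ∈ frontier Ω, ∀ t ∈ Ioo (0:ℝ) T, u x t ≥ ∫ y in Ω, k x y t * u y t ^ l) ∧
  (∀ x ∈ Ω, u x 0 ≥ u0 x)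

/-- `u` is a subsolution of problem (P) in `Q_T`. -/
def IsSubSol {n : ℕ} (r p q l : ℝ) (Ω : Set (EuclideanSpace ℝ (Fin n)))
    (a b : EuclideanSpace ℝ (Fin n) → ℝ → ℝ)
    (k : EuclideanSpace ℝ (Fin n) → EuclideanSpace ℝ (Fin n) → ℝ → ℝ)
    (u0 : EuclideanSpace ℝ (Fin n) → ℝ) (T : ℝ)
    (u : EuclideanSpace ℝ (Fin n) → ℝ → ℝ) : Prop :=
  RegQ Ω T u ∧ (∀ x ∈ closure Ω, ∀ t ∈ Ico (0:ℝ) T, 0 ≤ u x t) ∧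
  (∀ x ∈ Ω, ∀ t ∈ Ioo (0:ℝ) T,
    deriv (u x) t ≤ lap (fun y => u y t) x
      + a x t * u x t ^ r * (∫ y in Ω, u y t ^ p) - b x t * u x t ^ q) ∧
  (∀ x ∈ frontier Ω, ∀ t ∈ Ioo (0:ℝ) T, u x t ≤ ∫ y in Ω, k x y t * u y t ^ l) ∧
  (∀ x ∈ Ω, u x 0 ≤ u0 x)

/-- `u` is a solution of problem (P) in `Q_T`: both a subsolution and a supersolution. -/
def IsSol {n : ℕ} (r p q l : ℝ) (Ω : Set (EuclideanSpace ℝ (Fin n)))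
    (a b : EuclideanSpace ℝ (Fin n) → ℝ → ℝ)
    (k : EuclideanSpace ℝ (Fin n) → EuclideanSpace ℝ (Fin n) → ℝ → ℝ)
    (u0 : EuclideanSpace ℝ (Fin n) → ℝ) (T : ℝ)
    (u : EuclideanSpace ℝ (Fin n) → ℝ → ℝ) : Prop :=
  IsSubSol r p q l Ω a b k u0 T u ∧ IsSuperSol r p q l Ω a b k u0 T u

/-- `u` solves problem (P) in `Q_T` for every `T < Tstar`. -/
def IsSolOn {n : ℕ} (r p q l : ℝ) (Ω : Set (EuclideanSpace ℝ (Fin n)))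
    (a b : EuclideanSpace ℝ (Fin n) → ℝ → ℝ)
    (k : EuclideanSpace ℝ (Fin n) → EuclideanSpace ℝ (Fin n) → ℝ → ℝ)
    (u0 : EuclideanSpace ℝ (Fin n) → ℝ) (Tstar : ℝ)
    (u : EuclideanSpace ℝ (Fin n) → ℝ → ℝ) : Prop :=
  ∀ T : ℝ, 0 < T → T < Tstar → IsSol r p q l Ω a b k u0 T u

/-- `sup_Ω u(·,t) → ∞` as `t → Tstar⁻`. -/
def BlowsUpAt {n : ℕ} (Ω : Set (EuclideanSpace ℝ (Fin n)))
    (u : EuclideanSpace ℝ (Fin n) → ℝ → ℝ) (Tstar : ℝ) : Prop :=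
  ∀ M : ℝ, ∀ᶠ t in nhdsWithin Tstar (Iio Tstar), ∃ x ∈ Ω, M < u x t

/-- Every nontrivial solution with initial datum `u0` blows up in finite time: there is no
global solution, and every noncontinuable solution on a maximal time interval `[0, Tstar)`
satisfies `sup_Ω u(·,t) → ∞` as `t → Tstar⁻`. -/
def AllSolutionsBlowUp {n : ℕ} (r p q l : ℝ) (Ω : Set (EuclideanSpace ℝ (Fin n)))
    (a b : EuclideanSpace ℝ (Fin n) → ℝ → ℝ)
    (k : EuclideanSpace ℝ (Fin n) → EuclideanSpace ℝ (Fin n) → ℝ → ℝ)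
    (u0 : EuclideanSpace ℝ (Fin n) → ℝ) : Prop :=
  (∀ u : EuclideanSpace ℝ (Fin n) → ℝ → ℝ, ¬ (∀ T : ℝ, 0 < T → IsSol r p q l Ω a b k u0 T u)) ∧
  (∀ (u : EuclideanSpace ℝ (Fin n) → ℝ → ℝ) (Tstar : ℝ), 0 < Tstar →
    IsSolOn r p q l Ω a b k u0 Tstar u →
    (¬ ∃ (v : EuclideanSpace ℝ (Fin n) → ℝ → ℝ) (T' : ℝ), Tstar < T' ∧
        IsSolOn r p q l Ω a b k u0 T' v ∧
        ∀ x ∈ closure Ω, ∀ t ∈ Ico (0:ℝ) Tstar, v x t = u x t) →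
    BlowsUpAt Ω u Tstar)

/-- `φ` is a (positive, hence principal) Dirichlet eigenfunction of `-Δ` on `Ω` with
eigenvalue `lam`:  `Δφ + lam φ = 0` in `Ω`, `φ = 0` on `∂Ω`, `φ > 0` in `Ω`. -/
def IsDirichletEigen {n : ℕ} (Ω : Set (EuclideanSpace ℝ (Fin n))) (lam : ℝ)
    (φ : EuclideanSpace ℝ (Fin n) → ℝ) : Prop :=
  ContinuousOn φ (closure Ω) ∧ ContDiffOn ℝ 2 φ Ω ∧
  (∀ x ∈ Ω, lap φ x + lam * φ x = 0) ∧ (∀ x ∈ frontier Ω, φ x = 0) ∧ (∀ x ∈ Ω, 0 < φ x)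

/-- `lam` is the first Dirichlet eigenvalue of `-Δ` on `Ω`, with (some) positive
eigenfunction `φ`. -/
def IsFirstEigen {n : ℕ} (Ω : Set (EuclideanSpace ℝ (Fin n))) (lam : ℝ)
    (φ : EuclideanSpace ℝ (Fin n) → ℝ) : Prop :=
  IsDirichletEigen Ω lam φ ∧
  ∀ lam' : ℝ, (∃ ψ : EuclideanSpace ℝ (Fin n) → ℝ, ContinuousOn ψ (closure Ω) ∧
      ContDiffOn ℝ 2 ψ Ω ∧ (∀ x ∈ Ω, lap ψ x + lam' * ψ x = 0) ∧
      (∀ x ∈ frontier Ω, ψ x = 0) ∧ ∃ x ∈ Ω, ψ x ≠ 0) → lam ≤ lam'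

/-- `sup_Ω f(·,t)`. -/
def supOmega {n : ℕ} (Ω : Set (EuclideanSpace ℝ (Fin n)))
    (f : EuclideanSpace ℝ (Fin n) → ℝ → ℝ) (t : ℝ) : ℝ :=
  sSup ((fun x => f x t) '' Ω)

/-- `inf_Ω f(·,t)`. -/
def infOmega {n : ℕ} (Ω : Set (EuclideanSpace ℝ (Fin n)))
    (f : EuclideanSpace ℝ (Fin n) → ℝ → ℝ) (t : ℝ) : ℝ :=
  sInf ((fun x => f x t) '' Ω)

/-- `inf_{∂Ω × Ω} k(·,·,t)`. -/
def infBdry {n : ℕ} (Ω : Set (EuclideanSpace ℝ (Fin n)))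
    (k : EuclideanSpace ℝ (Fin n) → EuclideanSpace ℝ (Fin n) → ℝ → ℝ) (t : ℝ) : ℝ :=
  sInf ((fun z : EuclideanSpace ℝ (Fin n) × EuclideanSpace ℝ (Fin n) => k z.1 z.2 t) ''
    (frontier Ω ×ˢ Ω))

open Topology
open scoped ContDiff

/-- Euclidean `n`-space. -/
abbrev Euc (n : ℕ) := EuclideanSpace ℝ (Fin n)

section Laplacian

variable {n : ℕ}

theorem lap_congr {f g : Euc n → ℝ} {x : Euc n} (h : f =ᶠ[𝓝 x] g) : lap f x = lap g x := by
  unfold lap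
  refine Finset.sum_congr rfl fun i _ => ?_
  have : (fun y => fderiv ℝ f y (EuclideanSpace.single i 1)) =ᶠ[𝓝 x]
      fun y => fderiv ℝ g y (EuclideanSpace.single i 1) := by
    filter_upwards [h.eventuallyEq_nhds] with y hy
    rw [hy.fderiv_eq]
  rw [this.fderiv_eq]

theorem contDiff_partial {f : Euc n → ℝ} (hf : ContDiff ℝ 2 f) (v : Euc n) :
    ContDiff ℝ 1 (fun y => fderiv ℝ f y v) :=
  (hf.fderiv_right (m := 1) (by norm_num)).clm_apply contDiff_const

theorem continuous_lap {f : Euc n → ℝ} (hf : ContDiff ℝ 2 f) : Continuous (lap f) := by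
  unfold lap
  refine continuous_finsetSum _ fun i _ => ?_
  exact ((contDiff_partial hf _).continuous_fderiv (by norm_num)).clm_apply continuous_const

theorem hasCompactSupport_lap {f : Euc n → ℝ} (hc : HasCompactSupport f) :
    HasCompactSupport (lap f) := by
  refine hc.mono' fun x hx => ?_
  by_contra hxt
  apply hx
  have h0 : f =ᶠ[𝓝 x] fun _ => 0 := notMem_tsupport_iff_eventuallyEq.mp hxt
  rw [lap_congr h0]
  simp [lap]

/-- Green's first identity for a compactly supported test function. -/
theorem integral_grad_mul_grad {θ f : Euc n → ℝ} (hθ : ContDiff ℝ 1 θ) (hc : HasCompactSupport θ)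
    (hf : ContDiff ℝ 2 f) :
    ∫ z, ∑ i : Fin n, fderiv ℝ θ z (EuclideanSpace.single i 1) *
        fderiv ℝ f z (EuclideanSpace.single i 1) = -∫ z, θ z * lap f z := by
  have hint : ∀ i : Fin n, Integrable (fun z => fderiv ℝ θ z (EuclideanSpace.single i 1) *
        fderiv ℝ f z (EuclideanSpace.single i 1)) := fun i =>
    (((hθ.continuous_fderiv (by norm_num)).clm_apply continuous_const).mul
      (contDiff_partial hf _).continuous).integrable_of_hasCompactSupport
      ((hc.fderiv_apply ℝ _).mul_right)
  have hint2 : ∀ i : Fin n, Integrable (fun z => θ z *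
      fderiv ℝ (fun y => fderiv ℝ f y (EuclideanSpace.single i 1)) z
        (EuclideanSpace.single i 1)) := fun i =>
    (hθ.continuous.mul (((contDiff_partial hf _).continuous_fderiv (by norm_num)).clm_apply
      continuous_const)).integrable_of_hasCompactSupport hc.mul_right
  rw [integral_finsetSum _ fun i _ => hint i]
  simp only [lap, Finset.mul_sum]
  rw [integral_finsetSum _ fun i _ => hint2 i, ← Finset.sum_neg_distrib]
  refine Finset.sum_congr rfl fun i _ => ?_
  rw [eq_neg_iff_add_eq_zero, add_comm, ← eq_neg_iff_add_eq_zero]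
  refine integral_mul_fderiv_eq_neg_fderiv_mul_of_integrable (hint i) (hint2 i) ?_
    (fun x _ => (hθ.differentiable (by norm_num)) x)
    (fun x _ => ((contDiff_partial hf _).differentiable (by norm_num)) x)
  exact (hθ.continuous.mul (contDiff_partial hf _).continuous).integrable_of_hasCompactSupport
    hc.mul_right

theorem lap_comp_smul {f : Euc n → ℝ} (hf : ContDiff ℝ 2 f) (x : Euc n) (s : ℝ) (z : Euc n) :
    lap (fun z => f (x + s • z)) z = s ^ 2 * lap f (x + s • z) := by
  have hg : ∀ (g : Euc n → ℝ), Differentiable ℝ g → ∀ (y v : Euc n),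
      fderiv ℝ (fun z => g (x + s • z)) y v = s * fderiv ℝ g (x + s • y) v := by
    intro g hgd y v
    have h1 : HasFDerivAt (fun z : Euc n => x + s • z) (s • ContinuousLinearMap.id ℝ (Euc n)) y :=
      ((hasFDerivAt_id y).const_smul s).const_add x
    have h2 := (hgd (x + s • y)).hasFDerivAt.comp y h1
    have h3 : fderiv ℝ (fun z => g (x + s • z)) y = _ := h2.fderiv
    rw [h3]
    simp
  unfold lap
  rw [Finset.mul_sum]
  refine Finset.sum_congr rfl fun i _ => ?_
  simp_rw [hg f (hf.differentiable (by norm_num))]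
  have hd := (contDiff_partial hf (EuclideanSpace.single i 1)).differentiable (by norm_num)
  have hd' : DifferentiableAt ℝ (fun y => fderiv ℝ f (x + s • y) (EuclideanSpace.single i 1)) z :=
    DifferentiableAt.comp (g := fun y => fderiv ℝ f y (EuclideanSpace.single i 1)) z (hd _)
      (by fun_prop)
  rw [fderiv_const_mul hd', smul_apply,
    hg (fun y => fderiv ℝ f y (EuclideanSpace.single i 1)) hd]
  simp only [smul_eq_mul]
  ring

end Laplacian

section Kernel

variable {n : ℕ}

/-- The unnormalized averaging kernel `max (1 - ‖z‖²) 0`. -/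
def cone (z : Euc n) : ℝ := max (1 - ‖z‖ ^ 2) 0

/-- The mass of the unnormalized averaging kernel. -/
def coneMass (n : ℕ) : ℝ := ∫ z : Euc n, cone z

/-- The averaging kernel, a radial probability density supported in the unit ball. -/
def aker (z : Euc n) : ℝ := cone z / coneMass n

/-- The radial potential of the averaging kernel: its gradient at `z` is `-aker z • z`. -/
def pot (z : Euc n) : ℝ := cone z ^ 2 / (4 * coneMass n)

/-- The mass of the potential. -/
def potMass (n : ℕ) : ℝ := ∫ z : Euc n, pot z

/-- The average of `U` over the ball of radius `h` around `x`. -/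
def avg (h : ℝ) (U : Euc n → ℝ) (x : Euc n) : ℝ := ∫ z, aker z * U (x + h • z)

/-- The time step associated with averaging at scale `h`. -/
def stp (n : ℕ) (h : ℝ) : ℝ := potMass n * h ^ 2 / 2

theorem cone_nonneg (z : Euc n) : 0 ≤ cone z := le_max_right _ _

theorem continuous_cone : Continuous (cone : Euc n → ℝ) := by unfold cone; fun_prop

theorem cone_eq_zero {z : Euc n} (hz : 1 ≤ ‖z‖) : cone z = 0 := by
  unfold cone; apply max_eq_right; nlinarith

theorem hasCompactSupport_cone : HasCompactSupport (cone : Euc n → ℝ) := by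
  refine HasCompactSupport.intro (isCompact_closedBall 0 1) fun z hz => cone_eq_zero ?_
  simp only [Metric.mem_closedBall, dist_zero_right, not_le] at hz
  exact hz.le

theorem cone_zero : cone (0 : Euc n) = 1 := by simp [cone]

theorem coneMass_pos : 0 < coneMass n :=
  continuous_cone.integral_pos_of_hasCompactSupport_nonneg_nonzero hasCompactSupport_cone
    cone_nonneg (x := 0) (by simp [cone_zero])

theorem aker_nonneg (z : Euc n) : 0 ≤ aker z := div_nonneg (cone_nonneg z) coneMass_pos.le

theorem continuous_aker : Continuous (aker : Euc n → ℝ) := continuous_cone.div_const _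

theorem hasCompactSupport_aker : HasCompactSupport (aker : Euc n → ℝ) :=
  hasCompactSupport_cone.mono fun z hz h => hz (by simp [aker, h])

theorem aker_eq_zero {z : Euc n} (hz : 1 ≤ ‖z‖) : aker z = 0 := by simp [aker, cone_eq_zero hz]

theorem aker_neg (z : Euc n) : aker (-z) = aker z := by simp [aker, cone]

theorem integrable_aker : Integrable (aker : Euc n → ℝ) :=
  continuous_aker.integrable_of_hasCompactSupport hasCompactSupport_aker

theorem integral_aker : ∫ z : Euc n, aker z = 1 := by
  simp only [aker, integral_div]
  exact div_self coneMass_pos.ne'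

theorem pot_nonneg (z : Euc n) : 0 ≤ pot z :=
  div_nonneg (sq_nonneg _) (by linarith [coneMass_pos (n := n)])

theorem continuous_pot : Continuous (pot : Euc n → ℝ) := (continuous_cone.pow 2).div_const _

theorem hasCompactSupport_pot : HasCompactSupport (pot : Euc n → ℝ) :=
  hasCompactSupport_cone.mono fun z hz h => hz (by simp [pot, h])

theorem pot_eq_zero {z : Euc n} (hz : 1 ≤ ‖z‖) : pot z = 0 := by simp [pot, cone_eq_zero hz]

theorem integrable_pot : Integrable (pot : Euc n → ℝ) :=
  continuous_pot.integrable_of_hasCompactSupport hasCompactSupport_pot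

theorem potMass_pos : 0 < potMass n :=
  continuous_pot.integral_pos_of_hasCompactSupport_nonneg_nonzero hasCompactSupport_pot
    pot_nonneg (x := 0) (by simp [pot, cone_zero, coneMass_pos.ne'])

theorem stp_pos {h : ℝ} (hh : 0 < h) : 0 < stp n h := by
  have := potMass_pos (n := n)
  unfold stp; positivity

theorem hasDerivAt_max_zero_sq (s : ℝ) : HasDerivAt (fun s : ℝ => max s 0 ^ 2) (2 * max s 0) s := by
  rcases lt_trichotomy s 0 with hs | rfl | hs
  · rw [max_eq_right hs.le, mul_zero]
    refine (hasDerivAt_const s (0 : ℝ)).congr_of_eventuallyEq ?_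
    filter_upwards [gt_mem_nhds hs] with t ht
    simp [max_eq_right (le_of_lt ht)]
  · rw [hasDerivAt_iff_isLittleO_nhds_zero]
    have h : (fun h : ℝ => h * h) =o[𝓝 0] fun h => h := by
      simpa using (Asymptotics.isLittleO_one_iff ℝ |>.mpr (tendsto_id (α := ℝ) (x := 𝓝 0))).mul_isBigO
        (Asymptotics.isBigO_refl (fun h : ℝ => h) (𝓝 0))
    refine (Asymptotics.IsBigO.of_bound 1 (Eventually.of_forall fun t => ?_)).trans_isLittleO h
    rcases le_total t 0 with ht | ht
    · simp [max_eq_right ht, mul_self_nonneg]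
    · simp [max_eq_left ht, pow_two]
  · rw [max_eq_left hs.le]
    refine (by simpa using hasDerivAt_pow 2 s : HasDerivAt (fun s : ℝ => s ^ 2) (2 * s) s).congr_of_eventuallyEq ?_
    filter_upwards [lt_mem_nhds hs] with t ht
    simp [max_eq_left (le_of_lt ht)]

theorem hasFDerivAt_pot (z : Euc n) : HasFDerivAt (pot : Euc n → ℝ) (-(aker z • innerSL ℝ z)) z := by
  have h1 : HasFDerivAt (fun z : Euc n => 1 - ‖z‖ ^ 2) (-(2 • innerSL ℝ z)) z :=
    ((hasStrictFDerivAt_norm_sq z).hasFDerivAt).const_sub 1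
  have h2 := ((hasDerivAt_max_zero_sq (1 - ‖z‖ ^ 2)).comp_hasFDerivAt z h1).mul_const
    ((4 * coneMass n)⁻¹)
  have hm := coneMass_pos (n := n)
  refine h2.congr_fderiv ?_
  ext v
  simp [aker, cone]
  field_simp
  norm_num

theorem contDiff_pot : ContDiff ℝ 1 (pot : Euc n → ℝ) := by
  rw [contDiff_one_iff_hasFDerivAt]
  exact ⟨_, (continuous_aker.smul (innerSL ℝ).continuous).neg, hasFDerivAt_pot⟩

theorem integral_aker_mul_fderiv {f : Euc n → ℝ} (hf : ContDiff ℝ 2 f) :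
    ∫ z, aker z * fderiv ℝ f z z = ∫ z, pot z * lap f z := by
  have h := integral_grad_mul_grad contDiff_pot hasCompactSupport_pot hf
  rw [← neg_eq_iff_eq_neg, ← integral_neg] at h
  rw [← h]
  congr 1
  ext z
  rw [← Finset.sum_neg_distrib]
  have hz : z = ∑ i, z i • (EuclideanSpace.single i (1 : ℝ) : Euc n) := by
    ext j
    simp [Pi.single_apply]
  conv_lhs => rw [hz, map_sum]
  rw [← hz, Finset.mul_sum]
  refine Finset.sum_congr rfl fun i _ => ?_
  rw [(hasFDerivAt_pot z).fderiv]
  simp [EuclideanSpace.inner_single_right]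
  ring

theorem integrable_aker_mul {U : Euc n → ℝ} (hU : Measurable U) {M : ℝ} (hM : ∀ x, |U x| ≤ M)
    (h : ℝ) (x : Euc n) : Integrable (fun z => aker z * U (x + h • z)) :=
  integrable_aker.mul_bdd (c := M) (hU.comp (by fun_prop)).aestronglyMeasurable
    (Eventually.of_forall fun z => hM _)

theorem hasDerivAt_avg {f : Euc n → ℝ} (hf : ContDiff ℝ 2 f) (x : Euc n) {s : ℝ} (hs : s ≠ 0) :
    HasDerivAt (fun s => avg s f x) (s * ∫ z, pot z * lap f (x + s • z)) s := by
  have hcd : Continuous (fderiv ℝ f) := hf.continuous_fderiv (by norm_num)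
  obtain ⟨C, hC⟩ := (isCompact_closedBall x (|s| + 1)).exists_bound_of_continuousOn hcd.continuousOn
  have key := hasDerivAt_integral_of_dominated_loc_of_deriv_le (μ := volume)
    (F := fun s z => aker z * f (x + s • z))
    (F' := fun s z => aker z * fderiv ℝ f (x + s • z) z) (x₀ := s)
    (bound := fun z : Euc n => aker z * C) (Metric.ball_mem_nhds s one_pos)
    (Eventually.of_forall fun s => (continuous_aker.mul (hf.continuous.comp
      (by fun_prop))).aestronglyMeasurable)
    ((continuous_aker.mul (hf.continuous.comp
      (by fun_prop))).integrable_of_hasCompactSupport hasCompactSupport_aker.mul_right)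
    (continuous_aker.mul ((hcd.comp (by fun_prop)).clm_apply
      continuous_id)).aestronglyMeasurable
    (Eventually.of_forall fun z t ht => ?_)
    (integrable_aker.mul_const C)
    (Eventually.of_forall fun z t ht => ?_)
  · have h2 := key.2
    refine h2.congr_deriv ?_
    have hfs : ContDiff ℝ 2 (fun z => f (x + s • z)) := hf.comp (by fun_prop)
    have h3 := integral_aker_mul_fderiv hfs
    have h4 : ∀ z, fderiv ℝ (fun z => f (x + s • z)) z z = s * fderiv ℝ f (x + s • z) z := by
      intro z
      have h1 : HasFDerivAt (fun z : Euc n => x + s • z) (s • ContinuousLinearMap.id ℝ (Euc n)) z :=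
        ((hasFDerivAt_id z).const_smul s).const_add x
      have h2 := ((hf.differentiable (by norm_num)) (x + s • z)).hasFDerivAt.comp z h1
      have h3 : fderiv ℝ (fun z => f (x + s • z)) z = _ := h2.fderiv
      rw [h3]
      simp
    simp_rw [h4, lap_comp_smul hf] at h3
    have h5 : ∀ z : Euc n, pot z * (s ^ 2 * lap f (x + s • z)) =
        s ^ 2 * (pot z * lap f (x + s • z)) := fun z => by ring
    have h6 : ∀ z : Euc n, aker z * (s * fderiv ℝ f (x + s • z) z) =
        s * (aker z * fderiv ℝ f (x + s • z) z) := fun z => by ring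
    simp_rw [h5, h6, integral_const_mul] at h3
    rw [pow_two, mul_assoc] at h3
    exact mul_left_cancel₀ hs h3
  · rcases le_or_gt 1 ‖z‖ with hz | hz
    · simp [aker_eq_zero hz]
    · rw [norm_mul, Real.norm_of_nonneg (aker_nonneg z)]
      refine mul_le_mul_of_nonneg_left ?_ (aker_nonneg z)
      have hmem : x + t • z ∈ Metric.closedBall x (|s| + 1) := by
        rw [Metric.mem_closedBall, dist_self_add_left, norm_smul, Real.norm_eq_abs]
        have : |t| ≤ |s| + 1 := by
          rw [Metric.mem_ball, Real.dist_eq] at ht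
          have := abs_sub_abs_le_abs_sub t s
          linarith
        nlinarith [norm_nonneg z, abs_nonneg t]
      have hCz := hC _ hmem
      have := (fderiv ℝ f (x + t • z)).le_opNorm z
      nlinarith [norm_nonneg z, norm_nonneg (fderiv ℝ f (x + t • z))]
  · have h1 : HasDerivAt (fun t : ℝ => x + t • z) z t := by
      simpa using ((hasDerivAt_id t).smul_const z).const_add x
    exact ((((hf.differentiable (by norm_num)) (x + t • z)).hasFDerivAt).comp_hasDerivAt t h1).const_mul
      (aker z)

theorem continuous_avg {f : Euc n → ℝ} (hf : Continuous f) (x : Euc n) :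
    Continuous (fun s => avg s f x) := by
  have h : (fun s => avg s f x) =
      fun s => ∫ z in Metric.closedBall (0 : Euc n) 1, aker z * f (x + s • z) := by
    ext s
    refine (setIntegral_eq_integral_of_forall_compl_eq_zero fun z hz => ?_).symm
    simp only [Metric.mem_closedBall, dist_zero_right, not_le] at hz
    simp [aker_eq_zero hz.le]
  rw [h]
  refine continuous_parametric_integral_of_continuous ?_ (isCompact_closedBall 0 1)
  exact (continuous_aker.comp continuous_snd).mul (hf.comp (by fun_prop))

/-- Averaging differs from the identity by the time step times the Laplacian. -/
theorem abs_avg_sub_le {f : Euc n → ℝ} (hf : ContDiff ℝ 2 f) {x : Euc n} {h c ε : ℝ} (hh : 0 < h)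
    (hc : ∀ y ∈ Metric.closedBall x h, |lap f y - c| ≤ ε) :
    |avg h f x - f x - stp n h * c| ≤ stp n h * ε := by
  have havg0 : avg 0 f x = f x := by
    simp [avg, integral_mul_const, integral_aker]
  have hbd : ∀ s ∈ Ioo 0 h, |(∫ z, pot z * lap f (x + s • z)) - potMass n * c| ≤ potMass n * ε := by
    intro s hs
    have hi : Integrable (fun z => pot z * lap f (x + s • z)) :=
      (continuous_pot.mul ((continuous_lap hf).comp (by fun_prop))).integrable_of_hasCompactSupport
        hasCompactSupport_pot.mul_right
    rw [potMass, ← integral_mul_const, ← integral_mul_const, ← integral_sub hi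
      (integrable_pot.mul_const c), ← Real.norm_eq_abs]
    refine norm_integral_le_of_norm_le (integrable_pot.mul_const ε) (Eventually.of_forall fun z => ?_)
    rcases le_or_gt 1 ‖z‖ with hz | hz
    · simp [pot_eq_zero hz]
    · rw [← mul_sub, norm_mul, Real.norm_of_nonneg (pot_nonneg z)]
      refine mul_le_mul_of_nonneg_left (hc _ ?_) (pot_nonneg z)
      rw [Metric.mem_closedBall, dist_self_add_left, norm_smul, Real.norm_of_nonneg hs.1.le]
      nlinarith [hs.1, hs.2, norm_nonneg z]
  have hder : ∀ (k : ℝ), ∀ s ∈ Ioo 0 h, HasDerivAt (fun s => avg s f x - potMass n * k * s ^ 2 / 2)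
      (s * ((∫ z, pot z * lap f (x + s • z)) - potMass n * k)) s := by
    intro k s hs
    have h1 := (hasDerivAt_avg hf x hs.1.ne').sub
      (((hasDerivAt_pow 2 s).const_mul (potMass n * k)).div_const 2)
    refine h1.congr_deriv ?_
    simp
    ring
  have hcont : ∀ k : ℝ, ContinuousOn (fun s => avg s f x - potMass n * k * s ^ 2 / 2) (Icc 0 h) :=
    fun k => ((continuous_avg hf.continuous x).sub (by fun_prop)).continuousOn
  have hmono := monotoneOn_of_deriv_nonneg (convex_Icc 0 h) (hcont (c - ε))
    (fun s hs => (hder _ s (interior_Icc (a := (0:ℝ)) ▸ hs)).differentiableAt.differentiableWithinAt)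
    (fun s hs => by
      rw [interior_Icc] at hs
      rw [(hder _ s hs).deriv]
      have := (abs_le.mp (hbd s hs)).1
      exact mul_nonneg hs.1.le (by linarith))
  have hanti := antitoneOn_of_deriv_nonpos (convex_Icc 0 h) (hcont (c + ε))
    (fun s hs => (hder _ s (interior_Icc (a := (0:ℝ)) ▸ hs)).differentiableAt.differentiableWithinAt)
    (fun s hs => by
      rw [interior_Icc] at hs
      rw [(hder _ s hs).deriv]
      have := (abs_le.mp (hbd s hs)).2
      exact mul_nonpos_of_nonneg_of_nonpos hs.1.le (by linarith))
  have h1 := hmono (left_mem_Icc.mpr hh.le) (right_mem_Icc.mpr hh.le) hh.le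
  have h2 := hanti (left_mem_Icc.mpr hh.le) (right_mem_Icc.mpr hh.le) hh.le
  simp only [havg0] at h1 h2
  unfold stp
  rw [abs_le]
  constructor <;> nlinarith

end Kernel

section Averages

variable {n : ℕ}

theorem measurable_avg {U : Euc n → ℝ} (hU : Measurable U) (h : ℝ) : Measurable (avg h U) := by
  have : StronglyMeasurable (fun w : Euc n × Euc n => aker w.2 * U (w.1 + h • w.2)) :=
    ((continuous_aker.measurable.comp measurable_snd).mul
      (hU.comp (by fun_prop))).stronglyMeasurable
  exact this.integral_prod_right.measurable

theorem avg_mono {U V : Euc n → ℝ} (hU : Measurable U) (hV : Measurable V) {M : ℝ}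
    (hUM : ∀ x, |U x| ≤ M) (hVM : ∀ x, |V x| ≤ M) {h : ℝ} {x y : Euc n}
    (hle : ∀ z : Euc n, ‖z‖ ≤ 1 → U (x + h • z) ≤ V (y + h • z)) : avg h U x ≤ avg h V y := by
  refine integral_mono (integrable_aker_mul hU hUM h x) (integrable_aker_mul hV hVM h y) fun z => ?_
  rcases le_or_gt 1 ‖z‖ with hz | hz
  · simp [aker_eq_zero hz]
  · exact mul_le_mul_of_nonneg_left (hle z hz.le) (aker_nonneg z)

theorem avg_const (h c : ℝ) (x : Euc n) : avg h (fun _ => c) x = c := by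
  simp [avg, integral_mul_const, integral_aker]

theorem avg_nonneg {U : Euc n → ℝ} (hU : ∀ x, 0 ≤ U x) (h : ℝ) (x : Euc n) : 0 ≤ avg h U x :=
  integral_nonneg fun z => mul_nonneg (aker_nonneg z) (hU _)

theorem avg_le {U : Euc n → ℝ} (hU : Measurable U) {M c : ℝ}
    (hUM : ∀ x, |U x| ≤ M) {h : ℝ} {x : Euc n}
    (hle : ∀ z : Euc n, ‖z‖ ≤ 1 → U (x + h • z) ≤ c) : avg h U x ≤ c := by
  have := avg_mono hU (measurable_const (a := c)) (M := max M |c|)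
    (fun x => (hUM x).trans (le_max_left _ _)) (fun _ => le_max_right _ _) (y := x) hle
  rwa [avg_const] at this

theorem avg_linear {U V : Euc n → ℝ} (hU : Measurable U) (hV : Measurable V) {M : ℝ}
    (hUM : ∀ x, |U x| ≤ M) (hVM : ∀ x, |V x| ≤ M) (α β h : ℝ) (x : Euc n) :
    avg h (fun y => α * U y + β * V y) x = α * avg h U x + β * avg h V x := by
  unfold avg
  rw [← integral_const_mul, ← integral_const_mul, ← integral_add
    ((integrable_aker_mul hU hUM h x).const_mul α) ((integrable_aker_mul hV hVM h x).const_mul β)]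
  congr 1
  ext z
  ring

theorem abs_avg_sub_avg_le {U : Euc n → ℝ} (hU : Measurable U) {M d : ℝ}
    (hUM : ∀ x, |U x| ≤ M) {h : ℝ} {x y : Euc n}
    (hd : ∀ z : Euc n, ‖z‖ ≤ 1 → |U (x + h • z) - U (y + h • z)| ≤ d) :
    |avg h U x - avg h U y| ≤ d := by
  have key : ∀ x y : Euc n, (∀ z : Euc n, ‖z‖ ≤ 1 → |U (x + h • z) - U (y + h • z)| ≤ d) →
      avg h U x ≤ avg h U y + d := by
    intro x y hd
    have h1 := avg_mono (V := fun y => 1 * U y + d * 1) hU (by fun_prop) (M := M + |d|)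
      (fun x => (hUM x).trans (by linarith [abs_nonneg d]))
      (fun x => (abs_add_le _ _).trans (by simpa using hUM x)) (x := x) (y := y)
      (fun z hz => by linarith [(abs_le.mp (hd z hz)).2])
    have h2 := avg_linear hU (measurable_const (a := (1:ℝ))) (M := max M 1)
      (fun x => (hUM x).trans (le_max_left _ _)) (fun x => by simp) 1 d h y
    rw [avg_const] at h2
    linarith
  rw [abs_le]
  constructor
  · linarith [key y x fun z hz => by rw [abs_sub_comm]; exact hd z hz]
  · linarith [key x y hd]

theorem abs_avg_sub_const_le {U : Euc n → ℝ} (hU : Measurable U) {M d c : ℝ}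
    (hUM : ∀ x, |U x| ≤ M) {h : ℝ} {x : Euc n}
    (hd : ∀ z : Euc n, ‖z‖ ≤ 1 → |U (x + h • z) - c| ≤ d) : |avg h U x - c| ≤ d := by
  have h1 : avg h U x - c = ∫ z, aker z * (U (x + h • z) - c) := by
    simp only [mul_sub]
    rw [integral_sub (integrable_aker_mul hU hUM h x) (integrable_aker.mul_const c),
      integral_mul_const, integral_aker, one_mul]
    rfl
  have h2 : d = ∫ z : Euc n, aker z * d := by rw [integral_mul_const, integral_aker, one_mul]
  rw [h1, h2, ← Real.norm_eq_abs]
  refine norm_integral_le_of_norm_le (integrable_aker.mul_const d) (Eventually.of_forall fun z => ?_)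
  rcases le_or_gt 1 ‖z‖ with hz | hz
  · simp [aker_eq_zero hz]
  · rw [norm_mul, Real.norm_of_nonneg (aker_nonneg z)]
    exact mul_le_mul_of_nonneg_left (hd z hz.le) (aker_nonneg z)

/-- Multiplying by a bump function turns an interior `C²` function into a global one. -/
theorem contDiff_bump_mul {f : Euc n → ℝ} {Ω : Set (Euc n)} (hΩ : IsOpen Ω)
    (hf : ContDiffOn ℝ 2 f Ω) {χ : Euc n → ℝ} (hχ : ContDiff ℝ 2 χ) (hs : tsupport χ ⊆ Ω) :
    ContDiff ℝ 2 (fun y => χ y * f y) := by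
  rw [contDiff_iff_contDiffAt]
  intro y
  by_cases hy : y ∈ tsupport χ
  · exact hχ.contDiffAt.mul (hf.contDiffAt (hΩ.mem_nhds (hs hy)))
  · have h0 : χ =ᶠ[𝓝 y] fun _ => 0 := notMem_tsupport_iff_eventuallyEq.mp hy
    refine (contDiffAt_const (c := (0:ℝ))).congr_of_eventuallyEq ?_
    filter_upwards [h0] with z hz
    simp [hz]

/-- Approximate mean value inequality for eigenfunctions. -/
theorem avg_le_of_eigen {φ : Euc n → ℝ} {Ω : Set (Euc n)} (hΩ : IsOpen Ω)
    (hφ : ContDiffOn ℝ 2 φ Ω) {lam : ℝ} (heq : ∀ x ∈ Ω, lap φ x + lam * φ x = 0) {x : Euc n}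
    {h ε : ℝ} (hh : 0 < h) (hx : Metric.ball x (2 * h) ⊆ Ω)
    (hε : ∀ y ∈ Metric.closedBall x h, |lam * φ y - lam * φ x| ≤ ε) :
    avg h φ x ≤ φ x - stp n h * (lam * φ x) + stp n h * ε := by
  let χ : ContDiffBump x := ⟨5 / 4 * h, 3 / 2 * h, by linarith, by linarith⟩
  have hs : tsupport χ ⊆ Ω := by
    rw [χ.tsupport_eq]
    exact (Metric.closedBall_subset_ball (by change 3 / 2 * h < 2 * h; linarith)).trans hx
  have hc : ContDiff ℝ 2 (fun y => χ y * φ y) := contDiff_bump_mul hΩ hφ χ.contDiff hs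
  have hone : ∀ y ∈ Metric.closedBall x h, (fun y => χ y * φ y) =ᶠ[𝓝 y] φ := by
    intro y hy
    have : Metric.ball x (5 / 4 * h) ∈ 𝓝 y := Metric.isOpen_ball.mem_nhds
      (Metric.closedBall_subset_ball (by linarith) hy)
    filter_upwards [this] with z hz
    rw [χ.one_of_mem_closedBall (Metric.ball_subset_closedBall hz), one_mul]
  have hxm : x ∈ Metric.closedBall x h := Metric.mem_closedBall_self hh.le
  have h1 := abs_avg_sub_le hc (x := x) (c := -(lam * φ x)) (ε := ε) hh (fun y hy => by
    rw [lap_congr (hone y hy)]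
    have hyΩ : y ∈ Ω := hx (Metric.closedBall_subset_ball (by linarith) hy)
    have h2 := heq y hyΩ
    have h3 := hε y hy
    rw [abs_sub_comm] at h3
    rwa [show lap φ y - -(lam * φ x) = lam * φ x - lam * φ y by linarith])
  have h2 : avg h (fun y => χ y * φ y) x = avg h φ x := by
    unfold avg
    congr 1
    ext z
    rcases le_or_gt 1 ‖z‖ with hz | hz
    · simp [aker_eq_zero hz]
    · have hm : x + h • z ∈ Metric.closedBall x h := by
        rw [Metric.mem_closedBall, dist_self_add_left, norm_smul, Real.norm_of_nonneg hh.le]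
        nlinarith
      have := (hone _ hm).eq_of_nhds
      exact congrArg _ this
  have h3 := (hone x hxm).eq_of_nhds
  rw [h2, h3] at h1
  have := (abs_le.mp h1).2
  linarith

/-- The average of a quadratic is at most the quadratic plus the square of the radius. -/
theorem integral_aker_mul_quadratic_le (h : ℝ) (x x₀ : Euc n) :
    ∫ z, aker z * ‖x + h • z - x₀‖ ^ 2 ≤ ‖x - x₀‖ ^ 2 + h ^ 2 := by
  have hi : ∀ f : Euc n → ℝ, Continuous f → Integrable (fun z => aker z * f z) := fun f hf =>
    (continuous_aker.mul hf).integrable_of_hasCompactSupport hasCompactSupport_aker.mul_right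
  have hodd : ∫ z : Euc n, aker z * inner ℝ (x - x₀) z = 0 := by
    have h1 := integral_neg_eq_self (fun z : Euc n => aker z * inner ℝ (x - x₀) z) volume
    simp only [aker_neg, inner_neg_right, mul_neg, integral_neg] at h1
    linarith
  have h2 : ∀ z : Euc n, aker z * ‖x + h • z - x₀‖ ^ 2 ≤
      aker z * (‖x - x₀‖ ^ 2 + h ^ 2) + 2 * h * (aker z * inner ℝ (x - x₀) z) := by
    intro z
    rcases le_or_gt 1 ‖z‖ with hz | hz
    · simp [aker_eq_zero hz]
    · have h3 : x + h • z - x₀ = (x - x₀) + h • z := by abel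
      have h4 : ‖x + h • z - x₀‖ ^ 2 = ‖x - x₀‖ ^ 2 + 2 * (h * inner ℝ (x - x₀) z) +
          h ^ 2 * ‖z‖ ^ 2 := by
        rw [h3, norm_add_sq_real, inner_smul_right, norm_smul, mul_pow, Real.norm_eq_abs, sq_abs]
      have h5 : ‖z‖ ^ 2 ≤ 1 := by nlinarith [norm_nonneg z]
      have h6 : h ^ 2 * ‖z‖ ^ 2 ≤ h ^ 2 := by nlinarith [sq_nonneg h]
      rw [h4]
      nlinarith [aker_nonneg z]
  calc _ ≤ ∫ z : Euc n, (aker z * (‖x - x₀‖ ^ 2 + h ^ 2) +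
        2 * h * (aker z * inner ℝ (x - x₀) z)) :=
        integral_mono (hi _ (by fun_prop)) ((hi _ (by fun_prop)).add
          ((hi _ (by fun_prop)).const_mul _)) h2
    _ = _ := by
        rw [integral_add (hi _ (by fun_prop)) ((hi _ (by fun_prop)).const_mul _),
          integral_const_mul, hodd, integral_mul_const, integral_aker]
        ring

end Averages

/-- Data of the reaction problem, extended by zero outside `Ω`, together with the barrier
`β φ e^{-lam t}`; the reaction term is `R t u (∫ u ^ p)`. -/
structure Scheme (n : ℕ) where
  (Ω : Set (Euc n)) (φ u0 : Euc n → ℝ) (lam β Φ p : ℝ) (R : ℝ → ℝ → ℝ → ℝ)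
  isOpen : IsOpen Ω
  bdd : Bornology.IsBounded Ω
  cont_φ : Continuous φ
  φ_nonneg : ∀ x, 0 ≤ φ x
  φ_zero : ∀ x, x ∉ Ω → φ x = 0
  φ_le : ∀ x, φ x ≤ Φ
  Φ_pos : 0 < Φ
  φ_c2 : ContDiffOn ℝ 2 φ Ω
  φ_eq : ∀ x ∈ Ω, lap φ x + lam * φ x = 0
  cont_u0 : Continuous u0
  u0_nonneg : ∀ x, 0 ≤ u0 x
  u0_le : ∀ x, u0 x ≤ β * φ x
  β_pos : 0 < β
  p_ge : 1 ≤ p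
  cont_R : Continuous (fun z : ℝ × ℝ × ℝ => R z.1 z.2.1 z.2.2)
  R_zero : ∀ t I, R t 0 I = 0
  R_lip : ∀ T M : ℝ, ∃ L : ℝ, 0 ≤ L ∧ ∀ t ∈ Icc 0 T, ∀ I ∈ Icc 0 M, ∀ w ∈ Icc 0 M,
    ∀ w' ∈ Icc 0 M, |R t w I - R t w' I| ≤ L * |w - w'|
  R_nonpos : ∀ t w I, 0 ≤ t → 0 ≤ w → w ≤ 2 * β * Φ * exp (-lam * t) → 0 ≤ I →
    I ≤ volume.real Ω * (2 * β * Φ * exp (-lam * t)) ^ p → R t w I ≤ 0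

namespace Scheme

variable {n : ℕ} (S : Scheme n)

/-- Points of `Ω` at distance at least `2h` from the complement. -/
def inn (h : ℝ) : Set (Euc n) := {x | Metric.ball x (2 * h) ⊆ S.Ω}

/-- The total mass entering the nonlocal term. -/
def mass (U : Euc n → ℝ) : ℝ := ∫ y in S.Ω, U y ^ S.p

open Classical in
/-- The explicit scheme: averaging, reaction, and extension by zero. -/
def U (h : ℝ) : ℕ → Euc n → ℝ
  | 0 => fun x => if x ∈ S.inn h then S.u0 x else 0
  | k + 1 => fun x => if x ∈ S.inn h then
      avg h (U h k) x + stp n h * S.R (k * stp n h) (avg h (U h k) x) (S.mass (U h k)) else 0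

variable {S}

theorem isClosed_inn (h : ℝ) : IsClosed (S.inn h) := by
  have : (S.inn h)ᶜ = ⋃ z ∈ S.Ωᶜ, Metric.ball z (2 * h) := by
    ext x
    simp only [inn, mem_compl_iff, mem_ofPred_eq, not_subset, mem_iUnion, Metric.mem_ball, exists_prop]
    constructor
    · rintro ⟨z, h1, h2⟩
      exact ⟨z, h2, by rwa [dist_comm]⟩
    · rintro ⟨z, h1, h2⟩
      exact ⟨z, by rwa [dist_comm], h1⟩
  rw [← isOpen_compl_iff, this]
  exact isOpen_biUnion fun z _ => Metric.isOpen_ball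

theorem U_of_notMem {h : ℝ} {x : Euc n} (hx : x ∉ S.inn h) (k : ℕ) : S.U h k x = 0 := by
  cases k <;> simp [U, hx]

theorem U_zero {h : ℝ} {x : Euc n} (hx : x ∈ S.inn h) : S.U h 0 x = S.u0 x := by
  simp [U, hx]

theorem U_succ {h : ℝ} {x : Euc n} (hx : x ∈ S.inn h) (k : ℕ) : S.U h (k + 1) x =
      avg h (S.U h k) x + stp n h * S.R (k * stp n h) (avg h (S.U h k) x) (S.mass (S.U h k)) := by
  simp [U, hx]

theorem mem_of_mem_inn {h : ℝ} (hh : 0 < h) {x : Euc n} (hx : x ∈ S.inn h) : x ∈ S.Ω :=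
  hx (Metric.mem_ball_self (by linarith))

theorem measurable_U (h : ℝ) (k : ℕ) : Measurable (S.U h k) := by
  classical
  induction k with
  | zero => exact Measurable.ite (isClosed_inn h).measurableSet S.cont_u0.measurable measurable_const
  | succ k ih =>
    refine Measurable.ite (isClosed_inn h).measurableSet ?_ measurable_const
    have hm := measurable_avg ih h
    refine hm.add (measurable_const.mul ?_)
    exact S.cont_R.measurable.comp (measurable_const.prodMk (hm.prodMk measurable_const))

theorem volume_ne_top : volume S.Ω ≠ ⊤ := S.bdd.measure_lt_top.ne

/-- The uniform bound for the scheme at time `t`. -/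
def mb (S : Scheme n) (t : ℝ) : ℝ := 2 * S.β * S.Φ * exp (-S.lam * t)

theorem mb_pos (t : ℝ) : 0 < S.mb t := by
  have := S.β_pos
  have := S.Φ_pos
  unfold mb; positivity

theorem mass_nonneg {U : Euc n → ℝ} (h0 : ∀ x, 0 ≤ U x) : 0 ≤ S.mass U :=
  integral_nonneg fun x => rpow_nonneg (h0 x) _

theorem mass_le {U : Euc n → ℝ} {M : ℝ} (h0 : ∀ x, 0 ≤ U x)
    (hM : ∀ x, U x ≤ M) : S.mass U ≤ volume.real S.Ω * M ^ S.p := by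
  have h := norm_setIntegral_le_of_norm_le_const (μ := volume) (s := S.Ω) (f := fun y => U y ^ S.p)
    (C := M ^ S.p) S.bdd.measure_lt_top (fun x _ => by
    rw [Real.norm_of_nonneg (rpow_nonneg (h0 x) _)]
    exact rpow_le_rpow (h0 x) (hM x) (by linarith [S.p_ge]))
  rw [mul_comm]
  exact (le_abs_self _).trans h

/-- A bound for all quantities entering the reaction up to time `T`. -/
def bigM (S : Scheme n) (T : ℝ) : ℝ :=
  max (2 * S.β * S.Φ * exp (|S.lam| * T))
    (volume.real S.Ω * (2 * S.β * S.Φ * exp (|S.lam| * T)) ^ S.p)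

theorem mb_le {t T : ℝ} (ht : 0 ≤ t) (htT : t ≤ T) :
    S.mb t ≤ 2 * S.β * S.Φ * exp (|S.lam| * T) := by
  have := S.β_pos
  have := S.Φ_pos
  unfold mb
  gcongr
  nlinarith [neg_abs_le S.lam, abs_nonneg S.lam]

theorem mb_le_bigM {t T : ℝ} (ht : 0 ≤ t) (htT : t ≤ T) : S.mb t ≤ S.bigM T :=
  (mb_le ht htT).trans (le_max_left _ _)

theorem bigM_pos {T : ℝ} (hT : 0 ≤ T) : 0 < S.bigM T := (mb_pos 0).trans_le (mb_le_bigM le_rfl hT)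

theorem mass_le_bigM {t T : ℝ} (ht : 0 ≤ t) (htT : t ≤ T) {U : Euc n → ℝ} (h0 : ∀ x, 0 ≤ U x)
    (hM : ∀ x, U x ≤ S.mb t) : S.mass U ≤ S.bigM T := by
  refine (mass_le h0 fun x => (hM x).trans (mb_le ht htT)).trans (le_max_right _ _)

theorem tendsto_stp : Tendsto (stp n) (𝓝[>] 0) (𝓝 0) := by
  have : Continuous (stp n) := by unfold stp; fun_prop
  have h := this.tendsto 0
  simp only [stp, ne_eq, OfNat.ofNat_ne_zero, not_false_eq_true, zero_pow, mul_zero, zero_div] at h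
  exact h.mono_left nhdsWithin_le_nhds

theorem hasCompactSupport_of_zero {f : Euc n → ℝ} (hf : ∀ x, x ∉ S.Ω → f x = 0) :
    HasCompactSupport f :=
  HasCompactSupport.intro (S.bdd.isCompact_closure) fun x hx => hf x fun h => hx (subset_closure h)

theorem u0_zero (S : Scheme n) (x : Euc n) (hx : x ∉ S.Ω) : S.u0 x = 0 := by
  have := S.u0_le x
  rw [S.φ_zero x hx, mul_zero] at this
  exact le_antisymm this (S.u0_nonneg x)

theorem exists_delta {f : Euc n → ℝ} (hfc : Continuous f) (hf : ∀ x, x ∉ S.Ω → f x = 0) {ε : ℝ}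
    (hε : 0 < ε) : ∃ δ > 0, ∀ x y, dist x y < δ → |f x - f y| ≤ ε := by
  have h := (hasCompactSupport_of_zero hf).uniformContinuous_of_continuous hfc
  obtain ⟨δ, hδ, h⟩ := Metric.uniformContinuous_iff.mp h ε hε
  exact ⟨δ, hδ, fun x y hxy => (h hxy).le⟩

/-- The barrier bound for the scheme. -/
theorem eventually_bound {T ε : ℝ} (hT : 0 < T) (hε : 0 < ε) : ∀ᶠ h in 𝓝[>] 0, ∀ k : ℕ,
    k * stp n h ≤ T → ∀ x, 0 ≤ S.U h k x ∧
      S.U h k x ≤ S.β * S.φ x * exp (-S.lam * (k * stp n h)) + ε ∧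
      S.U h k x ≤ S.mb (k * stp n h) := by
  have hβ := S.β_pos
  have hΦ := S.Φ_pos
  set ε' := min ε (S.β * S.Φ * exp (-(|S.lam| * T))) with hε'
  have hε'0 : 0 < ε' := lt_min hε (by positivity)
  set κ := ε' / T with hκ
  have hκ0 : 0 < κ := by positivity
  set η := κ / (S.β * exp (|S.lam| * T)) with hη
  have hη0 : 0 < η := by positivity
  obtain ⟨δ, hδ, hδφ⟩ := exists_delta (S := S) (f := fun x => S.lam * S.φ x)
    (continuous_const.mul S.cont_φ) (fun x hx => by simp [S.φ_zero x hx]) hη0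
  obtain ⟨L, hL0, hL⟩ := S.R_lip T (S.bigM T)
  have hM := bigM_pos (S := S) hT.le
  have e1 : ∀ᶠ h : ℝ in 𝓝[>] 0, h < δ := (gt_mem_nhds hδ).filter_mono nhdsWithin_le_nhds
  have e2 : ∀ᶠ h : ℝ in 𝓝[>] 0, stp n h * L < 1 := by
    have := (tendsto_stp (n := n)).mul_const L
    rw [zero_mul] at this
    exact this.eventually (gt_mem_nhds one_pos)
  filter_upwards [e1, e2, self_mem_nhdsWithin] with h hhδ hτL hh0
  have hh : 0 < h := hh0
  have hτ : 0 < stp n h := stp_pos hh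
  set τ := stp n h
  have strong : ∀ k : ℕ, k * τ ≤ T → ∀ x, S.U h k x ≤ S.β * S.φ x * exp (-S.lam * (k * τ)) +
      κ * (k * τ) → (S.U h k x ≤ S.β * S.φ x * exp (-S.lam * (k * τ)) + ε ∧
      S.U h k x ≤ S.mb (k * τ)) := by
    intro k hk x hx
    have hk0 : 0 ≤ k * τ := by positivity
    have h1 : κ * (k * τ) ≤ ε' := by
      rw [hκ, div_mul_eq_mul_div, div_le_iff₀ hT]; gcongr
    have h2 : exp (-(|S.lam| * T)) ≤ exp (-S.lam * (k * τ)) := by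
      gcongr
      nlinarith [le_abs_self S.lam, abs_nonneg S.lam]
    have h3 : ε' ≤ S.β * S.Φ * exp (-S.lam * (k * τ)) := (min_le_right _ _).trans (by gcongr)
    have h4 : S.β * S.φ x * exp (-S.lam * (k * τ)) ≤ S.β * S.Φ * exp (-S.lam * (k * τ)) := by
      gcongr; exact S.φ_le x
    refine ⟨by linarith [min_le_left ε (S.β * S.Φ * exp (-(|S.lam| * T)))], ?_⟩
    unfold mb; linarith
  suffices H : ∀ k : ℕ, k * τ ≤ T → ∀ x, 0 ≤ S.U h k x ∧
      S.U h k x ≤ S.β * S.φ x * exp (-S.lam * (k * τ)) + κ * (k * τ) from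
    fun k hk x => ⟨(H k hk x).1, strong k hk x (H k hk x).2⟩
  intro k
  induction k with
  | zero =>
    intro _ x
    by_cases hx : x ∈ S.inn h
    · simpa [U_zero hx] using ⟨S.u0_nonneg x, S.u0_le x⟩
    · simpa [U_of_notMem hx] using mul_nonneg hβ.le (S.φ_nonneg x)
  | succ k ih =>
    intro hk x
    push_cast at hk ⊢
    have hkτ : k * τ ≤ T := by nlinarith
    have hk0 : 0 ≤ k * τ := by positivity
    have ih := ih hkτ
    by_cases hx : x ∈ S.inn h
    swap
    · rw [U_of_notMem hx]
      have := S.φ_nonneg x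
      exact ⟨le_rfl, by positivity⟩
    rw [U_succ hx]
    have hU0 : ∀ y, 0 ≤ S.U h k y := fun y => (ih y).1
    have hUM : ∀ y, S.U h k y ≤ S.mb (k * τ) := fun y => (strong k hkτ y (ih y).2).2
    have hUa : ∀ y, |S.U h k y| ≤ S.mb (k * τ) := fun y => by rw [abs_of_nonneg (hU0 y)]; exact hUM y
    set w := avg h (S.U h k) x with hw
    have hw0 : 0 ≤ w := avg_nonneg hU0 h x
    have hwM : w ≤ S.mb (k * τ) := avg_le (measurable_U h k) hUa fun z _ => hUM _
    have hI0 := mass_nonneg (S := S) hU0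
    have hRn : S.R (k * τ) w (S.mass (S.U h k)) ≤ 0 :=
      S.R_nonpos _ _ _ hk0 hw0 hwM hI0 (mass_le hU0 hUM)
    have hRl := hL (k * τ) ⟨hk0, hkτ⟩ (S.mass (S.U h k)) ⟨hI0, mass_le_bigM hk0 hkτ hU0 hUM⟩
      w ⟨hw0, hwM.trans (mb_le_bigM hk0 hkτ)⟩ 0 ⟨le_rfl, hM.le⟩
    rw [S.R_zero, sub_zero, sub_zero, abs_of_nonneg hw0] at hRl
    have hRl' := (abs_le.mp hRl).1
    constructor
    · nlinarith
    have hwφ : w ≤ S.β * exp (-S.lam * (k * τ)) * avg h S.φ x + κ * (k * τ) := by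
      have hb : ∀ y, |S.φ y| ≤ max S.Φ 1 := fun y => by
        rw [abs_of_nonneg (S.φ_nonneg y)]; exact (S.φ_le y).trans (le_max_left _ _)
      have h1 := avg_linear S.cont_φ.measurable (measurable_const (a := (1:ℝ))) hb
        (fun _ => by simp) (S.β * exp (-S.lam * (k * τ))) (κ * (k * τ)) h x
      simp only [avg_const, mul_one] at h1
      rw [← h1, hw]
      have hv : ∀ y, |S.β * exp (-S.lam * (k * τ)) * S.φ y + κ * (k * τ)| ≤
          S.β * exp (-S.lam * (k * τ)) * S.Φ + κ * (k * τ) := fun y => by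
        have := S.φ_nonneg y
        rw [abs_of_nonneg (by positivity)]
        gcongr
        exact S.φ_le y
      refine avg_mono (V := fun y => S.β * exp (-S.lam * (k * τ)) * S.φ y + κ * (k * τ))
        (M := max (S.mb (k * τ)) (S.β * exp (-S.lam * (k * τ)) * S.Φ + κ * (k * τ)))
        (measurable_U h k) ((continuous_const.mul S.cont_φ).add continuous_const).measurable
        (fun y => (hUa y).trans (le_max_left _ _))
        (fun y => (hv y).trans (le_max_right _ _)) fun z _ => ?_
      have := (ih (x + h • z)).2
      linarith
    have hmv := avg_le_of_eigen S.isOpen S.φ_c2 S.φ_eq hh hx (ε := η) (fun y hy =>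
      hδφ y x (lt_of_le_of_lt hy hhδ))
    change avg h S.φ x ≤ S.φ x - τ * (S.lam * S.φ x) + τ * η at hmv
    have hexp : exp (-S.lam * (k * τ)) * (1 - τ * S.lam) ≤ exp (-S.lam * ((k + 1) * τ)) := by
      have h1 := add_one_le_exp (-S.lam * τ)
      calc _ ≤ exp (-S.lam * (k * τ)) * exp (-S.lam * τ) := by gcongr; linarith
        _ = _ := by rw [← exp_add]; ring_nf
    have hη' : S.β * exp (-S.lam * (k * τ)) * η ≤ κ := by
      have h2 : exp (-S.lam * (k * τ)) ≤ exp (|S.lam| * T) := by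
        gcongr
        nlinarith [neg_abs_le S.lam, abs_nonneg S.lam]
      calc _ ≤ S.β * exp (|S.lam| * T) * η := by gcongr
        _ = κ := by rw [hη]; field_simp
    have h5 : S.β * exp (-S.lam * (k * τ)) * avg h S.φ x ≤
        S.β * exp (-S.lam * (k * τ)) * (S.φ x - τ * (S.lam * S.φ x) + τ * η) := by gcongr
    have h6 : S.β * S.φ x * (exp (-S.lam * (k * τ)) * (1 - τ * S.lam)) ≤
        S.β * S.φ x * exp (-S.lam * ((k + 1) * τ)) := by
      have := S.φ_nonneg x
      gcongr
    have h7 : τ * (S.β * exp (-S.lam * (k * τ)) * η) ≤ τ * κ := by gcongr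
    have h8 : τ * S.R (k * τ) w (S.mass (S.U h k)) ≤ 0 := mul_nonpos_of_nonneg_of_nonpos hτ.le hRn
    nlinarith

end Scheme

namespace Scheme

variable {n : ℕ} {S : Scheme n}

/-- Bounds on the reaction term along the scheme. -/
theorem eventually_reaction {T : ℝ} (hT : 0 < T) : ∃ L : ℝ, 0 ≤ L ∧ ∀ᶠ h in 𝓝[>] 0, ∀ k : ℕ,
    k * stp n h ≤ T → (∀ x, |S.U h k x| ≤ S.bigM T) ∧
      (∀ x, 0 ≤ avg h (S.U h k) x ∧ avg h (S.U h k) x ≤ S.bigM T) ∧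
      (0 ≤ S.mass (S.U h k) ∧ S.mass (S.U h k) ≤ S.bigM T) ∧
      (∀ x, |S.R (k * stp n h) (avg h (S.U h k) x) (S.mass (S.U h k))| ≤ L * S.bigM T) ∧
      ∀ x y, |S.R (k * stp n h) (avg h (S.U h k) x) (S.mass (S.U h k)) -
        S.R (k * stp n h) (avg h (S.U h k) y) (S.mass (S.U h k))| ≤
        L * |avg h (S.U h k) x - avg h (S.U h k) y| := by
  obtain ⟨L, hL0, hL⟩ := S.R_lip T (S.bigM T)
  have hM := bigM_pos (S := S) hT.le
  refine ⟨L, hL0, ?_⟩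
  filter_upwards [eventually_bound (S := S) hT one_pos, self_mem_nhdsWithin] with h hb hh0 k hk
  have hk0 : 0 ≤ k * stp n h := by
    have := stp_pos (n := n) (h := h) hh0
    positivity
  have hb := hb k hk
  have hU0 : ∀ y, 0 ≤ S.U h k y := fun y => (hb y).1
  have hUM : ∀ y, S.U h k y ≤ S.mb (k * stp n h) := fun y => (hb y).2.2
  have hUa : ∀ y, |S.U h k y| ≤ S.bigM T := fun y => by
    rw [abs_of_nonneg (hU0 y)]; exact (hUM y).trans (mb_le_bigM hk0 hk)
  have hw : ∀ x, 0 ≤ avg h (S.U h k) x ∧ avg h (S.U h k) x ≤ S.bigM T := fun x =>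
    ⟨avg_nonneg hU0 h x, avg_le (measurable_U h k) hUa fun z _ => (le_abs_self _).trans (hUa _)⟩
  have hI : 0 ≤ S.mass (S.U h k) ∧ S.mass (S.U h k) ≤ S.bigM T :=
    ⟨mass_nonneg hU0, mass_le_bigM hk0 hk hU0 hUM⟩
  refine ⟨hUa, hw, hI, fun x => ?_, fun x y => hL _ ⟨hk0, hk⟩ _ hI _ (hw x) _ (hw y)⟩
  have h1 := hL _ ⟨hk0, hk⟩ _ hI _ (hw x) 0 ⟨le_rfl, hM.le⟩
  rw [S.R_zero, sub_zero, sub_zero, abs_of_nonneg (hw x).1] at h1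
  exact h1.trans (mul_le_mul_of_nonneg_left (hw x).2 hL0)

/-- Equicontinuity of the scheme in space. -/
theorem eventually_space {T ε : ℝ} (hT : 0 < T) (hε : 0 < ε) : ∃ δ > 0, ∀ᶠ h in 𝓝[>] 0, ∀ k : ℕ,
    k * stp n h ≤ T → ∀ x y, dist x y < δ → |S.U h k x - S.U h k y| ≤ ε := by
  obtain ⟨L, hL0, hL⟩ := eventually_reaction (S := S) hT
  have hβ := S.β_pos
  set ε' := ε * exp (-(L * T)) with hε'
  have hε'0 : 0 < ε' := by positivity
  set C := S.β * exp (|S.lam| * T) with hC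
  obtain ⟨δ₁, hδ₁, hφ⟩ := exists_delta (S := S) (f := fun x => C * S.φ x)
    (continuous_const.mul S.cont_φ) (fun x hx => by simp [S.φ_zero x hx]) (half_pos hε'0)
  obtain ⟨δ₂, hδ₂, hu⟩ := exists_delta (S := S) S.cont_u0 S.u0_zero hε'0
  refine ⟨min (δ₁ / 2) δ₂, lt_min (half_pos hδ₁) hδ₂, ?_⟩
  have e1 : ∀ᶠ h : ℝ in 𝓝[>] 0, h < δ₁ / 4 :=
    (gt_mem_nhds (by linarith)).filter_mono nhdsWithin_le_nhds
  filter_upwards [e1, hL, eventually_bound (S := S) hT (half_pos hε'0), self_mem_nhdsWithin]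
    with h hhδ hL hb hh0
  have hh : 0 < h := hh0
  have hτ : 0 < stp n h := stp_pos hh
  set τ := stp n h
  have hpow : ∀ k : ℕ, 1 ≤ (1 + τ * L) ^ k := fun k => one_le_pow₀ (by nlinarith)
  have hbdry : ∀ k : ℕ, k * τ ≤ T → ∀ x y, x ∉ S.inn h → dist x y < min (δ₁ / 2) δ₂ →
      |S.U h k x - S.U h k y| ≤ ε' * (1 + τ * L) ^ k := by
    intro k hk x y hx hxy
    have hk0 : 0 ≤ k * τ := by positivity
    obtain ⟨z, hz1, hz2⟩ := not_subset.mp hx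
    have hd : dist y z < δ₁ := by
      rw [Metric.mem_ball, dist_comm] at hz1
      have := dist_triangle y x z
      rw [dist_comm y x] at this
      linarith [min_le_left (δ₁ / 2) δ₂]
    have h1 := (abs_le.mp (hφ y z hd)).2
    rw [S.φ_zero z hz2, mul_zero, sub_zero] at h1
    have h2 : S.β * S.φ y * exp (-S.lam * (k * τ)) ≤ C * S.φ y := by
      rw [hC, mul_right_comm]
      have := S.φ_nonneg y
      gcongr
      nlinarith [neg_abs_le S.lam, abs_nonneg S.lam]
    obtain ⟨h3, h4, -⟩ := hb k hk y
    rw [U_of_notMem hx, zero_sub, abs_neg, abs_of_nonneg h3]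
    have := hpow k
    nlinarith
  have main : ∀ k : ℕ, k * τ ≤ T → ∀ x y, dist x y < min (δ₁ / 2) δ₂ →
      |S.U h k x - S.U h k y| ≤ ε' * (1 + τ * L) ^ k := by
    intro k
    induction k with
    | zero =>
      intro hk x y hxy
      by_cases hx : x ∈ S.inn h
      swap
      · exact hbdry 0 hk x y hx hxy
      by_cases hy : y ∈ S.inn h
      swap
      · rw [abs_sub_comm]; exact hbdry 0 hk y x hy (by rwa [dist_comm])
      rw [U_zero hx, U_zero hy, pow_zero, mul_one]
      exact hu x y (hxy.trans_le (min_le_right _ _))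
    | succ k ih =>
      intro hk x y hxy
      by_cases hx : x ∈ S.inn h
      swap
      · exact hbdry (k + 1) hk x y hx hxy
      by_cases hy : y ∈ S.inn h
      swap
      · rw [abs_sub_comm]; exact hbdry (k + 1) hk y x hy (by rwa [dist_comm])
      push_cast at hk
      have hkτ : k * τ ≤ T := by nlinarith
      obtain ⟨hUa, -, -, -, hlip⟩ := hL k hkτ
      have hlip := hlip x y
      have hw : |avg h (S.U h k) x - avg h (S.U h k) y| ≤ ε' * (1 + τ * L) ^ k :=
        abs_avg_sub_avg_le (measurable_U h k) hUa fun z _ => ih hkτ _ _ (by simpa using hxy)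
      rw [U_succ hx, U_succ hy]
      set w := avg h (S.U h k) x
      set w' := avg h (S.U h k) y
      set r := S.R (k * stp n h) w (S.mass (S.U h k))
      set r' := S.R (k * stp n h) w' (S.mass (S.U h k))
      calc |w + τ * r - (w' + τ * r')| = |(w - w') + τ * (r - r')| := by ring_nf
        _ ≤ |w - w'| + τ * |r - r'| := by
            refine (abs_add_le _ _).trans ?_
            rw [abs_mul, abs_of_pos hτ]
        _ ≤ |w - w'| + τ * (L * |w - w'|) := by gcongr
        _ = |w - w'| * (1 + τ * L) := by ring
        _ ≤ ε' * (1 + τ * L) ^ k * (1 + τ * L) := by gcongr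
        _ = _ := by rw [pow_succ]; ring
  intro k hk x y hxy
  refine (main k hk x y hxy).trans ?_
  have h1 : (1 + τ * L) ^ k ≤ exp (L * T) := by
    calc (1 + τ * L) ^ k ≤ exp (τ * L) ^ k := by
          gcongr; linarith [add_one_le_exp (τ * L)]
      _ = exp (L * (k * τ)) := by rw [← exp_nat_mul]; ring_nf
      _ ≤ _ := by gcongr
  calc ε' * (1 + τ * L) ^ k ≤ ε' * exp (L * T) := by gcongr
    _ = ε := by rw [hε', mul_assoc, ← exp_add]; simp

/-- Equicontinuity of the scheme in time. -/
theorem eventually_time {T ε : ℝ} (hT : 0 < T) (hε : 0 < ε) : ∃ δ > 0, ∀ᶠ h in 𝓝[>] 0,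
    ∀ j m : ℕ, ((j + m : ℕ) : ℝ) * stp n h ≤ T → m * stp n h ≤ δ →
      ∀ x, |S.U h (j + m) x - S.U h j x| ≤ ε := by
  obtain ⟨L, hL0, hL⟩ := eventually_reaction (S := S) hT
  obtain ⟨δ, hδ, hsp⟩ := eventually_space (S := S) hT (half_pos hε)
  have hM := bigM_pos (S := S) hT.le
  set M := S.bigM T
  set Q := M / δ ^ 2 with hQ
  have hQ0 : 0 < Q := by positivity
  have hpm := potMass_pos (n := n)
  refine ⟨ε / 2 / (2 * Q / potMass n + L * M), by positivity, ?_⟩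
  filter_upwards [hL, hsp, eventually_bound (S := S) hT one_pos, self_mem_nhdsWithin]
    with h hL hsp hb hh0
  have hh : 0 < h := hh0
  have hτ : 0 < stp n h := stp_pos hh
  have hh2 : h ^ 2 = 2 * stp n h / potMass n := by unfold stp; field_simp
  set τ := stp n h
  intro j m hjm hmδ x₀
  have hquad : j * τ ≤ T → ∀ x, |S.U h j x - S.U h j x₀| ≤ ε / 2 + Q * ‖x - x₀‖ ^ 2 := by
    intro hj x
    rcases lt_or_ge (dist x x₀) δ with hd | hd
    · exact (hsp j hj x x₀ hd).trans (by linarith [mul_nonneg hQ0.le (sq_nonneg ‖x - x₀‖)])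
    · rw [dist_eq_norm] at hd
      have h1 : M ≤ Q * ‖x - x₀‖ ^ 2 := by
        rw [hQ, div_mul_eq_mul_div, le_div_iff₀ (by positivity)]; gcongr
      have h2 : ∀ y, 0 ≤ S.U h j y ∧ S.U h j y ≤ M := fun y =>
        ⟨(hb j hj y).1, (le_abs_self _).trans ((hL j hj).1 y)⟩
      rw [abs_le]
      constructor <;> linarith [(h2 x).1, (h2 x).2, (h2 x₀).1, (h2 x₀).2]
  have hj : j * τ ≤ T := by push_cast at hjm; nlinarith [m.cast_nonneg (α := ℝ)]
  have main : ∀ i : ℕ, ((j + i : ℕ) : ℝ) * τ ≤ T → ∀ x, |S.U h (j + i) x - S.U h j x₀| ≤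
      ε / 2 + Q * ‖x - x₀‖ ^ 2 + i * (Q * h ^ 2 + τ * (L * M)) := by
    intro i
    induction i with
    | zero => intro _ x; simpa using hquad hj x
    | succ i ih =>
      intro hi x
      rw [← add_assoc] at hi ⊢
      by_cases hx : x ∈ S.inn h
      swap
      · have h1 := hquad hj x
        rw [U_of_notMem hx] at h1 ⊢
        refine h1.trans ?_
        push_cast
        have : 0 ≤ ((i : ℝ) + 1) * (Q * h ^ 2 + τ * (L * M)) := by positivity
        linarith
      have hi' : ((j + i : ℕ) : ℝ) * τ ≤ T := by push_cast at hi ⊢; nlinarith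
      have ih := ih hi'
      obtain ⟨hUa, -, -, hRb, -⟩ := hL (j + i) hi'
      have hRb := hRb x
      rw [U_succ hx]
      set c := S.U h j x₀
      set B := ε / 2 + i * (Q * h ^ 2 + τ * (L * M)) with hB
      have hw : |avg h (S.U h (j + i)) x - c| ≤ B + Q * (‖x - x₀‖ ^ 2 + h ^ 2) := by
        have hi1 := integrable_aker_mul (measurable_U h (j + i)) hUa h x
        have hi2 : Integrable (fun z : Euc n => aker z * ‖x + h • z - x₀‖ ^ 2) :=
          (continuous_aker.mul (by fun_prop)).integrable_of_hasCompactSupport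
            hasCompactSupport_aker.mul_right
        have e1 : avg h (S.U h (j + i)) x - c =
            ∫ z, (aker z * S.U h (j + i) (x + h • z) - aker z * c) := by
          rw [integral_sub hi1 (integrable_aker.mul_const c), integral_mul_const, integral_aker,
            one_mul]
          rfl
        have e2 : |avg h (S.U h (j + i)) x - c| ≤
            ∫ z, (aker z * B + Q * (aker z * ‖x + h • z - x₀‖ ^ 2)) := by
          rw [e1, ← Real.norm_eq_abs]
          refine norm_integral_le_of_norm_le ((integrable_aker.mul_const B).add (hi2.const_mul Q))
            (Eventually.of_forall fun z => ?_)
          rw [← mul_sub, norm_mul, Real.norm_of_nonneg (aker_nonneg z), Real.norm_eq_abs]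
          have := mul_le_mul_of_nonneg_left (ih (x + h • z)) (aker_nonneg z)
          refine this.trans (le_of_eq ?_)
          rw [hB]
          ring
        rw [integral_add (integrable_aker.mul_const B) (hi2.const_mul Q), integral_mul_const,
          integral_const_mul, integral_aker, one_mul] at e2
        have e3 := integral_aker_mul_quadratic_le h x x₀
        exact e2.trans (by gcongr)
      set w := avg h (S.U h (j + i)) x
      set r := S.R (((j + i : ℕ) : ℝ) * stp n h) w (S.mass (S.U h (j + i)))
      calc |w + τ * r - c| = |(w - c) + τ * r| := by ring_nf
        _ ≤ |w - c| + τ * |r| := by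
            refine (abs_add_le _ _).trans ?_
            rw [abs_mul, abs_of_pos hτ]
        _ ≤ B + Q * (‖x - x₀‖ ^ 2 + h ^ 2) + τ * (L * M) := by gcongr
        _ = _ := by rw [hB]; push_cast; ring
  have h1 := main m hjm x₀
  rw [sub_self, norm_zero] at h1
  have h2 : m * (Q * h ^ 2 + τ * (L * M)) = m * τ * (2 * Q / potMass n + L * M) := by
    rw [hh2]; ring
  have h3 : m * τ * (2 * Q / potMass n + L * M) ≤ ε / 2 := by
    rwa [le_div_iff₀ (by positivity)] at hmδ
  rw [h2] at h1
  norm_num at h1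
  linarith

end Scheme

namespace Scheme

variable {n : ℕ} {S : Scheme n}

theorem natFloor_mul_le {t τ : ℝ} (hτ : 0 < τ) : (⌊t / τ⌋₊ : ℝ) * τ ≤ max t 0 := by
  rcases le_or_gt 0 t with ht | ht
  · have := Nat.floor_le (div_nonneg ht hτ.le)
    rw [le_div_iff₀ hτ] at this
    exact this.trans (le_max_left _ _)
  · rw [Nat.floor_of_nonpos (div_nonpos_of_nonpos_of_nonneg ht.le hτ.le)]
    simp

theorem lt_natFloor_mul {t τ : ℝ} (hτ : 0 < τ) : t < (⌊t / τ⌋₊ : ℝ) * τ + τ := by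
  have := Nat.lt_floor_add_one (t / τ)
  rw [div_lt_iff₀ hτ] at this
  linarith

/-- Joint equicontinuity of the scheme, at time `t` read off at the step `⌊t / τ⌋`. -/
theorem eventually_joint {T ε : ℝ} (hT : 0 < T) (hε : 0 < ε) : ∃ δ > 0, ∀ᶠ h in 𝓝[>] 0,
    ∀ s ≤ T, ∀ t ≤ T, |s - t| < δ → ∀ x y, dist x y < δ →
      |S.U h ⌊s / stp n h⌋₊ x - S.U h ⌊t / stp n h⌋₊ y| ≤ ε := by
  obtain ⟨δ₁, hδ₁, h1⟩ := eventually_space (S := S) hT (half_pos hε)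
  obtain ⟨δ₂, hδ₂, h2⟩ := eventually_time (S := S) hT (half_pos hε)
  refine ⟨min δ₁ (δ₂ / 2), lt_min hδ₁ (half_pos hδ₂), ?_⟩
  have e1 : ∀ᶠ h : ℝ in 𝓝[>] 0, stp n h < δ₂ / 2 :=
    tendsto_stp.eventually (gt_mem_nhds (half_pos hδ₂))
  filter_upwards [h1, h2, e1, self_mem_nhdsWithin] with h h1 h2 hτδ hh0
  have hτ : 0 < stp n h := stp_pos hh0
  set τ := stp n h
  have htime : ∀ s t : ℝ, s ≤ t → t ≤ T → |s - t| < min δ₁ (δ₂ / 2) → ∀ x,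
      |S.U h ⌊t / τ⌋₊ x - S.U h ⌊s / τ⌋₊ x| ≤ ε / 2 := by
    intro s t hst ht hd x
    have hle : ⌊s / τ⌋₊ ≤ ⌊t / τ⌋₊ := Nat.floor_le_floor (by gcongr)
    obtain ⟨m, hm⟩ := Nat.exists_eq_add_of_le hle
    have h3 := natFloor_mul_le (t := t) hτ
    have hT' : (⌊t / τ⌋₊ : ℝ) * τ ≤ T := h3.trans (max_le ht hT.le)
    rw [hm] at hT' ⊢
    refine h2 _ _ hT' ?_ x
    rw [abs_sub_comm, abs_of_nonneg (by linarith)] at hd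
    have h4 := lt_natFloor_mul (t := s) hτ
    have h5 : (⌊t / τ⌋₊ : ℝ) = ⌊s / τ⌋₊ + m := by rw [hm]; push_cast; ring
    rcases le_or_gt t 0 with ht0 | ht0
    · have h6 : ⌊t / τ⌋₊ = 0 := Nat.floor_of_nonpos (div_nonpos_of_nonpos_of_nonneg ht0 hτ.le)
      have : m = 0 := by omega
      subst this
      simpa using hδ₂.le
    · rw [max_eq_left ht0.le, h5] at h3
      linarith [min_le_right δ₁ (δ₂ / 2)]
  have hsp : ∀ t ≤ T, ∀ x y, dist x y < min δ₁ (δ₂ / 2) →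
      |S.U h ⌊t / τ⌋₊ x - S.U h ⌊t / τ⌋₊ y| ≤ ε / 2 := fun t ht x y hxy =>
    h1 _ ((natFloor_mul_le hτ).trans (max_le ht hT.le)) x y (hxy.trans_le (min_le_left _ _))
  intro s hs t ht hst x y hxy
  have h3 : |S.U h ⌊s / τ⌋₊ x - S.U h ⌊t / τ⌋₊ x| ≤ ε / 2 := by
    rcases le_total s t with hle | hle
    · rw [abs_sub_comm]; exact htime s t hle ht hst x
    · exact htime t s hle hs (by rwa [abs_sub_comm]) x
  have h4 := hsp t ht x y hxy
  have := abs_sub_le (S.U h ⌊s / τ⌋₊ x) (S.U h ⌊t / τ⌋₊ x) (S.U h ⌊t / τ⌋₊ y)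
  linarith

/-- `u` is a limit of the scheme along some sequence of mesh sizes, uniform on bounded time
intervals. -/
structure IsLimit (S : Scheme n) (u : Euc n → ℝ → ℝ) : Prop where
  cont : Continuous (fun z : Euc n × ℝ => u z.1 z.2)
  zero : ∀ x, x ∉ S.Ω → ∀ t, u x t = 0
  nonneg : ∀ x t, 0 ≤ u x t
  initial : ∀ x t, t ≤ 0 → u x t = S.u0 x
  le : ∀ T, 0 < T → ∀ t ≤ T, ∀ x, u x t ≤ S.bigM T
  approx : ∀ T, 0 < T → ∀ ε, 0 < ε → ∃ᶠ h in 𝓝[>] 0, ∀ k : ℕ, k * stp n h ≤ T → ∀ x,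
      |S.U h k x - u x (k * stp n h)| ≤ ε

theorem exists_limit (S : Scheme n) : ∃ u : Euc n → ℝ → ℝ, S.IsLimit u := by
  let hs : ℕ → ℝ := fun j => 1 / ((j : ℝ) + 1)
  have hs0 : Tendsto hs atTop (𝓝[>] 0) :=
    tendsto_nhdsWithin_iff.mpr ⟨tendsto_one_div_add_atTop_nhds_zero_nat,
      Eventually.of_forall fun j => by simp only [hs, mem_Ioi]; positivity⟩
  let F : Ultrafilter ℕ := hyperfilter ℕ
  have hF : Tendsto hs F (𝓝[>] 0) := hs0.mono_left Nat.hyperfilter_le_atTop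
  let V : ℕ → Euc n → ℝ → ℝ := fun j x t => S.U (hs j) ⌊t / stp n (hs j)⌋₊ x
  have hpos : ∀ j, 0 < stp n (hs j) := fun j => stp_pos (by simp only [hs]; positivity)
  have hVb : ∀ T, 0 < T → ∀ᶠ j in (F : Filter ℕ), ∀ t ≤ T, ∀ x, V j x t ∈ Icc 0 (S.bigM T) := by
    intro T hT
    filter_upwards [hF.eventually (eventually_bound (S := S) hT one_pos)] with j hj t ht x
    have h1 := (natFloor_mul_le (t := t) (hpos j)).trans (max_le ht hT.le)
    obtain ⟨h2, -, h3⟩ := hj _ h1 x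
    have := hpos j
    exact ⟨h2, h3.trans (mb_le_bigM (by positivity) h1)⟩
  have hlim : ∀ x t, ∃ l, Tendsto (fun j => V j x t) F (𝓝 l) := by
    intro x t
    have hT : (0:ℝ) < max t 1 := lt_max_of_lt_right one_pos
    have h1 : ((F.map fun j => V j x t : Ultrafilter ℝ) : Filter ℝ) ≤ 𝓟 (Icc 0 (S.bigM (max t 1))) := by
      rw [le_principal_iff]
      exact (hVb _ hT).mono fun j hj => hj t (le_max_left _ _) x
    obtain ⟨l, -, hl⟩ := isCompact_Icc.ultrafilter_le_nhds _ h1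
    exact ⟨l, hl⟩
  choose u hu using hlim
  have hub : ∀ T, 0 < T → ∀ t ≤ T, ∀ x, u x t ∈ Icc 0 (S.bigM T) := fun T hT t ht x =>
    isClosed_Icc.mem_of_tendsto (hu x t) ((hVb T hT).mono fun j hj => hj t ht x)
  have hequi : ∀ T, 0 < T → ∀ ε, 0 < ε → ∃ δ > 0, (∀ᶠ j in (F : Filter ℕ), ∀ s ≤ T, ∀ t ≤ T,
      |s - t| < δ → ∀ x y, dist x y < δ → |V j x s - V j y t| ≤ ε) ∧
      ∀ s ≤ T, ∀ t ≤ T, |s - t| < δ → ∀ x y, dist x y < δ → |u x s - u y t| ≤ ε := by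
    intro T hT ε hε
    obtain ⟨δ, hδ, h⟩ := eventually_joint (S := S) hT hε
    have h' := hF.eventually h
    refine ⟨δ, hδ, h', fun s hs t ht hst x y hxy => ?_⟩
    exact le_of_tendsto ((hu x s).sub (hu y t)).abs (h'.mono fun j hj => hj s hs t ht hst x y hxy)
  have hV0 : ∀ x, x ∉ S.Ω → ∀ j t, V j x t = 0 := fun x hx j t =>
    U_of_notMem (fun h => hx (mem_of_mem_inn (by simp only [hs]; positivity) h)) _
  have hu0 : ∀ x, x ∉ S.Ω → ∀ t, u x t = 0 := fun x hx t =>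
    tendsto_nhds_unique (hu x t) (by simpa only [hV0 x hx] using tendsto_const_nhds)
  refine ⟨u, ?_, hu0, fun x t => (hub (max t 1) (lt_max_of_lt_right one_pos) t (le_max_left _ _) x).1,
    ?_, fun T hT t ht x => (hub T hT t ht x).2, ?_⟩
  · rw [Metric.continuous_iff]
    rintro ⟨y, t⟩ ε hε
    obtain ⟨δ, hδ, -, h⟩ := hequi (|t| + 1) (by positivity) (ε / 2) (half_pos hε)
    refine ⟨min δ 1, lt_min hδ one_pos, ?_⟩
    rintro ⟨x, s⟩ hxs
    rw [Prod.dist_eq, max_lt_iff] at hxs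
    simp only [Real.dist_eq] at hxs ⊢
    have h1 : |s - t| < 1 := hxs.2.trans_le (min_le_right _ _)
    refine (h s ?_ t ?_ (hxs.2.trans_le (min_le_left _ _)) x y
      (hxs.1.trans_le (min_le_left _ _))).trans_lt (by linarith)
    · linarith [(abs_lt.mp h1).2, le_abs_self t]
    · linarith [le_abs_self t]
  · intro x t ht
    by_cases hx : x ∈ S.Ω
    swap
    · rw [hu0 x hx, S.u0_zero x hx]
    refine tendsto_nhds_unique (hu x t) (tendsto_const_nhds.congr' ?_)
    obtain ⟨ε, hε, hball⟩ := Metric.isOpen_iff.mp S.isOpen x hx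
    have e1 : ∀ᶠ h : ℝ in 𝓝[>] 0, h < ε / 2 :=
      (gt_mem_nhds (half_pos hε)).filter_mono nhdsWithin_le_nhds
    filter_upwards [hF.eventually e1] with j hj
    have hm : x ∈ S.inn (hs j) := (Metric.ball_subset_ball (by linarith)).trans hball
    have : ⌊t / stp n (hs j)⌋₊ = 0 :=
      Nat.floor_of_nonpos (div_nonpos_of_nonpos_of_nonneg ht (hpos j).le)
    simp only [V, this]
    rw [U_zero hm]
  · intro T hT ε hε
    refine hF.frequently (Eventually.frequently ?_)
    obtain ⟨δ, hδ, hV, hue⟩ := hequi T hT (ε / 3) (by positivity)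
    obtain ⟨c, hcs, hcf, hcov⟩ := ((S.bdd.isCompact_closure).prod
      (isCompact_Icc (a := (0:ℝ)) (b := T))).finite_cover_balls hδ
    have hfin : ∀ᶠ j in (F : Filter ℕ), ∀ z ∈ c, |V j z.1 z.2 - u z.1 z.2| ≤ ε / 3 := by
      rw [eventually_all_finite hcf]
      intro z _
      have := ((hu z.1 z.2).sub_const (u z.1 z.2)).abs
      rw [sub_self, abs_zero] at this
      exact this.eventually (ge_mem_nhds (by positivity))
    filter_upwards [hV, hfin] with j hV hfin k hk x
    have hVk : V j x (k * stp n (hs j)) = S.U (hs j) k x := by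
      simp only [V]
      rw [mul_div_cancel_right₀ _ (hpos j).ne', Nat.floor_natCast]
    rw [← hVk]
    by_cases hx : x ∈ S.Ω
    swap
    · rw [hV0 x hx, hu0 x hx]; simpa using hε.le
    have hk0 : 0 ≤ k * stp n (hs j) := by have := hpos j; positivity
    obtain ⟨z, hz, hxz⟩ := mem_iUnion₂.mp (hcov (mk_mem_prod (subset_closure hx)
      (mem_Icc.mpr ⟨hk0, hk⟩)))
    rw [Metric.mem_ball, Prod.dist_eq, max_lt_iff, Real.dist_eq] at hxz
    have hzT := (hcs hz).2.2
    have h1 := hV _ hk z.2 hzT hxz.2 x z.1 hxz.1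
    have h2 := hue _ hk z.2 hzT hxz.2 x z.1 hxz.1
    have h3 := hfin z hz
    simp only [abs_le] at h1 h2 h3 ⊢
    constructor <;> linarith [h1.1, h1.2, h2.1, h2.2, h3.1, h3.2]

end Scheme

/-- Averaging is symmetric. -/
theorem integral_mul_avg {n : ℕ} {ρ U : Euc n → ℝ} (hρ : Continuous ρ) (hρc : HasCompactSupport ρ)
    (hU : Measurable U) {M : ℝ} (hM : ∀ x, |U x| ≤ M) (h : ℝ) :
    ∫ x, ρ x * avg h U x = ∫ x, avg h ρ x * U x := by
  have hρi : Integrable ρ := hρ.integrable_of_hasCompactSupport hρc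
  have hswap : ∀ (f g : Euc n → ℝ), Integrable (fun z : Euc n × Euc n => f z.1 * aker z.2 * g (z.1 + h • z.2)) →
      ∫ x, f x * avg h g x = ∫ z, aker z * ∫ x, f x * g (x + h • z) := by
    intro f g hfg
    have h1 := integral_integral_swap (f := fun x z => f x * aker z * g (x + h • z)) hfg
    calc ∫ x, f x * avg h g x = ∫ x, ∫ z, f x * aker z * g (x + h • z) := by
          simp only [avg, ← integral_const_mul, mul_assoc]
      _ = ∫ z, ∫ x, f x * aker z * g (x + h • z) := h1
      _ = _ := by simp only [← integral_const_mul, mul_left_comm, mul_assoc]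
  rw [hswap ρ U]
  · have h2 : ∀ z, ∫ x, ρ x * U (x + h • z) = ∫ x, U x * ρ (x + h • (-z)) := by
      intro z
      rw [← integral_add_right_eq_self (fun x => U x * ρ (x + h • (-z))) (h • z)]
      congr 1
      ext x
      rw [smul_neg, add_neg_cancel_right, mul_comm]
    simp_rw [h2]
    rw [← integral_neg_eq_self]
    simp_rw [aker_neg, neg_neg]
    simp_rw [mul_comm (avg h ρ _)]
    rw [hswap U ρ]
    have hi : Integrable (fun z : Euc n × Euc n => ρ z.1 * aker z.2 * U (z.1 + h • (-z.2))) :=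
      (hρi.mul_prod integrable_aker).mul_bdd (c := M) (hU.comp (by fun_prop)).aestronglyMeasurable
        (Eventually.of_forall fun z => hM _)
    -- shear `(x, z) ↦ (x + h z, z)` preserves the measure
    have hmp : MeasurePreserving (fun z : Euc n × Euc n => (z.1 + h • z.2, z.2))
        (volume.prod volume) (volume.prod volume) := by
      have h3 : MeasurePreserving (fun z : Euc n × Euc n => (z.1, z.2 + h • z.1))
          (volume.prod volume) (volume.prod volume) :=
        (MeasurePreserving.id volume).skew_product (g := fun a b => b + h • a) (by fun_prop)
          (Eventually.of_forall fun a => (measurePreserving_add_right volume (h • a)).map_eq)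
      exact (Measure.measurePreserving_swap.comp h3).comp Measure.measurePreserving_swap
    have h4 := (hmp.integrable_comp hi.aestronglyMeasurable).mpr hi
    refine h4.congr (Eventually.of_forall fun z => ?_)
    simp only [Function.comp, smul_neg, add_neg_cancel_right]
    ring
  · exact (hρi.mul_prod integrable_aker).mul_bdd (c := M)
      (hU.comp (by fun_prop)).aestronglyMeasurable (Eventually.of_forall fun z => hM _)

namespace Scheme

variable {n : ℕ} {S : Scheme n}

theorem eventually_subset_inn {K : Set (Euc n)} (hK : IsCompact K) (hKΩ : K ⊆ S.Ω) :
    ∀ᶠ h in 𝓝[>] (0:ℝ), K ⊆ S.inn h := by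
  obtain ⟨δ, hδ, hsub⟩ := hK.exists_thickening_subset_open S.isOpen hKΩ
  have e1 : ∀ᶠ h : ℝ in 𝓝[>] 0, h < δ / 2 :=
    (gt_mem_nhds (half_pos hδ)).filter_mono nhdsWithin_le_nhds
  filter_upwards [e1] with h hh x hx
  refine (Metric.ball_subset_ball (by linarith)).trans
    ((Metric.ball_subset_thickening hx δ).trans hsub)

theorem integrable_of_zero {f : Euc n → ℝ} (hf : Measurable f) {M : ℝ} (hM : ∀ x, |f x| ≤ M)
    (h0 : ∀ x, x ∉ S.Ω → f x = 0) : Integrable f := by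
  have h1 : IntegrableOn f S.Ω :=
    Measure.integrableOn_of_bounded volume_ne_top hf.aestronglyMeasurable
      (Eventually.of_forall hM)
  exact h1.integrable_of_forall_notMem_eq_zero h0

theorem integral_U_succ {ρ : Euc n → ℝ} (hρ : Continuous ρ) (hρc : HasCompactSupport ρ) {h : ℝ}
    (hρh : tsupport ρ ⊆ S.inn h) (k : ℕ) {M C : ℝ} (hM : ∀ x, |S.U h k x| ≤ M)
    (hC : ∀ x, |S.R (k * stp n h) (avg h (S.U h k) x) (S.mass (S.U h k))| ≤ C) :
    ∫ x, ρ x * S.U h (k + 1) x = (∫ x, avg h ρ x * S.U h k x) +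
      stp n h * ∫ x, ρ x * S.R (k * stp n h) (avg h (S.U h k) x) (S.mass (S.U h k)) := by
  have hρi : Integrable ρ := hρ.integrable_of_hasCompactSupport hρc
  have hma := measurable_avg (measurable_U (S := S) h k) h
  have i1 : Integrable (fun x => ρ x * avg h (S.U h k) x) :=
    hρi.mul_bdd (c := M) hma.aestronglyMeasurable (Eventually.of_forall fun x => by
      rw [← avg_const h M x, Real.norm_eq_abs]
      refine (abs_integral_le_integral_abs).trans ?_
      refine integral_mono (integrable_aker_mul (measurable_U h k) hM h x).abs
        (integrable_aker.mul_const M) fun z => ?_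
      simp only [abs_mul, abs_of_nonneg (aker_nonneg z)]
      exact mul_le_mul_of_nonneg_left (hM _) (aker_nonneg z))
  have i2 : Integrable (fun x => ρ x * S.R (k * stp n h) (avg h (S.U h k) x) (S.mass (S.U h k))) :=
    hρi.mul_bdd (c := C) (S.cont_R.measurable.comp (measurable_const.prodMk
      (hma.prodMk measurable_const))).aestronglyMeasurable (Eventually.of_forall hC)
  rw [← integral_mul_avg hρ hρc (measurable_U h k) hM, ← integral_const_mul, ← integral_add i1
    (i2.const_mul _)]
  congr 1
  ext x
  by_cases hx : x ∈ S.inn h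
  · rw [U_succ hx]; ring
  · have : ρ x = 0 := image_eq_zero_of_notMem_tsupport fun h => hx (hρh h)
    simp [this]

/-- The averages converge uniformly to the Laplacian. -/
theorem eventually_avg_lap {ρ : Euc n → ℝ} (hρ : ContDiff ℝ 2 ρ) (hρc : HasCompactSupport ρ) {ε : ℝ}
    (hε : 0 < ε) : ∀ᶠ h in 𝓝[>] (0:ℝ), ∀ x, |(avg h ρ x - ρ x) / stp n h - lap ρ x| ≤ ε := by
  have huc := (hasCompactSupport_lap hρc).uniformContinuous_of_continuous (continuous_lap hρ)
  obtain ⟨δ, hδ, hlap⟩ := Metric.uniformContinuous_iff.mp huc ε hε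
  have e1 : ∀ᶠ h : ℝ in 𝓝[>] 0, h < δ := (gt_mem_nhds hδ).filter_mono nhdsWithin_le_nhds
  filter_upwards [e1, self_mem_nhdsWithin] with h hh hh0 x
  have hτ : 0 < stp n h := stp_pos hh0
  have h1 := abs_avg_sub_le hρ (x := x) (c := lap ρ x) (ε := ε) hh0
    (fun y hy => (hlap (lt_of_le_of_lt hy hh)).le)
  have h2 : (avg h ρ x - ρ x) / stp n h - lap ρ x =
      (avg h ρ x - ρ x - stp n h * lap ρ x) / stp n h := by field_simp
  rw [h2, abs_div, abs_of_pos hτ, div_le_iff₀ hτ, mul_comm ε]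
  exact h1

/-- The reaction term of a limit, frozen for negative times. -/
def react (S : Scheme n) (u : Euc n → ℝ → ℝ) (x : Euc n) (t : ℝ) : ℝ :=
  S.R (max t 0) (u x t) (S.mass fun y => u y t)

variable {u : Euc n → ℝ → ℝ}

theorem IsLimit.continuous_mass (hu : S.IsLimit u) : Continuous fun t => S.mass fun y => u y t := by
  have hp : 0 < S.p := by linarith [S.p_ge]
  have h : (fun t => S.mass fun y => u y t) = fun t => ∫ y in closure S.Ω, u y t ^ S.p := by
    ext t
    refine setIntegral_eq_of_subset_of_forall_sdiff_eq_zero isClosed_closure.measurableSet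
      subset_closure (fun x hx => ?_) |>.symm
    change u x t ^ S.p = 0
    rw [hu.zero x hx.2, zero_rpow hp.ne']
  rw [h]
  refine continuous_parametric_integral_of_continuous ?_ S.bdd.isCompact_closure
  exact (hu.cont.comp (by fun_prop : Continuous fun z : ℝ × Euc n => (z.2, z.1))).rpow_const
    fun _ => Or.inr hp.le

theorem IsLimit.continuous_react (hu : S.IsLimit u) :
    Continuous fun z : Euc n × ℝ => S.react u z.1 z.2 := by
  have h1 := hu.continuous_mass.comp (continuous_snd (X := Euc n) (Y := ℝ))
  exact S.cont_R.comp (((continuous_snd.max continuous_const)).prodMk (hu.cont.prodMk h1))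

theorem IsLimit.continuous_pairing {ρ : Euc n → ℝ} (hρ : Continuous ρ) (hρc : HasCompactSupport ρ)
    {f : Euc n → ℝ → ℝ} (hf : Continuous fun z : Euc n × ℝ => f z.1 z.2) :
    Continuous fun t => ∫ x, ρ x * f x t := by
  have h : (fun t => ∫ x, ρ x * f x t) = fun t => ∫ x in tsupport ρ, ρ x * f x t := by
    ext t
    refine (setIntegral_eq_integral_of_forall_compl_eq_zero fun x hx => ?_).symm
    rw [image_eq_zero_of_notMem_tsupport hx, zero_mul]
  rw [h]
  refine continuous_parametric_integral_of_continuous ?_ hρc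
  exact (hρ.comp continuous_snd).mul
    (hf.comp (by fun_prop : Continuous fun z : ℝ × Euc n => (z.2, z.1)))

end Scheme

namespace Scheme

variable {n : ℕ} {S : Scheme n} {u : Euc n → ℝ → ℝ}

theorem integrable_rpow (S : Scheme n) {f : Euc n → ℝ} (hf : Measurable f) {M : ℝ} (h0 : ∀ x, 0 ≤ f x)
    (hM : ∀ x, f x ≤ M) : IntegrableOn (fun x => f x ^ S.p) S.Ω := by
  have hp : 0 ≤ S.p := by linarith [S.p_ge]
  refine Measure.integrableOn_of_bounded (M := M ^ S.p) volume_ne_top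
    (hf.pow_const _).aestronglyMeasurable (Eventually.of_forall fun x => ?_)
  rw [Real.norm_of_nonneg (rpow_nonneg (h0 x) _)]
  exact rpow_le_rpow (h0 x) (hM x) hp

theorem abs_mass_sub_le {f g : Euc n → ℝ} (hf : Measurable f) (hg : Measurable g) {M η : ℝ}
    (hf0 : ∀ x, 0 ≤ f x) (hfM : ∀ x, f x ≤ M) (hg0 : ∀ x, 0 ≤ g x) (hgM : ∀ x, g x ≤ M)
    (h : ∀ x, |f x ^ S.p - g x ^ S.p| ≤ η) : |S.mass f - S.mass g| ≤ η * volume.real S.Ω := by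
  unfold mass
  rw [← integral_sub (S.integrable_rpow hf hf0 hfM) (S.integrable_rpow hg hg0 hgM)]
  rw [← Real.norm_eq_abs]
  exact norm_setIntegral_le_of_norm_le_const S.bdd.measure_lt_top fun x _ => h x

theorem frequently_step (hu : S.IsLimit u) {ρ : Euc n → ℝ} (hρ : ContDiff ℝ 2 ρ)
    (hρc : HasCompactSupport ρ) (hρΩ : tsupport ρ ⊆ S.Ω) {T ε : ℝ} (hT : 0 < T) (hε : 0 < ε) :
    ∃ᶠ h in 𝓝[>] (0:ℝ), (∀ k : ℕ, k * stp n h ≤ T →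
      |(∫ x, ρ x * S.U h k x) - ∫ x, ρ x * u x (k * stp n h)| ≤ ε) ∧
      ∀ k : ℕ, k * stp n h ≤ T →
      |(∫ x, ρ x * S.U h (k + 1) x) - (∫ x, ρ x * S.U h k x) - stp n h *
        ((∫ x, lap ρ x * u x (k * stp n h)) + ∫ x, ρ x * S.react u x (k * stp n h))| ≤
        stp n h * ε := by
  have hρi : Integrable ρ := hρ.continuous.integrable_of_hasCompactSupport hρc
  have hli : Integrable (lap ρ) := (continuous_lap hρ).integrable_of_hasCompactSupport
    (hasCompactSupport_lap hρc)
  obtain ⟨CΔ, hCΔ⟩ := (continuous_lap hρ).bounded_above_of_compact_support (hasCompactSupport_lap hρc)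
  have hCΔ0 : 0 ≤ CΔ := (norm_nonneg _).trans (hCΔ 0)
  have hM := bigM_pos (S := S) hT.le
  obtain ⟨L, hL0, hLe⟩ := eventually_reaction (S := S) hT
  set M := S.bigM T with hMdef
  set Vol := volume.real S.Ω with hVol
  have hVol0 : 0 ≤ Vol := measureReal_nonneg
  set Cρ := ∫ x, |ρ x| with hCρ
  have hCρ0 : 0 ≤ Cρ := integral_nonneg fun x => abs_nonneg _
  set η := ε / (Vol * (M + CΔ) + Cρ + 1) with hη
  have hden : 0 < Vol * (M + CΔ) + Cρ + 1 := by positivity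
  have hη0 : 0 < η := by positivity
  have hηε : η * (Vol * (M + CΔ) + Cρ + 1) = ε := by rw [hη]; field_simp
  have hRuc := ((isCompact_Icc (a := (0:ℝ)) (b := T)).prod ((isCompact_Icc (a := (0:ℝ)) (b := M)).prod
    (isCompact_Icc (a := (0:ℝ)) (b := max M (Vol * M ^ S.p))))).uniformContinuousOn_of_continuous S.cont_R.continuousOn
  obtain ⟨δ, hδ, hR⟩ := Metric.uniformContinuousOn_iff.mp hRuc η hη0
  have hp : 0 ≤ S.p := by linarith [S.p_ge]
  have hpuc := (isCompact_Icc (a := (0:ℝ)) (b := M)).uniformContinuousOn_of_continuous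
    (continuous_id.rpow_const (p := S.p) fun _ => Or.inr hp).continuousOn
  obtain ⟨δp, hδp, hpow⟩ := Metric.uniformContinuousOn_iff.mp hpuc (δ / 2 / (Vol + 1)) (by positivity)
  obtain ⟨δs, hδs, hsp⟩ := eventually_space (S := S) hT (ε := δ / 4) (by positivity)
  have e1 : ∀ᶠ h : ℝ in 𝓝[>] 0, h < δs := (gt_mem_nhds hδs).filter_mono nhdsWithin_le_nhds
  refine ((hu.approx T hT (min η (min (δp / 2) (δ / 4))) (by positivity)).and_eventually
    (e1.and (hsp.and (hLe.and ((eventually_bound (S := S) hT one_pos).and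
      ((eventually_subset_inn hρc hρΩ).and ((eventually_avg_lap hρ hρc hη0).and
        self_mem_nhdsWithin))))))).mono ?_
  rintro h ⟨happ, hhδ, hsp, hLe, hb, hinn, hlap, hh0⟩
  have hh : 0 < h := hh0
  have hτ : 0 < stp n h := stp_pos hh
  set τ := stp n h with hτdef
  have humeas : ∀ t, Measurable fun x => u x t := fun t =>
    (hu.cont.comp (by fun_prop : Continuous fun x : Euc n => (x, t))).measurable
  have hFk : ∀ k : ℕ, k * τ ≤ T → |(∫ x, ρ x * S.U h k x) - ∫ x, ρ x * u x (k * τ)| ≤ Cρ * η := by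
    intro k hk
    have hUa := (hLe k hk).1
    have i1 : Integrable fun x => ρ x * S.U h k x :=
      hρi.mul_bdd (c := M) (measurable_U h k).aestronglyMeasurable (Eventually.of_forall hUa)
    have i2 : Integrable fun x => ρ x * u x (k * τ) :=
      hρi.mul_bdd (c := M) (humeas _).aestronglyMeasurable (Eventually.of_forall fun x => by
        rw [Real.norm_of_nonneg (hu.nonneg _ _)]; exact hu.le T hT _ hk x)
    rw [← integral_sub i1 i2, hCρ, ← integral_mul_const, ← Real.norm_eq_abs]
    refine norm_integral_le_of_norm_le (hρi.abs.mul_const η) (Eventually.of_forall fun x => ?_)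
    rw [← mul_sub, norm_mul, Real.norm_eq_abs, Real.norm_eq_abs]
    exact mul_le_mul_of_nonneg_left ((happ k hk x).trans (min_le_left _ _)) (abs_nonneg _)
  refine ⟨fun k hk => (hFk k hk).trans ?_, fun k hk => ?_⟩
  · have : 0 ≤ Vol * (M + CΔ) * η := by positivity
    nlinarith
  obtain ⟨hUa, hw, hI, hRb, -⟩ := hLe k hk
  have hk0 : 0 ≤ k * τ := by positivity
  have hU0 : ∀ x, 0 ≤ S.U h k x := fun x => (hb k hk x).1
  have hUM : ∀ x, S.U h k x ≤ M := fun x => (le_abs_self _).trans (hUa x)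
  have hu0 : ∀ x, 0 ≤ u x (k * τ) := fun x => hu.nonneg _ _
  have huM : ∀ x, u x (k * τ) ≤ M := fun x => hu.le T hT _ hk x
  have hρU : Integrable fun x => ρ x * S.U h k x :=
    hρi.mul_bdd (c := M) (measurable_U h k).aestronglyMeasurable (Eventually.of_forall hUa)
  have haρ : Integrable fun x => avg h ρ x * S.U h k x := by
    obtain ⟨C, hC⟩ := hρ.continuous.bounded_above_of_compact_support hρc
    have hCa : ∀ x, |avg h ρ x| ≤ C := fun x => by
      rw [← avg_const h C x]
      refine (abs_integral_le_integral_abs).trans ?_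
      refine integral_mono (integrable_aker_mul hρ.continuous.measurable hC h x).abs
        (integrable_aker.mul_const C) fun z => ?_
      simp only [abs_mul, abs_of_nonneg (aker_nonneg z)]
      exact mul_le_mul_of_nonneg_left (hC _) (aker_nonneg z)
    exact (integrable_of_zero (measurable_U h k) hUa fun x hx => U_of_notMem
      (fun hx' => hx (mem_of_mem_inn hh hx')) k).bdd_mul (c := C)
      (measurable_avg hρ.continuous.measurable h).aestronglyMeasurable (Eventually.of_forall hCa)
  rw [integral_U_succ hρ.continuous hρc hinn k hUa hRb]
  set Rk : Euc n → ℝ := fun x => S.R (k * stp n h) (avg h (S.U h k) x) (S.mass (S.U h k)) with hRk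
  have hlapterm : |(∫ x, (avg h ρ x - ρ x) / τ * S.U h k x) - ∫ x, lap ρ x * u x (k * τ)| ≤
      η * (M + CΔ) * Vol := by
    have i1 : Integrable fun x => (avg h ρ x - ρ x) / τ * S.U h k x := by
      refine ((haρ.sub hρU).div_const τ).congr (Eventually.of_forall fun x => ?_)
      simp only [Pi.sub_apply]; ring
    have i2 : Integrable fun x => lap ρ x * u x (k * τ) :=
      hli.mul_bdd (c := M) (humeas _).aestronglyMeasurable (Eventually.of_forall fun x => by
        rw [Real.norm_of_nonneg (hu0 _)]; exact huM x)
    rw [← integral_sub i1 i2, ← setIntegral_eq_integral_of_forall_compl_eq_zero (s := S.Ω)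
      (fun x hx => by
        rw [U_of_notMem (fun hx' => hx (mem_of_mem_inn hh hx')) k, hu.zero x hx]; simp)]
    rw [← Real.norm_eq_abs]
    refine norm_setIntegral_le_of_norm_le_const S.bdd.measure_lt_top fun x _ => ?_
    have e2 : (avg h ρ x - ρ x) / τ * S.U h k x - lap ρ x * u x (k * τ) =
        ((avg h ρ x - ρ x) / τ - lap ρ x) * S.U h k x + lap ρ x * (S.U h k x - u x (k * τ)) := by ring
    rw [e2, mul_add]
    refine (norm_add_le _ _).trans (add_le_add ?_ ?_)
    · rw [norm_mul]
      exact mul_le_mul (hlap x) (hUa x) (norm_nonneg _) hη0.le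
    · rw [norm_mul, mul_comm]
      exact mul_le_mul ((happ k hk x).trans (min_le_left _ _)) (hCΔ x) (norm_nonneg _) hη0.le
  have hmass : |S.mass (S.U h k) - S.mass fun y => u y (k * τ)| < δ := by
    refine (abs_mass_sub_le (η := δ / 2 / (Vol + 1)) (measurable_U h k) (humeas _) hU0 hUM hu0 huM
      fun x => ?_).trans_lt ?_
    · refine (hpow _ ⟨hU0 x, hUM x⟩ _ ⟨hu0 x, huM x⟩ ?_).le
      rw [Real.dist_eq]
      have := (happ k hk x).trans ((min_le_right _ _).trans (min_le_left _ _))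
      linarith
    · rw [← hVol, div_mul_eq_mul_div, div_lt_iff₀ (by positivity)]
      nlinarith
  have hreact : ∀ x, |Rk x - S.react u x (k * τ)| ≤ η := by
    intro x
    have h1 : |avg h (S.U h k) x - S.U h k x| ≤ δ / 4 := by
      have h4 := abs_avg_sub_const_le (measurable_U h k) hUa (h := h) (x := x) (c := S.U h k x)
        (d := δ / 4) fun z hz => hsp k hk _ _ ?_
      · exact h4
      · rw [dist_self_add_left, norm_smul, Real.norm_of_nonneg hh.le]
        nlinarith [norm_nonneg z]
    have h2 := (happ k hk x).trans ((min_le_right _ _).trans (min_le_right _ _))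
    have h3 := hR (k * τ, avg h (S.U h k) x, S.mass (S.U h k)) ⟨⟨hk0, hk⟩, hw x, hI.1, hI.2.trans (le_max_left _ _)⟩
      (k * τ, u x (k * τ), S.mass fun y => u y (k * τ)) ⟨⟨hk0, hk⟩, ⟨hu0 x, huM x⟩,
        mass_nonneg hu0, ?_⟩ ?_
    · rw [Real.dist_eq] at h3
      rw [react, max_eq_left hk0]
      exact h3.le
    · exact (mass_le hu0 fun x => hu.le T hT _ hk x).trans (le_max_right _ _)
    · rw [Prod.dist_eq, Prod.dist_eq, dist_self, Real.dist_eq, Real.dist_eq]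
      refine max_lt hδ (max_lt ?_ hmass)
      rw [abs_le] at h1 h2
      rw [abs_lt]
      constructor <;> linarith [h1.1, h1.2, h2.1, h2.2]
  have hreactterm : |(∫ x, ρ x * Rk x) - ∫ x, ρ x * S.react u x (k * τ)| ≤ Cρ * η := by
    have i1 : Integrable fun x => ρ x * Rk x :=
      hρi.mul_bdd (S.cont_R.measurable.comp (measurable_const.prodMk
        ((measurable_avg (measurable_U h k) h).prodMk measurable_const))).aestronglyMeasurable
        (Eventually.of_forall hRb)
    have i2 : Integrable fun x => ρ x * S.react u x (k * τ) :=
      (hρ.continuous.mul (hu.continuous_react.comp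
        (by fun_prop : Continuous fun x : Euc n => (x, k * τ)))).integrable_of_hasCompactSupport
        hρc.mul_right
    rw [← integral_sub i1 i2, hCρ, ← integral_mul_const, ← Real.norm_eq_abs]
    refine norm_integral_le_of_norm_le (hρi.abs.mul_const η) (Eventually.of_forall fun x => ?_)
    rw [← mul_sub, norm_mul, Real.norm_eq_abs, Real.norm_eq_abs]
    exact mul_le_mul_of_nonneg_left (hreact x) (abs_nonneg _)
  have hdiff : (∫ x, avg h ρ x * S.U h k x) - ∫ x, ρ x * S.U h k x =
      τ * ∫ x, (avg h ρ x - ρ x) / τ * S.U h k x := by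
    rw [← integral_sub haρ hρU, ← integral_const_mul]
    congr 1
    ext x
    field_simp
  have e3 : (∫ x, avg h ρ x * S.U h k x) + τ * (∫ x, ρ x * Rk x) - (∫ x, ρ x * S.U h k x) -
      τ * ((∫ x, lap ρ x * u x (k * τ)) + ∫ x, ρ x * S.react u x (k * τ)) =
      τ * (((∫ x, (avg h ρ x - ρ x) / τ * S.U h k x) - ∫ x, lap ρ x * u x (k * τ)) +
        ((∫ x, ρ x * Rk x) - ∫ x, ρ x * S.react u x (k * τ))) := by
    linear_combination hdiff
  rw [e3, abs_mul, abs_of_pos hτ]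
  refine mul_le_mul_of_nonneg_left ((abs_add_le _ _).trans ?_) hτ.le
  have : η * (M + CΔ) * Vol + Cρ * η ≤ ε := by nlinarith
  linarith

theorem weak_integral (hu : S.IsLimit u) {ρ : Euc n → ℝ} (hρ : ContDiff ℝ 2 ρ)
    (hρc : HasCompactSupport ρ) (hρΩ : tsupport ρ ⊆ S.Ω) {t : ℝ} (ht : 0 < t) :
    (∫ x, ρ x * u x t) - ∫ x, ρ x * u x 0 =
      ∫ s in (0:ℝ)..t, ((∫ x, lap ρ x * u x s) + ∫ x, ρ x * S.react u x s) := by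
  set w : ℝ → ℝ := fun s => (∫ x, lap ρ x * u x s) + ∫ x, ρ x * S.react u x s with hw
  have hwc : Continuous w := (IsLimit.continuous_pairing (continuous_lap hρ) (hasCompactSupport_lap hρc)
    hu.cont).add (IsLimit.continuous_pairing hρ.continuous hρc hu.continuous_react)
  have hWc : Continuous fun s => ∫ x, ρ x * u x s :=
    IsLimit.continuous_pairing hρ.continuous hρc hu.cont
  set P : ℝ → ℝ := fun s => (∫ x, ρ x * u x s) - (∫ x, ρ x * u x 0) - ∫ σ in (0:ℝ)..s, w σ with hP
  have hPc : Continuous P := (hWc.sub continuous_const).sub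
    (intervalIntegral.continuous_primitive (fun a b => hwc.intervalIntegrable a b) 0)
  suffices h : P t = 0 by simp only [hP] at h; linarith
  rw [← abs_nonpos_iff]
  refine le_of_forall_pos_le_add fun ε hε => ?_
  rw [zero_add]
  set η := ε / (2 * t + 3) with hη
  have hη0 : 0 < η := by positivity
  have hηε : η * (2 * t + 3) = ε := by rw [hη]; field_simp
  obtain ⟨δ, hδ, hPδ⟩ := Metric.continuous_iff.mp hPc t η hη0
  have hwuc := (isCompact_Icc (a := (0:ℝ)) (b := t + 1)).uniformContinuousOn_of_continuous
    hwc.continuousOn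
  obtain ⟨δw, hδw, hwδ⟩ := Metric.uniformContinuousOn_iff.mp hwuc η hη0
  have e1 : ∀ᶠ h : ℝ in 𝓝[>] 0, stp n h < min δ (min δw 1) :=
    tendsto_stp.eventually (gt_mem_nhds (by positivity))
  obtain ⟨h, ⟨hF, hstep⟩, hτmin, hh0⟩ := ((frequently_step hu hρ hρc hρΩ ht hη0).and_eventually
    (e1.and self_mem_nhdsWithin)).exists
  have hτ : 0 < stp n h := stp_pos hh0
  set τ := stp n h with hτdef
  have hτδ : τ < δ := hτmin.trans_le (min_le_left _ _)
  have hτw : τ < δw := hτmin.trans_le ((min_le_right _ _).trans (min_le_left _ _))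
  have hτ1 : τ < 1 := hτmin.trans_le ((min_le_right _ _).trans (min_le_right _ _))
  have htel : ∀ k : ℕ, k * τ ≤ t → |(∫ x, ρ x * S.U h k x) - (∫ x, ρ x * S.U h 0 x) -
      ∫ σ in (0:ℝ)..(k * τ), w σ| ≤ 2 * η * (k * τ) := by
    intro k
    induction k with
    | zero => intro _; simp
    | succ k ih =>
      intro hk
      push_cast at hk ⊢
      have hkt : k * τ ≤ t := by nlinarith
      have hk0 : 0 ≤ k * τ := by positivity
      have ih := ih hkt
      have hs := hstep k hkt
      have h1 : ∫ σ in (0:ℝ)..((k + 1) * τ), w σ = (∫ σ in (0:ℝ)..(k * τ), w σ) +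
          ∫ σ in (k * τ)..((k + 1) * τ), w σ :=
        (intervalIntegral.integral_add_adjacent_intervals (hwc.intervalIntegrable _ _)
          (hwc.intervalIntegrable _ _)).symm
      have h2 : |(∫ σ in (k * τ)..((k + 1) * τ), w σ) - τ * w (k * τ)| ≤ η * τ := by
        have h3 : τ * w (k * τ) = ∫ σ in (k * τ)..((k + 1) * τ), w (k * τ) := by
          rw [intervalIntegral.integral_const, smul_eq_mul]; ring
        rw [h3, ← intervalIntegral.integral_sub (hwc.intervalIntegrable _ _)
          (continuous_const.intervalIntegrable _ _)]
        have h4 := intervalIntegral.norm_integral_le_of_norm_le_const (a := k * τ) (b := (k + 1) * τ)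
          (f := fun σ => w σ - w (k * τ)) (C := η) (fun σ hσ => by
          rw [uIoc_of_le (by nlinarith)] at hσ
          refine (hwδ σ ⟨by linarith [hσ.1], by nlinarith [hσ.2]⟩ (k * τ) ⟨hk0, by linarith⟩ ?_).le
          rw [Real.dist_eq, abs_of_nonneg (by linarith [hσ.1])]
          nlinarith [hσ.2])
        rw [Real.norm_eq_abs] at h4
        refine h4.trans (le_of_eq ?_)
        rw [show (k + 1) * τ - k * τ = τ by ring, abs_of_pos hτ]
      change |_ - _ - τ * w (k * τ)| ≤ _ at hs
      rw [h1]
      rw [abs_le] at ih hs h2 ⊢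
      constructor <;> linarith [ih.1, ih.2, hs.1, hs.2, h2.1, h2.2]
  set K := ⌊t / τ⌋₊ with hK
  have hKt : K * τ ≤ t := by simpa [max_eq_left ht.le] using natFloor_mul_le (t := t) hτ
  have hKt' := lt_natFloor_mul (t := t) hτ
  have h1 := htel K hKt
  have h2 := hF K hKt
  have h3 := hF 0 (by simpa using ht.le)
  simp only [Nat.cast_zero, zero_mul] at h3
  have h4 := hPδ (K * τ) (by rw [Real.dist_eq, abs_lt]; constructor <;> linarith)
  rw [Real.dist_eq] at h4
  have h5 : |P (K * τ)| ≤ 2 * η * t + 2 * η := by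
    simp only [hP]
    have h6 : 2 * η * (K * τ) ≤ 2 * η * t := by gcongr
    rw [abs_le] at h1 h2 h3 ⊢
    constructor <;> linarith [h1.1, h1.2, h2.1, h2.2, h3.1, h3.2]
  rw [abs_le] at h5 ⊢
  rw [abs_lt] at h4
  constructor <;> linarith [h4.1, h4.2, h5.1, h5.2]

/-- The limit solves the equation weakly. -/
theorem weak_form (hu : S.IsLimit u) {ρ : Euc n → ℝ} (hρ : ContDiff ℝ 2 ρ)
    (hρc : HasCompactSupport ρ) (hρΩ : tsupport ρ ⊆ S.Ω) {t : ℝ} (ht : 0 < t) :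
    HasDerivAt (fun t => ∫ x, ρ x * u x t)
      ((∫ x, lap ρ x * u x t) + ∫ x, ρ x * S.react u x t) t := by
  have hwc : Continuous fun s => (∫ x, lap ρ x * u x s) + ∫ x, ρ x * S.react u x s :=
    (IsLimit.continuous_pairing (continuous_lap hρ) (hasCompactSupport_lap hρc)
    hu.cont).add (IsLimit.continuous_pairing hρ.continuous hρc hu.continuous_react)
  have h1 := (intervalIntegral.integral_hasDerivAt_right (hwc.intervalIntegrable 0 t)
    (hwc.stronglyMeasurableAtFilter _ _) hwc.continuousAt).add_const (∫ x, ρ x * u x 0)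
  refine h1.congr_of_eventuallyEq ?_
  filter_upwards [lt_mem_nhds ht] with s hs
  rw [← weak_integral hu hρ hρc hρΩ hs]
  ring

end Scheme

/-- A family of compactly supported kernels with the integral bounds of the heat kernel. -/
structure HeatKer {n : ℕ} (k : ℝ → Euc n → ℝ) (dk : ℝ → Euc n → Euc n →L[ℝ] ℝ) (r C : ℝ) : Prop where
  hasFDerivAt : ∀ σ, 0 < σ → ∀ y, HasFDerivAt (k σ) (dk σ y) y
  cont : ContinuousOn (fun w : ℝ × Euc n => k w.1 w.2) (Ioi 0 ×ˢ univ)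
  dcont : ContinuousOn (fun w : ℝ × Euc n => dk w.1 w.2) (Ioi 0 ×ˢ univ)
  supp : ∀ σ y, r ≤ ‖y‖ → k σ y = 0
  dsupp : ∀ σ y, r ≤ ‖y‖ → dk σ y = 0
  bound : ∀ σ, 0 < σ → σ ≤ r → ∫ y, ‖k σ y‖ ≤ C
  dbound : ∀ σ, 0 < σ → σ ≤ r → ∫ y, ‖dk σ y‖ ≤ C * σ ^ (-(1 / 2) : ℝ)

section Slice

variable {n : ℕ} {F : Type*} [NormedAddCommGroup F] [NormedSpace ℝ F]

/-- The convolution in space of `f (·, t - σ)` with the kernel `k σ`. -/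
def slice (k : ℝ → Euc n → F) (f : Euc n × ℝ → ℝ) (σ : ℝ) (z : Euc n × ℝ) : F :=
  ∫ y, f (z.1 - y, z.2 - σ) • k σ y

/-- The space-time potential of the density `f` with kernel `k`. -/
def potl (k : ℝ → Euc n → F) (f : Euc n × ℝ → ℝ) (r : ℝ) (z : Euc n × ℝ) : F :=
  ∫ σ in Ioc 0 r, slice k f σ z

variable {k : ℝ → Euc n → F} {f : Euc n × ℝ → ℝ} {r M : ℝ}

theorem continuous_kernel (hk : ContinuousOn (fun w : ℝ × Euc n => k w.1 w.2) (Ioi 0 ×ˢ univ))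
    {σ : ℝ} (hσ : 0 < σ) : Continuous (k σ) := by
  rw [← continuousOn_univ]
  exact hk.comp (f := fun y => (σ, y)) (by fun_prop) fun y _ => ⟨hσ, mem_univ _⟩

theorem hasCompactSupport_kernel (hs : ∀ σ y, r ≤ ‖y‖ → k σ y = 0) (σ : ℝ) :
    HasCompactSupport (k σ) :=
  HasCompactSupport.intro (isCompact_closedBall 0 r) fun y hy => hs σ y (by
    rw [mem_closedBall_zero_iff, not_le] at hy; exact hy.le)

theorem continuousOn_slice (hk : ContinuousOn (fun w : ℝ × Euc n => k w.1 w.2) (Ioi 0 ×ˢ univ))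
    (hs : ∀ σ y, r ≤ ‖y‖ → k σ y = 0) (hf : Continuous f) :
    ContinuousOn (fun w : ℝ × (Euc n × ℝ) => slice k f w.1 w.2) (Ioi 0 ×ˢ univ) := by
  unfold slice
  refine continuousOn_integral_of_compact_support (μ := volume)
    (f := fun (w : ℝ × (Euc n × ℝ)) y => f (w.2.1 - y, w.2.2 - w.1) • k w.1 y)
    (isCompact_closedBall (0 : Euc n) r) ?_ ?_
  · refine ContinuousOn.smul (hf.comp (by fun_prop)).continuousOn ?_
    refine hk.comp (f := fun v : (ℝ × (Euc n × ℝ)) × Euc n => (v.1.1, v.2)) (by fun_prop) ?_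
    rintro ⟨⟨σ, z⟩, y⟩ ⟨⟨hσ, -⟩, -⟩
    exact ⟨hσ, mem_univ _⟩
  · intro w y _ hy
    rw [mem_closedBall_zero_iff, not_le] at hy
    rw [hs _ _ hy.le, smul_zero]

theorem norm_slice_le (hk : ContinuousOn (fun w : ℝ × Euc n => k w.1 w.2) (Ioi 0 ×ˢ univ))
    (hs : ∀ σ y, r ≤ ‖y‖ → k σ y = 0) (hM : ∀ z, |f z| ≤ M) {σ : ℝ} (hσ : 0 < σ) (z : Euc n × ℝ) :
    ‖slice k f σ z‖ ≤ M * ∫ y, ‖k σ y‖ := by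
  have hki : Integrable (k σ) := (continuous_kernel hk hσ).integrable_of_hasCompactSupport
    (hasCompactSupport_kernel hs σ)
  rw [← integral_const_mul]
  refine norm_integral_le_of_norm_le (hki.norm.const_mul M) (Eventually.of_forall fun y => ?_)
  rw [norm_smul]
  exact mul_le_mul_of_nonneg_right (hM _) (norm_nonneg _)

theorem hasFDerivAt_slice {k : ℝ → Euc n → ℝ} {dk : ℝ → Euc n → Euc n →L[ℝ] ℝ} {C : ℝ}
    (hk : HeatKer k dk r C) (hf : Continuous f) {σ : ℝ} (hσ : 0 < σ) (x : Euc n) (t : ℝ) :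
    HasFDerivAt (fun x => slice k f σ (x, t)) (slice dk f σ (x, t)) x := by
  have hd : fderiv ℝ (k σ) = dk σ := funext fun y => (hk.hasFDerivAt σ hσ y).fderiv
  have h1 : ContDiff ℝ 1 (k σ) := contDiff_one_iff_fderiv.mpr
    ⟨fun y => (hk.hasFDerivAt σ hσ y).differentiableAt, by rw [hd]; exact continuous_kernel hk.dcont hσ⟩
  have hfc : Continuous fun y : Euc n => f (y, t - σ) := hf.comp (by fun_prop)
  have h2 := (hasCompactSupport_kernel hk.supp σ).hasFDerivAt_convolution_left
    (μ := (volume : Measure (Euc n))) (ContinuousLinearMap.mul ℝ ℝ) h1 hfc.locallyIntegrable x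
  have h3 : (fun x => slice k f σ (x, t)) = convolution (k σ) (fun y => f (y, t - σ))
      (ContinuousLinearMap.mul ℝ ℝ) volume := by
    ext x
    simp only [slice, convolution, ContinuousLinearMap.mul_apply', smul_eq_mul]
    congr 1; ext y; ring
  rw [h3]
  refine h2.congr_fderiv ?_
  rw [hd]
  simp only [slice, convolution]
  congr 1; ext y v
  simp [ContinuousLinearMap.precompL_apply, mul_comm]

theorem aestronglyMeasurable_slice
    (hk : ContinuousOn (fun w : ℝ × Euc n => k w.1 w.2) (Ioi 0 ×ˢ univ))
    (hs : ∀ σ y, r ≤ ‖y‖ → k σ y = 0) (hf : Continuous f) (z : Euc n × ℝ) :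
    AEStronglyMeasurable (fun σ => slice k f σ z) (volume.restrict (Ioc 0 r)) := by
  refine ContinuousOn.aestronglyMeasurable ?_ measurableSet_Ioc
  exact (continuousOn_slice hk hs hf).comp (f := fun σ : ℝ => (σ, z)) (by fun_prop)
    fun σ hσ => ⟨hσ.1, mem_univ _⟩

theorem continuous_slice (hk : ContinuousOn (fun w : ℝ × Euc n => k w.1 w.2) (Ioi 0 ×ˢ univ))
    (hs : ∀ σ y, r ≤ ‖y‖ → k σ y = 0) (hf : Continuous f) {σ : ℝ} (hσ : 0 < σ) :
    Continuous (slice k f σ) := by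
  rw [← continuousOn_univ]
  exact (continuousOn_slice hk hs hf).comp (f := fun z : Euc n × ℝ => (σ, z)) (by fun_prop)
    fun z _ => ⟨hσ, mem_univ _⟩

theorem integrableOn_rpow_neg_half (r : ℝ) : IntegrableOn (fun σ : ℝ => σ ^ (-(1 / 2) : ℝ)) (Ioc 0 r) := by
  rcases le_total 0 r with h | h
  · exact (intervalIntegrable_iff_integrableOn_Ioc_of_le h).mp
      (intervalIntegral.intervalIntegrable_rpow' (by norm_num))
  · rw [Ioc_eq_empty (by simpa using h)]; exact integrableOn_empty

theorem continuous_potl (hk : ContinuousOn (fun w : ℝ × Euc n => k w.1 w.2) (Ioi 0 ×ˢ univ))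
    (hs : ∀ σ y, r ≤ ‖y‖ → k σ y = 0) (hf : Continuous f) (hM : ∀ z, |f z| ≤ M) {C : ℝ}
    (hC : ∀ σ, 0 < σ → σ ≤ r → ∫ y, ‖k σ y‖ ≤ C * σ ^ (-(1 / 2) : ℝ)) :
    Continuous (potl k f r) := by
  have hM0 : 0 ≤ M := (abs_nonneg _).trans (hM 0)
  refine continuous_of_dominated (bound := fun σ => M * (C * σ ^ (-(1 / 2) : ℝ)))
    (aestronglyMeasurable_slice hk hs hf) (fun z => ?_)
    (((integrableOn_rpow_neg_half r).const_mul C).const_mul M) ?_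
  · filter_upwards [ae_restrict_mem measurableSet_Ioc] with σ hσ
    exact (norm_slice_le hk hs hM hσ.1 z).trans (mul_le_mul_of_nonneg_left (hC σ hσ.1 hσ.2) hM0)
  · filter_upwards [ae_restrict_mem measurableSet_Ioc] with σ hσ
    exact continuous_slice hk hs hf hσ.1

theorem HeatKer.integrable_slice {k : ℝ → Euc n → ℝ} {dk : ℝ → Euc n → Euc n →L[ℝ] ℝ} {C : ℝ}
    (hk : HeatKer k dk r C) (hf : Continuous f) (hM : ∀ z, |f z| ≤ M) (z : Euc n × ℝ) :
    IntegrableOn (fun σ => slice k f σ z) (Ioc 0 r) := by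
  have hM0 : 0 ≤ M := (abs_nonneg _).trans (hM 0)
  refine Integrable.mono' (g := fun _ => M * C) (integrableOn_const measure_Ioc_lt_top.ne)
    (aestronglyMeasurable_slice hk.cont hk.supp hf z) ?_
  filter_upwards [ae_restrict_mem measurableSet_Ioc] with σ hσ
  exact (norm_slice_le hk.cont hk.supp hM hσ.1 z).trans
    (mul_le_mul_of_nonneg_left (hk.bound σ hσ.1 hσ.2) hM0)

theorem HeatKer.hasFDerivAt_potl {k : ℝ → Euc n → ℝ} {dk : ℝ → Euc n → Euc n →L[ℝ] ℝ} {C : ℝ}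
    (hk : HeatKer k dk r C) (hf : Continuous f) (hM : ∀ z, |f z| ≤ M) (x : Euc n) (t : ℝ) :
    HasFDerivAt (fun x => potl k f r (x, t)) (potl dk f r (x, t)) x := by
  have hM0 : 0 ≤ M := (abs_nonneg _).trans (hM 0)
  refine hasFDerivAt_integral_of_dominated_of_fderiv_le (𝕜 := ℝ) (s := univ)
    (F := fun x σ => slice k f σ (x, t)) (F' := fun x σ => slice dk f σ (x, t))
    (bound := fun σ => M * (C * σ ^ (-(1 / 2) : ℝ))) univ_mem
    (Eventually.of_forall fun x => aestronglyMeasurable_slice hk.cont hk.supp hf _)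
    (hk.integrable_slice hf hM _) (aestronglyMeasurable_slice hk.dcont hk.dsupp hf _) ?_
    (((integrableOn_rpow_neg_half r).const_mul C).const_mul M) ?_
  · filter_upwards [ae_restrict_mem measurableSet_Ioc] with σ hσ x _
    exact (norm_slice_le hk.dcont hk.dsupp hM hσ.1 _).trans
      (mul_le_mul_of_nonneg_left (hk.dbound σ hσ.1 hσ.2) hM0)
  · filter_upwards [ae_restrict_mem measurableSet_Ioc] with σ hσ x _
    exact hasFDerivAt_slice hk hf hσ.1 x t

end Slice

section RadialKernel

variable {n : ℕ}

/-- A radial kernel in self-similar form with a radial cut-off `A`. -/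
def rker (A h : ℝ → ℝ) (σ : ℝ) (y : Euc n) : ℝ :=
  σ ^ (-(n : ℝ) / 2) * (A (‖y‖ ^ 2) * h (‖y‖ ^ 2 / σ))

/-- The gradient of `rker`. -/
def drker (A A' h h' : ℝ → ℝ) (σ : ℝ) (y : Euc n) : Euc n →L[ℝ] ℝ :=
  (2 * (σ ^ (-(n : ℝ) / 2) * (A' (‖y‖ ^ 2) * h (‖y‖ ^ 2 / σ) + A (‖y‖ ^ 2) * (h' (‖y‖ ^ 2 / σ) / σ)))) •
    innerSL ℝ y

theorem hasFDerivAt_radial {g : ℝ → ℝ} {g' : ℝ} {y : Euc n} (hg : HasDerivAt g g' (‖y‖ ^ 2)) :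
    HasFDerivAt (fun y : Euc n => g (‖y‖ ^ 2)) ((2 * g') • innerSL ℝ y) y := by
  refine (hg.comp_hasFDerivAt y (hasStrictFDerivAt_norm_sq y).hasFDerivAt).congr_fderiv ?_
  rw [two_mul, add_smul]
  ext v
  simp
  ring

theorem integral_gaussian_scaled {σ : ℝ} (hσ : 0 < σ) :
    ∫ y : Euc n, σ ^ (-(n : ℝ) / 2) * exp (-(‖y‖ ^ 2 / σ) / 8) = (8 * π) ^ ((n : ℝ) / 2) := by
  have h := GaussianFourier.integral_rexp_neg_mul_sq_norm (V := Euc n) (b := 1 / (8 * σ)) (by positivity)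
  have e : (fun y : Euc n => σ ^ (-(n : ℝ) / 2) * exp (-(‖y‖ ^ 2 / σ) / 8)) =
      fun y => σ ^ (-(n : ℝ) / 2) * exp (-(1 / (8 * σ)) * ‖y‖ ^ 2) := by
    ext y; congr 2; field_simp
  rw [e, integral_const_mul, h, finrank_euclideanSpace_fin,
    show π / (1 / (8 * σ)) = (8 * π) * σ by field_simp, mul_rpow (by positivity) hσ.le, neg_div,
    rpow_neg hσ.le]
  field_simp

theorem integrable_gaussian_scaled {σ : ℝ} (hσ : 0 < σ) :
    Integrable fun y : Euc n => σ ^ (-(n : ℝ) / 2) * exp (-(‖y‖ ^ 2 / σ) / 8) := by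
  by_contra h
  have h1 := integral_undef h
  rw [integral_gaussian_scaled hσ] at h1
  have : 0 < (8 * π) ^ ((n : ℝ) / 2) := by positivity
  linarith

variable {A A' h h' : ℝ → ℝ} {r B : ℝ}

theorem exists_heatKer_rker (hr : 0 < r) (hA : ∀ v, HasDerivAt A (A' v) v) (hA' : Continuous A')
    (hA0 : ∀ v, r ^ 2 ≤ v → A v = 0) (hA'0 : ∀ v, r ^ 2 ≤ v → A' v = 0)
    (hh : ∀ s, HasDerivAt h (h' s) s) (hh' : Continuous h')
    (hB : ∀ s, 0 ≤ s → |h s| ≤ B * exp (-s / 8))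
    (hB' : ∀ s, 0 ≤ s → |h' s| * (1 + s) ≤ B * exp (-s / 8)) :
    ∃ C, HeatKer (n := n) (rker A h) (drker A A' h h') r C := by
  have hAc : Continuous A := continuous_iff_continuousAt.mpr fun v => (hA v).continuousAt
  have hhc : Continuous h := continuous_iff_continuousAt.mpr fun v => (hh v).continuousAt
  have bd : ∀ {f : ℝ → ℝ}, Continuous f → (∀ v, r ^ 2 ≤ v → f v = 0) →
      ∃ M, 0 ≤ M ∧ ∀ v, 0 ≤ v → |f v| ≤ M := by
    intro f hf hf0
    obtain ⟨M, hM⟩ := (isCompact_Icc (a := (0:ℝ)) (b := r ^ 2)).exists_bound_of_continuousOn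
      hf.continuousOn
    refine ⟨max M 0, le_max_right _ _, fun v hv => ?_⟩
    rcases le_total v (r ^ 2) with h | h
    · exact (hM v ⟨hv, h⟩).trans (le_max_left _ _)
    · rw [hf0 v h, abs_zero]; exact le_max_right _ _
  obtain ⟨MA, hMA0, hMA⟩ := bd hAc hA0
  obtain ⟨MA', hMA'0, hMA'⟩ := bd hA' hA'0
  have hB0 : 0 ≤ B := by
    have := (abs_nonneg _).trans (hB 0 le_rfl)
    simpa using this
  set M := max MA MA' with hM
  have hM0 : 0 ≤ M := hMA0.trans (le_max_left _ _)
  have hsq : ∀ y : Euc n, r ≤ ‖y‖ → r ^ 2 ≤ ‖y‖ ^ 2 := fun y hy => by gcongr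
  have hcw : ContinuousOn (fun w : ℝ × Euc n => ‖w.2‖ ^ 2 / w.1) (Ioi 0 ×ˢ univ) := by
    refine ContinuousOn.div (by fun_prop) (by fun_prop) fun w hw => ne_of_gt hw.1
  have hcσ : ContinuousOn (fun w : ℝ × Euc n => w.1 ^ (-(n : ℝ) / 2)) (Ioi 0 ×ˢ univ) := by
    refine ContinuousOn.rpow_const (by fun_prop) fun w hw => Or.inl (ne_of_gt hw.1)
  have hcA : ContinuousOn (fun w : ℝ × Euc n => A (‖w.2‖ ^ 2)) (Ioi 0 ×ˢ univ) :=
    (hAc.comp (by fun_prop)).continuousOn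
  have hcA' : ContinuousOn (fun w : ℝ × Euc n => A' (‖w.2‖ ^ 2)) (Ioi 0 ×ˢ univ) :=
    (hA'.comp (by fun_prop)).continuousOn
  have hch : ContinuousOn (fun w : ℝ × Euc n => h (‖w.2‖ ^ 2 / w.1)) (Ioi 0 ×ˢ univ) :=
    hhc.comp_continuousOn hcw
  have hch' : ContinuousOn (fun w : ℝ × Euc n => h' (‖w.2‖ ^ 2 / w.1) / w.1) (Ioi 0 ×ˢ univ) :=
    (hh'.comp_continuousOn hcw).div (by fun_prop) fun w hw => ne_of_gt hw.1
  set G : ℝ → Euc n → ℝ := fun σ y => σ ^ (-(n : ℝ) / 2) * exp (-(‖y‖ ^ 2 / σ) / 8) with hG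
  set Z := (8 * π) ^ ((n : ℝ) / 2) with hZ
  have hZ0 : 0 ≤ Z := by positivity
  set D := 2 * (M * B * (r * √r + 1)) with hD
  have hD0 : 0 ≤ D := by positivity
  have b1 : ∀ σ, 0 < σ → ∀ y : Euc n, ‖rker A h σ y‖ ≤ M * B * G σ y := by
    intro σ hσ y
    have hs : 0 ≤ ‖y‖ ^ 2 / σ := by positivity
    rw [rker, norm_mul, norm_mul, Real.norm_of_nonneg (rpow_nonneg hσ.le _), Real.norm_eq_abs,
      Real.norm_eq_abs]
    calc σ ^ (-(n : ℝ) / 2) * (|A (‖y‖ ^ 2)| * |h (‖y‖ ^ 2 / σ)|)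
        ≤ σ ^ (-(n : ℝ) / 2) * (M * (B * exp (-(‖y‖ ^ 2 / σ) / 8))) := by
          gcongr
          · exact (hMA _ (by positivity)).trans (le_max_left _ _)
          · exact hB _ hs
      _ = M * B * G σ y := by simp only [hG]; ring
  have b2 : ∀ σ, 0 < σ → σ ≤ r → ∀ y : Euc n,
      ‖drker A A' h h' σ y‖ ≤ D * σ ^ (-(1 / 2) : ℝ) * G σ y := by
    intro σ hσ hσr y
    have hG0 : 0 ≤ G σ y := by simp only [hG]; positivity
    rcases le_total r ‖y‖ with hy | hy
    · rw [drker, hA0 _ (hsq y hy), hA'0 _ (hsq y hy)]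
      simp only [zero_mul, add_zero, mul_zero, zero_smul, norm_zero]
      positivity
    have hs : 0 ≤ ‖y‖ ^ 2 / σ := by positivity
    have hm : 0 < √σ := sqrt_pos.mpr hσ
    have hm2 : √σ ^ 2 = σ := sq_sqrt hσ.le
    have e1 : σ ^ (-(1 / 2) : ℝ) = (√σ)⁻¹ := by rw [rpow_neg hσ.le, sqrt_eq_rpow]
    have e2 : ‖y‖ ≤ r * √r * (√σ)⁻¹ := by
      rw [mul_assoc]
      have : 1 ≤ √r * (√σ)⁻¹ := by
        rw [← div_eq_mul_inv, one_le_div hm]; exact sqrt_le_sqrt hσr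
      nlinarith
    have e3 : ‖y‖ / σ ≤ (√σ)⁻¹ * (1 + ‖y‖ ^ 2 / σ) := by
      have e4 : ‖y‖ / σ = (√σ)⁻¹ * (‖y‖ / √σ) := by
        rw [← hm2]; field_simp
        rw [sqrt_sq hm.le]
      have e5 : ‖y‖ ^ 2 / σ = (‖y‖ / √σ) ^ 2 := by rw [div_pow, hm2]
      rw [e4, e5]
      gcongr
      nlinarith [sq_nonneg (‖y‖ / √σ - 1), sq_nonneg (‖y‖ / √σ)]
    have k1 : |A' (‖y‖ ^ 2) * h (‖y‖ ^ 2 / σ)| * ‖y‖ ≤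
        M * (B * exp (-(‖y‖ ^ 2 / σ) / 8)) * (r * √r * (√σ)⁻¹) := by
      rw [abs_mul]
      gcongr
      · exact (hMA' _ (by positivity)).trans (le_max_right _ _)
      · exact hB _ hs
    have k2 : |A (‖y‖ ^ 2) * (h' (‖y‖ ^ 2 / σ) / σ)| * ‖y‖ ≤
        M * (B * exp (-(‖y‖ ^ 2 / σ) / 8)) * (√σ)⁻¹ := by
      rw [abs_mul, abs_div, abs_of_pos hσ]
      calc |A (‖y‖ ^ 2)| * (|h' (‖y‖ ^ 2 / σ)| / σ) * ‖y‖
          = |A (‖y‖ ^ 2)| * (|h' (‖y‖ ^ 2 / σ)| * (‖y‖ / σ)) := by ring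
        _ ≤ M * (|h' (‖y‖ ^ 2 / σ)| * ((√σ)⁻¹ * (1 + ‖y‖ ^ 2 / σ))) := by
          gcongr
          exact (hMA _ (by positivity)).trans (le_max_left _ _)
        _ = M * (|h' (‖y‖ ^ 2 / σ)| * (1 + ‖y‖ ^ 2 / σ)) * (√σ)⁻¹ := by ring
        _ ≤ _ := mul_le_mul_of_nonneg_right (mul_le_mul_of_nonneg_left (hB' _ hs) hM0)
          (by positivity)
    rw [drker, norm_smul, innerSL_apply_norm, Real.norm_eq_abs, abs_mul, abs_mul, abs_two,
      abs_of_nonneg (rpow_nonneg hσ.le _), e1]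
    calc _ ≤ 2 * (σ ^ (-(n : ℝ) / 2) * (|A' (‖y‖ ^ 2) * h (‖y‖ ^ 2 / σ)| +
          |A (‖y‖ ^ 2) * (h' (‖y‖ ^ 2 / σ) / σ)|)) * ‖y‖ := by
          gcongr
          exact abs_add_le _ _
      _ = 2 * (σ ^ (-(n : ℝ) / 2) * (|A' (‖y‖ ^ 2) * h (‖y‖ ^ 2 / σ)| * ‖y‖ +
          |A (‖y‖ ^ 2) * (h' (‖y‖ ^ 2 / σ) / σ)| * ‖y‖)) := by ring
      _ ≤ 2 * (σ ^ (-(n : ℝ) / 2) * (M * (B * exp (-(‖y‖ ^ 2 / σ) / 8)) * (r * √r * (√σ)⁻¹) +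
          M * (B * exp (-(‖y‖ ^ 2 / σ) / 8)) * (√σ)⁻¹)) := by
          gcongr
      _ = D * (√σ)⁻¹ * G σ y := by simp only [hG, hD]; ring
  have hMD : M * B ≤ D := by
    have : 0 ≤ M * B := by positivity
    have : 0 ≤ M * B * (r * √r) := by positivity
    rw [hD]; linarith
  refine ⟨D * Z, ?_, ?_, ?_, ?_, ?_, ?_, ?_⟩
  · intro σ hσ y
    have h1 : HasDerivAt (fun v => σ ^ (-(n : ℝ) / 2) * (A v * h (v / σ)))
        (σ ^ (-(n : ℝ) / 2) * (A' (‖y‖ ^ 2) * h (‖y‖ ^ 2 / σ) +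
          A (‖y‖ ^ 2) * (h' (‖y‖ ^ 2 / σ) / σ))) (‖y‖ ^ 2) := by
      have h2 : HasDerivAt (fun v => h (v / σ)) (h' (‖y‖ ^ 2 / σ) / σ) (‖y‖ ^ 2) := by
        refine ((hh (‖y‖ ^ 2 / σ)).comp (‖y‖ ^ 2) ((hasDerivAt_id (‖y‖ ^ 2)).div_const σ)).congr_deriv ?_
        ring
      exact ((hA _).mul h2).const_mul _
    exact hasFDerivAt_radial h1
  · exact hcσ.mul (hcA.mul hch)
  · refine ContinuousOn.smul (continuousOn_const.mul (hcσ.mul ((hcA'.mul hch).add (hcA.mul hch')))) ?_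
    exact ((innerSL ℝ).continuous.comp continuous_snd).continuousOn
  · intro σ y hy; simp [rker, hA0 _ (hsq y hy)]
  · intro σ y hy; simp [drker, hA0 _ (hsq y hy), hA'0 _ (hsq y hy)]
  · intro σ hσ _
    rw [hZ, ← integral_gaussian_scaled (n := n) hσ, ← integral_const_mul]
    refine integral_mono_of_nonneg (Eventually.of_forall fun y => norm_nonneg _)
      ((integrable_gaussian_scaled hσ).const_mul D) (Eventually.of_forall fun y => ?_)
    refine (b1 σ hσ y).trans (mul_le_mul_of_nonneg_right hMD ?_)
    simp only [hG]; positivity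
  · intro σ hσ hσr
    rw [hZ, ← integral_gaussian_scaled (n := n) hσ, mul_right_comm, ← integral_const_mul]
    exact integral_mono_of_nonneg (Eventually.of_forall fun y => norm_nonneg _)
      ((integrable_gaussian_scaled hσ).const_mul _) (Eventually.of_forall (b2 σ hσ hσr))

end RadialKernel

section Parametrix

variable {n : ℕ} {r : ℝ}

theorem lap_radial {g g' g'' : ℝ → ℝ} (hg : ∀ v, HasDerivAt g (g' v) v)
    (hg' : ∀ v, HasDerivAt g' (g'' v) v) (x : Euc n) :
    lap (fun y : Euc n => g (‖y‖ ^ 2)) x = 4 * ‖x‖ ^ 2 * g'' (‖x‖ ^ 2) + 2 * n * g' (‖x‖ ^ 2) := by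
  unfold lap
  have h1 : ∀ i : Fin n, fderiv ℝ (fun y : Euc n =>
      fderiv ℝ (fun y : Euc n => g (‖y‖ ^ 2)) y (EuclideanSpace.single i 1)) x
        (EuclideanSpace.single i 1) = 4 * g'' (‖x‖ ^ 2) * x i ^ 2 + 2 * g' (‖x‖ ^ 2) := by
    intro i
    have h2 : (fun y : Euc n => fderiv ℝ (fun y : Euc n => g (‖y‖ ^ 2)) y (EuclideanSpace.single i 1)) =
        fun y => 2 * g' (‖y‖ ^ 2) * y i := by
      ext y
      rw [(hasFDerivAt_radial (hg _)).fderiv]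
      simp [EuclideanSpace.inner_single_right]
    rw [h2]
    have h3 := ((hasFDerivAt_radial (y := x) (hg' _)).const_mul 2).mul
      (EuclideanSpace.proj (𝕜 := ℝ) i : Euc n →L[ℝ] ℝ).hasFDerivAt
    have h4 : HasFDerivAt (fun y : Euc n => 2 * g' (‖y‖ ^ 2) * y i) _ x := h3
    rw [h4.fderiv]
    simp [EuclideanSpace.inner_single_right]
    ring
  rw [Finset.sum_congr rfl fun i _ => h1 i, Finset.sum_add_distrib, ← Finset.mul_sum,
    EuclideanSpace.real_norm_sq_eq]
  simp
  ring

theorem HeatKer.add {k₁ k₂ : ℝ → Euc n → ℝ} {dk₁ dk₂ : ℝ → Euc n → Euc n →L[ℝ] ℝ} {C₁ C₂ : ℝ}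
    (h₁ : HeatKer k₁ dk₁ r C₁) (h₂ : HeatKer k₂ dk₂ r C₂) :
    HeatKer (fun σ y => k₁ σ y + k₂ σ y) (fun σ y => dk₁ σ y + dk₂ σ y) r (C₁ + C₂) where
  hasFDerivAt σ hσ y := (h₁.hasFDerivAt σ hσ y).add (h₂.hasFDerivAt σ hσ y)
  cont := h₁.cont.add h₂.cont
  dcont := h₁.dcont.add h₂.dcont
  supp σ y hy := by rw [h₁.supp σ y hy, h₂.supp σ y hy, add_zero]
  dsupp σ y hy := by rw [h₁.dsupp σ y hy, h₂.dsupp σ y hy, add_zero]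
  bound σ hσ hσr := by
    have i₁ := ((continuous_kernel h₁.cont hσ).integrable_of_hasCompactSupport
      (hasCompactSupport_kernel h₁.supp σ) (μ := volume)).norm
    have i₂ := ((continuous_kernel h₂.cont hσ).integrable_of_hasCompactSupport
      (hasCompactSupport_kernel h₂.supp σ) (μ := volume)).norm
    refine (integral_mono_of_nonneg (Eventually.of_forall fun y => norm_nonneg _) (i₁.add i₂)
      (Eventually.of_forall fun y => norm_add_le _ _)).trans ?_
    rw [integral_add' i₁ i₂]
    exact add_le_add (h₁.bound σ hσ hσr) (h₂.bound σ hσ hσr)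
  dbound σ hσ hσr := by
    have i₁ := ((continuous_kernel h₁.dcont hσ).integrable_of_hasCompactSupport
      (hasCompactSupport_kernel h₁.dsupp σ) (μ := volume)).norm
    have i₂ := ((continuous_kernel h₂.dcont hσ).integrable_of_hasCompactSupport
      (hasCompactSupport_kernel h₂.dsupp σ) (μ := volume)).norm
    refine (integral_mono_of_nonneg (Eventually.of_forall fun y => norm_nonneg _) (i₁.add i₂)
      (Eventually.of_forall fun y => norm_add_le _ _)).trans ?_
    rw [integral_add' i₁ i₂, add_mul]
    exact add_le_add (h₁.dbound σ hσ hσr) (h₂.dbound σ hσ hσr)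

theorem hasDerivAt_exp_quarter (s : ℝ) :
    HasDerivAt (fun s : ℝ => exp (-s / 4)) (-exp (-s / 4) / 4) s := by
  refine ((hasDerivAt_id s).neg.div_const 4).exp.congr_deriv ?_
  simp; ring

theorem one_add_le_exp_sixteenth (s : ℝ) : 1 + s ≤ 16 * exp (s / 16) := by
  linarith [add_one_le_exp (s / 16)]

theorem sq_mul_exp_le {s : ℝ} (hs : 0 ≤ s) : (1 + s) ^ 2 * exp (-s / 4) ≤ 256 * exp (-s / 8) := by
  have h := one_add_le_exp_sixteenth s
  have e : exp (-s / 8) = exp (s / 16) ^ 2 * exp (-s / 4) := by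
    rw [← exp_nat_mul, ← exp_add]; congr 1; push_cast; ring
  rw [e]
  have : (1 + s) ^ 2 ≤ (16 * exp (s / 16)) ^ 2 := by gcongr
  nlinarith [exp_pos (-s / 4)]

/-- The Gaussian profile. -/
def prof (s : ℝ) : ℝ := exp (-s / 4)

/-- A smooth radial cut-off, as a function of the squared norm. -/
def cut (r v : ℝ) : ℝ := Real.smoothTransition (2 - 4 / r ^ 2 * v)

theorem contDiff_cut : ContDiff ℝ ∞ (cut r) := Real.smoothTransition.contDiff.comp (by fun_prop)

theorem cut_eq_zero (hr : 0 < r) {v : ℝ} (hv : r ^ 2 / 2 ≤ v) : cut r v = 0 := by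
  apply Real.smoothTransition.zero_of_nonpos
  have : 4 / r ^ 2 * (r ^ 2 / 2) ≤ 4 / r ^ 2 * v := by gcongr
  have e : 4 / r ^ 2 * (r ^ 2 / 2) = 2 := by field_simp; norm_num
  linarith

theorem cut_zero : cut r 0 = 1 := Real.smoothTransition.one_of_one_le (by norm_num)

theorem abs_cut_le (v : ℝ) : |cut r v| ≤ 1 :=
  abs_le.mpr ⟨by
    have : 0 ≤ cut r v := Real.smoothTransition.nonneg _
    linarith, Real.smoothTransition.le_one _⟩

theorem deriv_eq_zero_of_le {f : ℝ → ℝ} {a b : ℝ} (hab : a < b) (hf : ∀ v, a < v → f v = 0) :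
    ∀ v, b ≤ v → deriv f v = 0 := by
  intro v hv
  have : f =ᶠ[𝓝 v] fun _ => 0 := by
    filter_upwards [lt_mem_nhds (hab.trans_le hv)] with w hw using hf w hw
  rw [this.deriv_eq, deriv_const]

theorem exists_parametrix (n : ℕ) (hr : 0 < r) :
    ∃ (dN : ℝ → Euc n → Euc n →L[ℝ] ℝ) (K : ℝ → Euc n → ℝ) (dK : ℝ → Euc n → Euc n →L[ℝ] ℝ)
      (C D : ℝ), HeatKer (rker (cut r) prof) dN r C ∧ HeatKer K dK r D ∧
      (∀ σ, 0 < σ → ContDiff ℝ ∞ (rker (n := n) (cut r) prof σ)) ∧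
      (∀ σ, 0 < σ → ∀ y, HasDerivAt (fun σ => rker (cut r) prof σ y)
        (lap (rker (cut r) prof σ) y - K σ y) σ) ∧
      ContinuousOn (fun w : ℝ × Euc n => lap (rker (cut r) prof w.1) w.2) (Ioi 0 ×ˢ univ) := by
  set ψ := cut r with hψ
  have c0 : ContDiff ℝ ∞ ψ := contDiff_cut
  have c1 : ContDiff ℝ ∞ (deriv ψ) := (contDiff_infty_iff_deriv.mp c0).2
  have c2 : ContDiff ℝ ∞ (deriv (deriv ψ)) := (contDiff_infty_iff_deriv.mp c1).2
  have c3 : ContDiff ℝ ∞ (deriv (deriv (deriv ψ))) := (contDiff_infty_iff_deriv.mp c2).2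
  have hd : ∀ {f : ℝ → ℝ}, ContDiff ℝ ∞ f → ∀ v, HasDerivAt f (deriv f v) v := fun hf v =>
    ((contDiff_infty_iff_deriv.mp hf).1 v).hasDerivAt
  have hr2 : 0 < r ^ 2 := by positivity
  have z0 : ∀ v, r ^ 2 / 2 ≤ v → ψ v = 0 := fun v hv => cut_eq_zero hr hv
  have z1 : ∀ v, 4 * r ^ 2 / 6 ≤ v → deriv ψ v = 0 :=
    deriv_eq_zero_of_le (by linarith) fun v hv => z0 v hv.le
  have z2 : ∀ v, 5 * r ^ 2 / 6 ≤ v → deriv (deriv ψ) v = 0 :=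
    deriv_eq_zero_of_le (by linarith) fun v hv => z1 v hv.le
  have z3 : ∀ v, r ^ 2 ≤ v → deriv (deriv (deriv ψ)) v = 0 :=
    deriv_eq_zero_of_le (by linarith) fun v hv => z2 v hv.le
  have hp : ∀ s, HasDerivAt prof (-exp (-s / 4) / 4) s := hasDerivAt_exp_quarter
  have hB1 : ∀ s : ℝ, 0 ≤ s → |prof s| ≤ 256 * exp (-s / 8) := fun s hs => by
    rw [prof, abs_of_pos (exp_pos _)]
    have := sq_mul_exp_le hs
    nlinarith [exp_pos (-s / 4), mul_nonneg hs (exp_pos (-s / 4)).le,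
      mul_nonneg (sq_nonneg s) (exp_pos (-s / 4)).le]
  have hB2 : ∀ s : ℝ, 0 ≤ s → |-exp (-s / 4) / 4| * (1 + s) ≤ 256 * exp (-s / 8) := fun s hs => by
    rw [abs_div, abs_neg, abs_of_pos (exp_pos _), abs_of_pos (by norm_num : (0:ℝ) < 4)]
    have := sq_mul_exp_le hs
    nlinarith [exp_pos (-s / 4), mul_nonneg hs (exp_pos (-s / 4)).le,
      mul_nonneg (sq_nonneg s) (exp_pos (-s / 4)).le]
  obtain ⟨C, hC⟩ := exists_heatKer_rker (n := n) hr (hd c0) c1.continuous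
    (fun v hv => z0 v (by linarith)) (fun v hv => z1 v (by linarith)) hp (by fun_prop) hB1 hB2
  have hA1 : ∀ v, HasDerivAt (fun v => 4 * v * deriv (deriv ψ) v + 2 * n * deriv ψ v)
      (4 * deriv (deriv ψ) v + 4 * v * deriv (deriv (deriv ψ)) v + 2 * n * deriv (deriv ψ) v) v := by
    intro v
    refine ((((hasDerivAt_id v).const_mul 4).mul (hd c2 v)).add
      ((hd c1 v).const_mul (2 * (n : ℝ)))).congr_deriv ?_
    simp
  obtain ⟨D1, hD1⟩ := exists_heatKer_rker (n := n) hr hA1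
    (by have := c2.continuous; have := c3.continuous; fun_prop)
    (fun v hv => by rw [z2 v (by linarith), z1 v (by linarith)]; simp)
    (fun v hv => by rw [z2 v (by linarith), z3 v hv]; simp) hp (by fun_prop) hB1 hB2
  have hq : ∀ s, HasDerivAt (fun s => s * prof s) ((1 - s / 4) * exp (-s / 4)) s := by
    intro s
    refine ((hasDerivAt_id s).mul (hp s)).congr_deriv ?_
    simp [prof]; ring
  have hB3 : ∀ s : ℝ, 0 ≤ s → |s * prof s| ≤ 256 * exp (-s / 8) := fun s hs => by
    rw [prof, abs_of_nonneg (by positivity)]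
    have := sq_mul_exp_le hs
    nlinarith [exp_pos (-s / 4), mul_nonneg hs (exp_pos (-s / 4)).le,
      mul_nonneg (sq_nonneg s) (exp_pos (-s / 4)).le]
  have hB4 : ∀ s : ℝ, 0 ≤ s → |(1 - s / 4) * exp (-s / 4)| * (1 + s) ≤ 256 * exp (-s / 8) :=
    fun s hs => by
    rw [abs_mul, abs_of_pos (exp_pos _)]
    have h1 : |1 - s / 4| ≤ 1 + s := abs_le.mpr ⟨by linarith, by linarith⟩
    refine le_trans ?_ (sq_mul_exp_le hs)
    calc _ ≤ (1 + s) * exp (-s / 4) * (1 + s) := by gcongr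
      _ = _ := by ring
  obtain ⟨D2, hD2⟩ := exists_heatKer_rker (n := n) (A := fun v => -2 * deriv ψ v)
    (A' := fun v => -2 * deriv (deriv ψ) v) hr
    (fun v => (hd c1 v).const_mul _) (by have := c2.continuous; fun_prop)
    (fun v hv => by rw [z1 v (by linarith)]; simp)
    (fun v hv => by rw [z2 v (by linarith)]; simp) hq (by fun_prop) hB3 hB4
  have hlap : ∀ σ, 0 < σ → ∀ y : Euc n, lap (rker ψ prof σ) y = σ ^ (-(n : ℝ) / 2) *
      (exp (-(‖y‖ ^ 2 / σ) / 4) * (4 * ‖y‖ ^ 2 * (deriv (deriv ψ) (‖y‖ ^ 2) -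
        deriv ψ (‖y‖ ^ 2) / (2 * σ) + ψ (‖y‖ ^ 2) / (16 * σ ^ 2)) +
        2 * n * (deriv ψ (‖y‖ ^ 2) - ψ (‖y‖ ^ 2) / (4 * σ)))) := by
    intro σ hσ y
    have he : ∀ v, HasDerivAt (fun v => prof (v / σ)) (-prof (v / σ) / (4 * σ)) v := fun v => by
      refine ((hp (v / σ)).comp v ((hasDerivAt_id v).div_const σ)).congr_deriv ?_
      simp only [prof]; field_simp
    have g1 : ∀ v, HasDerivAt (fun v => σ ^ (-(n : ℝ) / 2) * (ψ v * prof (v / σ)))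
        (σ ^ (-(n : ℝ) / 2) * ((deriv ψ v - ψ v / (4 * σ)) * prof (v / σ))) v := fun v => by
      refine (((hd c0 v).mul (he v)).const_mul _).congr_deriv ?_
      ring
    have g2 : ∀ v, HasDerivAt (fun v => σ ^ (-(n : ℝ) / 2) *
        ((deriv ψ v - ψ v / (4 * σ)) * prof (v / σ)))
        (σ ^ (-(n : ℝ) / 2) * ((deriv (deriv ψ) v - deriv ψ v / (2 * σ) + ψ v / (16 * σ ^ 2)) *
          prof (v / σ))) v := fun v => by
      refine ((((hd c1 v).sub ((hd c0 v).div_const (4 * σ))).mul (he v)).const_mul _).congr_deriv ?_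
      simp only [Pi.sub_apply]
      field_simp
      ring
    have h3 := lap_radial (n := n) g1 g2 y
    refine Eq.trans ?_ (h3.trans ?_)
    · rfl
    · simp only [prof]; ring
  refine ⟨_, _, _, C, D1 + D2, hC, hD1.add hD2, ?_, ?_, ?_⟩
  · intro σ hσ
    unfold rker prof
    have hn : ContDiff ℝ ∞ fun y : Euc n => ‖y‖ ^ 2 := contDiff_norm_sq ℝ
    exact contDiff_const.mul ((c0.comp hn).mul (((hn.div_const σ).neg.div_const 4).exp))
  · intro σ hσ y
    rw [hlap σ hσ y]
    have e1 : HasDerivAt (fun σ : ℝ => σ ^ (-(n : ℝ) / 2)) (-(n : ℝ) / 2 * (σ ^ (-(n : ℝ) / 2) / σ)) σ := by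
      refine (Real.hasDerivAt_rpow_const (Or.inl hσ.ne')).congr_deriv ?_
      rw [rpow_sub hσ, rpow_one]
    have e2 : HasDerivAt (fun σ : ℝ => prof (‖y‖ ^ 2 / σ))
        (‖y‖ ^ 2 / (4 * σ ^ 2) * prof (‖y‖ ^ 2 / σ)) σ := by
      have e3 : HasDerivAt (fun σ : ℝ => ‖y‖ ^ 2 / σ) (-‖y‖ ^ 2 / σ ^ 2) σ := by
        refine ((hasDerivAt_const σ (‖y‖ ^ 2)).div (hasDerivAt_id σ) hσ.ne').congr_deriv ?_
        simp
      refine ((hp (‖y‖ ^ 2 / σ)).comp σ e3).congr_deriv ?_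
      simp only [prof]; field_simp
    refine (e1.mul (e2.const_mul (ψ (‖y‖ ^ 2)))).congr_deriv ?_
    simp only [rker, prof]
    field_simp
    ring
  · refine ContinuousOn.congr (f := fun w : ℝ × Euc n => w.1 ^ (-(n : ℝ) / 2) *
      (exp (-(‖w.2‖ ^ 2 / w.1) / 4) * (4 * ‖w.2‖ ^ 2 * (deriv (deriv ψ) (‖w.2‖ ^ 2) -
        deriv ψ (‖w.2‖ ^ 2) / (2 * w.1) + ψ (‖w.2‖ ^ 2) / (16 * w.1 ^ 2)) +
        2 * n * (deriv ψ (‖w.2‖ ^ 2) - ψ (‖w.2‖ ^ 2) / (4 * w.1))))) ?_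
        fun w hw => hlap w.1 hw.1 w.2
    have hne : ∀ w ∈ Ioi (0:ℝ) ×ˢ (univ : Set (Euc n)), w.1 ≠ 0 := fun w hw => ne_of_gt hw.1
    have h0 := c0.continuous
    have h1 := c1.continuous
    have h2 := c2.continuous
    have k0 : ContinuousOn (fun w : ℝ × Euc n => ψ (‖w.2‖ ^ 2)) (Ioi 0 ×ˢ univ) := by fun_prop
    have k1 : ContinuousOn (fun w : ℝ × Euc n => deriv ψ (‖w.2‖ ^ 2)) (Ioi 0 ×ˢ univ) := by fun_prop
    have k2 : ContinuousOn (fun w : ℝ × Euc n => deriv (deriv ψ) (‖w.2‖ ^ 2)) (Ioi 0 ×ˢ univ) := by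
      fun_prop
    have kn : ContinuousOn (fun w : ℝ × Euc n => ‖w.2‖ ^ 2) (Ioi 0 ×ˢ univ) := by fun_prop
    have kσ : ContinuousOn (fun w : ℝ × Euc n => w.1) (Ioi 0 ×ˢ univ) := by fun_prop
    refine (kσ.rpow_const fun w hw => Or.inl (hne w hw)).mul (((kn.div kσ hne).neg.div_const 4).rexp.mul
      (((continuousOn_const.mul kn).mul ((k2.sub (k1.div (continuousOn_const.mul kσ) ?_)).add
        (k0.div (continuousOn_const.mul (kσ.pow 2)) ?_))).add
        (continuousOn_const.mul (k1.sub (k0.div (continuousOn_const.mul kσ) ?_)))))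
    all_goals intro w hw; have := hne w hw; simpa using this

end Parametrix

section Representation

variable {n : ℕ} {f : Euc n × ℝ → ℝ} {r M : ℝ}

theorem slice_parametrix_eq (f : Euc n × ℝ → ℝ) (z : Euc n × ℝ) {σ : ℝ} (hσ : 0 < σ) :
    slice (rker (cut r) prof) f σ z =
      ∫ w, f (z.1 - √σ • w, z.2 - σ) * (cut r (σ * ‖w‖ ^ 2) * exp (-‖w‖ ^ 2 / 4)) := by
  have hs : 0 < √σ := Real.sqrt_pos.mpr hσ
  have h := Measure.integral_comp_smul (volume : Measure (Euc n))
    (fun y => f (z.1 - y, z.2 - σ) * (cut r (‖y‖ ^ 2) * prof (‖y‖ ^ 2 / σ))) (√σ)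
  have e : ∀ w : Euc n, ‖√σ • w‖ ^ 2 = σ * ‖w‖ ^ 2 := fun w => by
    rw [norm_smul, mul_pow, Real.norm_of_nonneg hs.le, Real.sq_sqrt hσ.le]
  have e2 : σ ^ (-(n : ℝ) / 2) = |((√σ) ^ n)⁻¹| := by
    rw [abs_of_nonneg (by positivity), Real.sqrt_eq_rpow, ← Real.rpow_natCast, ← Real.rpow_mul hσ.le,
      ← Real.rpow_neg hσ.le]
    congr 1; ring
  rw [finrank_euclideanSpace_fin, smul_eq_mul, ← e2] at h
  unfold slice rker
  simp only [e, smul_eq_mul] at h ⊢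
  rw [← integral_const_mul] at h
  calc _ = ∫ y : Euc n, σ ^ (-(n : ℝ) / 2) * (f (z.1 - y, z.2 - σ) *
        (cut r (‖y‖ ^ 2) * prof (‖y‖ ^ 2 / σ))) := by congr 1; ext y; ring
    _ = _ := by
        rw [← h]; congr 1; ext w
        rw [prof, mul_div_cancel_left₀ _ hσ.ne']

theorem integrable_gaussian_quarter : Integrable fun w : Euc n => exp (-‖w‖ ^ 2 / 4) := by
  by_contra h
  have := GaussianFourier.integral_rexp_neg_mul_sq_norm (V := Euc n) (b := 1 / 4) (by positivity)
  have e : (fun w : Euc n => exp (-‖w‖ ^ 2 / 4)) = fun w => exp (-(1 / 4) * ‖w‖ ^ 2) := by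
    ext w; congr 1; ring
  rw [← e, integral_undef h] at this
  have h2 : (0 : ℝ) < (π / (1 / 4)) ^ ((Module.finrank ℝ (Euc n) : ℝ) / 2) := by positivity
  exact h2.ne this

/-- The mass of the heat kernel. -/
def gmass (n : ℕ) : ℝ := ∫ w : Euc n, exp (-‖w‖ ^ 2 / 4)

theorem gmass_pos : 0 < gmass n := by
  have := GaussianFourier.integral_rexp_neg_mul_sq_norm (V := Euc n) (b := 1 / 4) (by positivity)
  have e : (fun w : Euc n => exp (-‖w‖ ^ 2 / 4)) = fun w => exp (-(1 / 4) * ‖w‖ ^ 2) := by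
    ext w; congr 1; ring
  rw [gmass, e, this]
  positivity

theorem tendsto_slice_parametrix (hf : Continuous f) (hM : ∀ z, |f z| ≤ M) (z : Euc n × ℝ) :
    Tendsto (fun σ => slice (rker (cut r) prof) f σ z) (𝓝[>] 0) (𝓝 (gmass n * f z)) := by
  have hM0 : 0 ≤ M := (abs_nonneg _).trans (hM 0)
  have hcut : Continuous (cut r) := contDiff_cut.continuous
  have hc : Continuous fun σ : ℝ =>
      ∫ w : Euc n, f (z.1 - √σ • w, z.2 - σ) * (cut r (σ * ‖w‖ ^ 2) * exp (-‖w‖ ^ 2 / 4)) := by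
    refine continuous_of_dominated (bound := fun w => M * exp (-‖w‖ ^ 2 / 4))
      (fun σ => ?_) (fun σ => Eventually.of_forall fun w => ?_)
      (integrable_gaussian_quarter.const_mul M) (Eventually.of_forall fun w => ?_)
    · exact Continuous.aestronglyMeasurable (by fun_prop)
    · rw [Real.norm_eq_abs, abs_mul, abs_mul, abs_of_nonneg (exp_pos _).le]
      refine mul_le_mul (hM _) ?_ (by positivity) hM0
      exact mul_le_of_le_one_left (exp_pos _).le (abs_cut_le _)
    · fun_prop
  have h0 := hc.tendsto 0
  simp only [Real.sqrt_zero, zero_smul, sub_zero, zero_mul, cut_zero, one_mul] at h0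
  rw [integral_const_mul, mul_comm] at h0
  refine (h0.mono_left nhdsWithin_le_nhds).congr' ?_
  filter_upwards [self_mem_nhdsWithin] with σ hσ
  exact (slice_parametrix_eq f z hσ).symm

end Representation

/-- `u` solves the heat equation with right-hand side `g` on `U × I`, in the weak sense in space. -/
def WeakHeat {n : ℕ} (u g : Euc n × ℝ → ℝ) (U : Set (Euc n)) (I : Set ℝ) : Prop :=
  ∀ ρ : Euc n → ℝ, ContDiff ℝ ∞ ρ → HasCompactSupport ρ → tsupport ρ ⊆ U → ∀ t ∈ I,
    HasDerivAt (fun t => ∫ x, ρ x * u (x, t))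
      ((∫ x, lap ρ x * u (x, t)) + ∫ x, ρ x * g (x, t)) t

section SliceDerivative

variable {n : ℕ} {k L K : ℝ → Euc n → ℝ} {f g : Euc n × ℝ → ℝ} {r : ℝ}

theorem hasDerivAt_integral_kernel
    (hk : ContinuousOn (fun w : ℝ × Euc n => k w.1 w.2) (Ioi 0 ×ˢ univ))
    (hL : ContinuousOn (fun w : ℝ × Euc n => L w.1 w.2) (Ioi 0 ×ˢ univ))
    (hks : ∀ σ y, r ≤ ‖y‖ → k σ y = 0) (hLs : ∀ σ, 0 < σ → ∀ y, r ≤ ‖y‖ → L σ y = 0)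
    (hd : ∀ σ, 0 < σ → ∀ y, HasDerivAt (fun σ => k σ y) (L σ y) σ)
    {h : Euc n → ℝ} (hh : Continuous h) {σ : ℝ} (hσ : 0 < σ) :
    HasDerivAt (fun σ => ∫ y, h y • k σ y) (∫ y, h y • L σ y) σ := by
  have hcpt : IsCompact (Icc (σ / 2) (2 * σ) ×ˢ Metric.closedBall (0 : Euc n) r) :=
    isCompact_Icc.prod (isCompact_closedBall _ _)
  obtain ⟨C, hC⟩ := hcpt.exists_bound_of_continuousOn (f := fun w => h w.2 • L w.1 w.2)
    ((hh.comp continuous_snd).continuousOn.smul (hL.mono fun w hw =>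
      ⟨(half_pos hσ).trans_le hw.1.1, mem_univ _⟩))
  refine (hasDerivAt_integral_of_dominated_loc_of_deriv_le (s := Icc (σ / 2) (2 * σ))
    (F := fun σ y => h y • k σ y) (F' := fun σ y => h y • L σ y)
    (bound := (Metric.closedBall (0 : Euc n) r).indicator fun _ => C)
    (Icc_mem_nhds (by linarith) (by linarith)) ?_ ?_ ?_ ?_ ?_ ?_).2
  · filter_upwards [lt_mem_nhds hσ] with s hs
    exact (hh.smul (continuous_kernel hk hs)).aestronglyMeasurable
  · exact (hh.smul (continuous_kernel hk hσ)).integrable_of_hasCompactSupport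
      (hasCompactSupport_kernel hks σ).smul_left
  · exact (hh.smul (continuous_kernel hL hσ)).aestronglyMeasurable
  · refine Eventually.of_forall fun y s hs => ?_
    by_cases hy : y ∈ Metric.closedBall (0 : Euc n) r
    · rw [indicator_of_mem hy]
      exact hC (s, y) ⟨hs, hy⟩
    · rw [indicator_of_notMem hy]
      rw [mem_closedBall_zero_iff, not_le] at hy
      rw [hLs s ((half_pos hσ).trans_le hs.1) y hy.le, smul_zero, norm_zero]
  · exact (integrable_indicator_iff measurableSet_closedBall).mpr
      (integrableOn_const (isCompact_closedBall _ _).measure_lt_top.ne)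
  · exact Eventually.of_forall fun y s hs => (hd s ((half_pos hσ).trans_le hs.1) y).const_smul (h y)

theorem lap_sub_left {ρ : Euc n → ℝ} (hρ : ContDiff ℝ 2 ρ) (x y : Euc n) :
    lap (fun y => ρ (x - y)) y = lap ρ (x - y) := by
  have h := lap_comp_smul hρ x (-1) y
  simp only [neg_smul, one_smul, ← sub_eq_add_neg] at h
  rw [h]; ring

/-- Differentiating the pairing of a weak solution with a translated, reflected test function. -/
theorem WeakHeat.hasDerivAt_reflected {U : Set (Euc n)} {I : Set ℝ} (hw : WeakHeat f g U I)
    {ρ : Euc n → ℝ} (hρ : ContDiff ℝ ∞ ρ) (hs : ∀ y, r ≤ ‖y‖ → ρ y = 0) {x : Euc n}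
    (hx : Metric.closedBall x r ⊆ U) {t : ℝ} (ht : t ∈ I) :
    HasDerivAt (fun t => ∫ y, f (x - y, t) • ρ y)
      ((∫ y, f (x - y, t) • lap ρ y) + ∫ y, g (x - y, t) • ρ y) t := by
  have hsub : ∀ y, y ∉ Metric.closedBall x r → ρ (x - y) = 0 := fun y hy => hs _ (by
    rw [Metric.mem_closedBall, dist_comm, dist_eq_norm, not_le] at hy; exact hy.le)
  have hts : tsupport (fun y => ρ (x - y)) ⊆ Metric.closedBall x r :=
    closure_minimal (fun y hy => by by_contra h; exact hy (hsub y h)) Metric.isClosed_closedBall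
  have h := hw (fun y => ρ (x - y)) (hρ.comp (by fun_prop))
    (HasCompactSupport.intro (isCompact_closedBall x r) hsub) (hts.trans hx) t ht
  have e : ∀ (P Q : Euc n → ℝ), ∫ y, P (x - y) * Q y = ∫ y, Q (x - y) • P y := fun P Q => by
    rw [← integral_sub_left_eq_self _ _ x]
    congr 1; ext y
    rw [sub_sub_cancel, smul_eq_mul, mul_comm]
  simp only [lap_sub_left (contDiff_infty.mp hρ 2)] at h
  rw [e (lap ρ) (fun y => f (y, t)), e ρ (fun y => g (y, t))] at h
  have e2 : (fun t => ∫ y, f (x - y, t) • ρ y) = fun t => ∫ y, ρ (x - y) * f (y, t) :=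
    funext fun t => (e ρ fun y => f (y, t)).symm
  rw [e2]
  exact h

theorem WeakHeat.hasDerivAt_slice {U : Set (Euc n)} {I : Set ℝ} (hw : WeakHeat f g U I)
    (hI : IsOpen I) (hf : Continuous f) (hg : Continuous g)
    (hk : ContinuousOn (fun w : ℝ × Euc n => k w.1 w.2) (Ioi 0 ×ˢ univ))
    (hK : ContinuousOn (fun w : ℝ × Euc n => K w.1 w.2) (Ioi 0 ×ˢ univ))
    (hL : ContinuousOn (fun w : ℝ × Euc n => lap (k w.1) w.2) (Ioi 0 ×ˢ univ))
    (hks : ∀ σ y, r ≤ ‖y‖ → k σ y = 0) (hKs : ∀ σ y, r ≤ ‖y‖ → K σ y = 0)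
    (hsm : ∀ σ, 0 < σ → ContDiff ℝ ∞ (k σ))
    (hd : ∀ σ, 0 < σ → ∀ y, HasDerivAt (fun σ => k σ y) (lap (k σ) y - K σ y) σ)
    {x : Euc n} (hx : Metric.closedBall x r ⊆ U) {t σ : ℝ} (hσ : 0 < σ) (ht : t - σ ∈ I) :
    HasDerivAt (fun σ => slice k f σ (x, t)) (-(slice K f σ (x, t)) - slice k g σ (x, t)) σ := by
  have hLs : ∀ σ, 0 < σ → ∀ y, r ≤ ‖y‖ → lap (k σ) y = 0 := fun s hs y hy => by
    have h1 := hd s hs y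
    have e : (fun σ => k σ y) = fun _ => 0 := funext fun σ => hks σ y hy
    rw [hKs s y hy, sub_zero, e] at h1
    exact h1.unique (hasDerivAt_const _ _)
  have hLs' : ∀ σ y, r ≤ ‖y‖ → (fun s y => if 0 < s then lap (k s) y else 0) σ y = 0 := by
    intro s y hy
    by_cases h : 0 < s
    · simp [h, hLs s h y hy]
    · simp [h]
  have hL' : ContinuousOn (fun w : ℝ × Euc n =>
      (fun s y => if 0 < s then lap (k s) y else 0) w.1 w.2) (Ioi 0 ×ˢ univ) :=
    hL.congr fun w hw => by simp [show 0 < w.1 from hw.1]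
  have hcL := continuousOn_slice hL' hLs' hf
  have hcK := continuousOn_slice hK hKs hf
  have hcg := continuousOn_slice hk hks hg
  set L : ℝ → Euc n → ℝ := fun s y => if 0 < s then lap (k s) y else 0 with hLdef
  have hpos : ∀ᶠ v : ℝ × ℝ in 𝓝 (σ, σ), 0 < v.1 :=
    continuous_fst.continuousAt.eventually (lt_mem_nhds hσ)
  have hti : ∀ᶠ v : ℝ × ℝ in 𝓝 (σ, σ), t - v.2 ∈ I :=
    (continuous_const.sub continuous_snd).continuousAt.eventually (hI.mem_nhds ht)
  have hcomp : ∀ {H : ℝ × (Euc n × ℝ) → ℝ}, ContinuousOn H (Ioi 0 ×ˢ univ) →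
      ContinuousAt (fun v : ℝ × ℝ => H (v.1, (x, t + v.1 - v.2))) (σ, σ) := fun hH =>
    ContinuousAt.comp (f := fun v : ℝ × ℝ => (v.1, (x, t + v.1 - v.2)))
      (hH.continuousAt ((isOpen_Ioi.prod isOpen_univ).mem_nhds ⟨hσ, mem_univ _⟩))
      (by fun_prop)
  have hst := hasStrictFDerivAt_uncurry_coprod (𝕜 := ℝ) (u := (σ, σ))
    (f := fun s s' => slice k f s (x, t + s - s'))
    (f₁ := fun s s' => (slice L f s (x, t + s - s') - slice K f s (x, t + s - s')) •
      ContinuousLinearMap.id ℝ ℝ)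
    (f₂ := fun s s' => (-(slice L f s (x, t + s - s') + slice k g s (x, t + s - s'))) •
      ContinuousLinearMap.id ℝ ℝ) ?_ ?_ ?_ ?_
  · have hdiag := hst.hasFDerivAt.comp_hasDerivAt (x := σ) (f := fun s : ℝ => (s, s))
      ((hasDerivAt_id σ).prodMk (hasDerivAt_id σ))
    have e : (fun σ => slice k f σ (x, t)) = (↿fun s s' => slice k f s (x, t + s - s')) ∘
        fun s : ℝ => (s, s) := by
      ext s
      simp [Function.HasUncurry.uncurry]
    rw [e]
    refine hdiag.congr_deriv ?_
    simp [Function.HasUncurry.uncurry]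
    ring
  · filter_upwards [hpos] with v hv
    have h1 := hasDerivAt_integral_kernel hk (L := fun s y => lap (k s) y - K s y) (hL.sub hK) hks
      (fun s hs y hy => by rw [hLs s hs y hy, hKs s y hy, sub_zero]) hd
      (h := fun y => f (x - y, t - v.2)) (hf.comp (by fun_prop)) hv
    have e : (fun s => slice k f s (x, t + s - v.2)) = fun s => ∫ y, f (x - y, t - v.2) • k s y := by
      ext s
      simp only [slice]
      congr 1; ext y
      congr 3; ring
    have hi : ∀ {P : Euc n → ℝ}, Continuous P → (∀ y, r ≤ ‖y‖ → P y = 0) →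
        Integrable fun y => f (x - y, t - v.2) • P y := fun {P} hP hs =>
      ((hf.comp (f := fun y => (x - y, t - v.2)) (by fun_prop)).smul hP).integrable_of_hasCompactSupport
        ((hasCompactSupport_kernel (k := fun _ => P) (fun _ => hs) 0).smul_left)
    have e2 : slice L f v.1 (x, t + v.1 - v.2) - slice K f v.1 (x, t + v.1 - v.2) =
        ∫ y, f (x - y, t - v.2) • (lap (k v.1) y - K v.1 y) := by
      simp only [smul_sub]
      rw [integral_sub (hi (continuous_kernel (k := fun s y => lap (k s) y) hL hv) (hLs _ hv))
        (hi (continuous_kernel hK hv) (hKs _))]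
      simp only [slice, hLdef, if_pos hv]
      congr 3 <;> ext y <;> congr 3 <;> ring
    rw [e]
    refine h1.hasFDerivAt.congr_fderiv ?_
    ext
    simp [Function.HasUncurry.uncurry, e2]
  · filter_upwards [hpos, hti] with v hv hv2
    have h1 := hw.hasDerivAt_reflected (hsm v.1 hv) (hks v.1) hx hv2
    have h2 := HasDerivAt.scomp (h := fun s' => t - s') v.2 h1 ((hasDerivAt_id v.2).const_sub t)
    have e : (fun s' => slice k f v.1 (x, t + v.1 - s')) =
        (fun t => ∫ y, f (x - y, t) • k v.1 y) ∘ fun s' => t - s' := by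
      ext s
      simp only [slice, Function.comp]
      congr 1; ext y
      congr 3; ring
    rw [e]
    refine h2.hasFDerivAt.congr_fderiv ?_
    ext
    simp [Function.HasUncurry.uncurry, slice, hLdef, hv, show t + v.1 - v.2 - v.1 = t - v.2 by ring]
  · exact ((hcomp hcL).sub (hcomp hcK)).smul continuousAt_const
  · exact ((hcomp hcL).add (hcomp hcg)).neg.smul continuousAt_const

end SliceDerivative

section LocalRegularity

variable {n : ℕ} {f g : Euc n × ℝ → ℝ} {r M : ℝ} {U : Set (Euc n)} {I : Set ℝ}

theorem lap_eq_zero_of_notMem_tsupport {ρ : Euc n → ℝ} {x : Euc n} (hx : x ∉ tsupport ρ) :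
    lap ρ x = 0 := by
  rw [lap_congr (notMem_tsupport_iff_eventuallyEq.mp hx)]
  simp [lap]

theorem WeakHeat.congr {f' g' : Euc n × ℝ → ℝ} (hw : WeakHeat f g U I) (hI : IsOpen I)
    (hf : ∀ x ∈ U, ∀ t ∈ I, f' (x, t) = f (x, t)) (hg : ∀ x ∈ U, ∀ t ∈ I, g' (x, t) = g (x, t)) :
    WeakHeat f' g' U I := by
  intro ρ hρ hc hs t ht
  have e : ∀ {ψ : Euc n → ℝ} {P Q : Euc n × ℝ → ℝ}, (∀ x, x ∉ tsupport ρ → ψ x = 0) →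
      (∀ x ∈ U, ∀ t ∈ I, P (x, t) = Q (x, t)) → ∀ t ∈ I, ∫ x, ψ x * P (x, t) = ∫ x, ψ x * Q (x, t) := by
    intro ψ P Q h0 h t ht
    congr 1; ext x
    by_cases hx : x ∈ tsupport ρ
    · rw [h x (hs hx) t ht]
    · rw [h0 x hx, zero_mul, zero_mul]
  have h0 : ∀ x, x ∉ tsupport ρ → ρ x = 0 := fun x => image_eq_zero_of_notMem_tsupport
  have h1 : ∀ x, x ∉ tsupport ρ → lap ρ x = 0 := fun x => lap_eq_zero_of_notMem_tsupport
  rw [e h1 hf t ht, e h0 hg t ht]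
  refine (hw ρ hρ hc hs t ht).congr_of_eventuallyEq ?_
  filter_upwards [hI.mem_nhds ht] with s hs
  exact e h0 hf s hs

theorem WeakHeat.mono {V : Set (Euc n)} {J : Set ℝ} (hw : WeakHeat f g U I) (hV : V ⊆ U)
    (hJ : J ⊆ I) : WeakHeat f g V J :=
  fun ρ hρ hc hs t ht => hw ρ hρ hc (hs.trans hV) t (hJ ht)

/-- A bounded weak solution of the heat equation is locally `C¹` in space. -/
theorem WeakHeat.exists_gradient_of_bounded {x₀ : Euc n} {t₀ : ℝ} (hr : 0 < r)
    (hw : WeakHeat f g (Metric.ball x₀ (2 * r)) (Metric.ball t₀ (2 * r)))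
    (hf : Continuous f) (hg : Continuous g) (hfM : ∀ z, |f z| ≤ M) (hgM : ∀ z, |g z| ≤ M) :
    ∃ F : Euc n × ℝ → Euc n →L[ℝ] ℝ, Continuous F ∧
      ∀ x ∈ Metric.ball x₀ r, ∀ t ∈ Metric.ball t₀ r, HasFDerivAt (fun x => f (x, t)) (F (x, t)) x := by
  obtain ⟨dN, K, dK, C, D, hN, hK, hsm, hd, hL⟩ := exists_parametrix n hr
  set N : ℝ → Euc n → ℝ := rker (cut r) prof with hNdef
  have hrep : ∀ x ∈ Metric.ball x₀ r, ∀ t ∈ Metric.ball t₀ r,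
      f (x, t) = (gmass n)⁻¹ * (slice N f r (x, t) + potl K f r (x, t) + potl N g r (x, t)) := by
    intro x hx t ht
    have hsub : Metric.closedBall x r ⊆ Metric.ball x₀ (2 * r) := by
      refine Metric.closedBall_subset_ball' ?_
      rw [Metric.mem_ball] at hx; linarith
    have hder : ∀ σ ∈ Ioo 0 r, HasDerivAt (fun σ => slice N f σ (x, t))
        (-(slice K f σ (x, t)) - slice N g σ (x, t)) σ := fun σ hσ =>
      hw.hasDerivAt_slice Metric.isOpen_ball hf hg hN.cont hK.cont hL hN.supp hK.supp hsm hd hsub hσ.1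
        (by
          rw [Metric.mem_ball, Real.dist_eq, abs_lt] at *
          constructor <;> linarith [hσ.1, hσ.2])
    have hi1 := hK.integrable_slice hf hfM (x, t)
    have hi2 := hN.integrable_slice hg hgM (x, t)
    have hcr : Tendsto (fun σ => slice N f σ (x, t)) (𝓝[<] r) (𝓝 (slice N f r (x, t))) := by
      have h1 : ContinuousAt (fun σ => slice N f σ (x, t)) r :=
        ContinuousAt.comp (g := fun w : ℝ × (Euc n × ℝ) => slice N f w.1 w.2)
          (f := fun σ => (σ, (x, t))) ((continuousOn_slice hN.cont hN.supp hf).continuousAt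
            ((isOpen_Ioi.prod isOpen_univ).mem_nhds ⟨hr, mem_univ _⟩)) (by fun_prop)
      exact h1.tendsto.mono_left nhdsWithin_le_nhds
    have hftc := intervalIntegral.integral_eq_sub_of_hasDerivAt_of_tendsto hr hder
      ((intervalIntegrable_iff_integrableOn_Ioc_of_le hr.le).mpr (hi1.neg.sub hi2))
      (tendsto_slice_parametrix hf hfM (x, t)) hcr
    rw [intervalIntegral.integral_of_le hr.le, integral_sub (f := fun σ => -slice K f σ (x, t)) hi1.neg hi2,
      integral_neg] at hftc
    change -potl K f r (x, t) - potl N g r (x, t) = _ at hftc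
    rw [eq_inv_mul_iff_mul_eq₀ gmass_pos.ne']
    linarith
  refine ⟨fun z => (gmass n)⁻¹ • (slice dN f r z + potl dK f r z + potl dN g r z), ?_, ?_⟩
  · have h := (((continuous_slice hN.dcont hN.dsupp hf hr).add
      (continuous_potl hK.dcont hK.dsupp hf hfM hK.dbound)).add
      (continuous_potl hN.dcont hN.dsupp hg hgM hN.dbound)).const_smul (gmass n)⁻¹
    exact h
  · intro x hx t ht
    have h := (((hasFDerivAt_slice hN hf hr x t).add (hK.hasFDerivAt_potl hf hfM x t)).add
      (hN.hasFDerivAt_potl hg hgM x t)).const_mul (gmass n)⁻¹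
    refine h.congr_of_eventuallyEq ?_
    filter_upwards [Metric.isOpen_ball.mem_nhds hx] with y hy
    exact hrep y hy t ht

theorem WeakHeat.exists_local_gradient (hU : IsOpen U) (hI : IsOpen I) (hw : WeakHeat f g U I)
    (hf : ContinuousOn f (U ×ˢ I)) (hg : ContinuousOn g (U ×ˢ I)) {x₀ : Euc n} {t₀ : ℝ}
    (hx : x₀ ∈ U) (ht : t₀ ∈ I) :
    ∃ r > 0, ∃ F : Euc n × ℝ → Euc n →L[ℝ] ℝ, Continuous F ∧
      ∀ x ∈ Metric.ball x₀ r, ∀ t ∈ Metric.ball t₀ r, HasFDerivAt (fun x => f (x, t)) (F (x, t)) x := by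
  obtain ⟨ε, hε, hball⟩ := Metric.isOpen_iff.mp (hU.prod hI) (x₀, t₀) ⟨hx, ht⟩
  set r := ε / 4 with hr
  have hr0 : 0 < r := by positivity
  obtain ⟨ζ, hζ, hζc, hζs⟩ : ∃ ζ : Euc n × ℝ → ℝ, Continuous ζ ∧ HasCompactSupport ζ ∧
      (∀ z ∈ Metric.closedBall (x₀, t₀) (2 * r), ζ z = 1) ∧ tsupport ζ ⊆ U ×ˢ I := by
    let b : ContDiffBump (x₀, t₀) := ⟨2 * r, 3 * r, by positivity, by linarith⟩
    refine ⟨b, b.contDiff (n := 0).continuous, b.hasCompactSupport, fun z hz => b.one_of_mem_closedBall hz, ?_⟩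
    rw [b.tsupport_eq]
    exact (Metric.closedBall_subset_ball (by change 3 * r < ε; linarith)).trans hball
  have hcs : ∀ {h : Euc n × ℝ → ℝ}, ContinuousOn h (U ×ˢ I) → Continuous fun z => ζ z * h z :=
    fun hh => (hζ.continuousOn.mul hh).continuous_of_tsupport_subset (hU.prod hI)
      ((tsupport_mul_subset_left).trans hζs.2)
  obtain ⟨M₁, hM₁⟩ := (hcs hf).bounded_above_of_compact_support hζc.mul_right
  obtain ⟨M₂, hM₂⟩ := (hcs hg).bounded_above_of_compact_support hζc.mul_right
  have hmem : ∀ x ∈ Metric.ball x₀ (2 * r), ∀ t ∈ Metric.ball t₀ (2 * r), ζ (x, t) = 1 := by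
    intro x hx t ht
    refine hζs.1 _ ?_
    rw [← closedBall_prod_same]
    exact ⟨Metric.ball_subset_closedBall hx, Metric.ball_subset_closedBall ht⟩
  have hsubset : ∀ x ∈ Metric.ball x₀ (2 * r), ∀ t ∈ Metric.ball t₀ (2 * r), (x, t) ∈ U ×ˢ I := by
    intro x hx t ht
    refine hball ?_
    rw [← ball_prod_same]
    exact ⟨Metric.ball_subset_ball (by linarith) hx, Metric.ball_subset_ball (by linarith) ht⟩
  have hw' : WeakHeat (fun z => ζ z * f z) (fun z => ζ z * g z) (Metric.ball x₀ (2 * r))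
      (Metric.ball t₀ (2 * r)) := by
    refine (hw.mono (fun x hx => (hsubset x hx t₀ (Metric.mem_ball_self (by positivity))).1)
      (fun t ht => (hsubset x₀ (Metric.mem_ball_self (by positivity)) t ht).2)).congr
      Metric.isOpen_ball ?_ ?_ <;>
    · intro x hx t ht
      simp only [hmem x hx t ht, one_mul]
  obtain ⟨F, hF, hFd⟩ := hw'.exists_gradient_of_bounded (M := max M₁ M₂) hr0 (hcs hf) (hcs hg)
    (fun z => (hM₁ z).trans (le_max_left _ _)) (fun z => (hM₂ z).trans (le_max_right _ _))
  refine ⟨r, hr0, F, hF, fun x hx t ht => (hFd x hx t ht).congr_of_eventuallyEq ?_⟩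
  filter_upwards [Metric.isOpen_ball.mem_nhds hx] with y hy
  rw [hmem y (Metric.ball_subset_ball (by linarith) hy) t (Metric.ball_subset_ball (by linarith) ht),
    one_mul]

/-- A weak solution of the heat equation with continuous right-hand side is `C¹` in space. -/
theorem WeakHeat.gradient (hU : IsOpen U) (hI : IsOpen I) (hw : WeakHeat f g U I)
    (hf : ContinuousOn f (U ×ˢ I)) (hg : ContinuousOn g (U ×ˢ I)) :
    (∀ x ∈ U, ∀ t ∈ I, DifferentiableAt ℝ (fun x => f (x, t)) x) ∧
      ContinuousOn (fun z : Euc n × ℝ => fderiv ℝ (fun x => f (x, z.2)) z.1) (U ×ˢ I) := by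
  constructor
  · intro x hx t ht
    obtain ⟨r, hr, F, -, hd⟩ := hw.exists_local_gradient hU hI hf hg hx ht
    exact (hd x (Metric.mem_ball_self hr) t (Metric.mem_ball_self hr)).differentiableAt
  · rintro ⟨x, t⟩ ⟨hx, ht⟩
    obtain ⟨r, hr, F, hF, hd⟩ := hw.exists_local_gradient hU hI hf hg hx ht
    refine (hF.continuousAt.congr ?_).continuousWithinAt
    filter_upwards [Metric.ball_mem_nhds (x, t) hr] with z hz
    rw [← ball_prod_same] at hz
    exact (hd z.1 hz.1 z.2 hz.2).fderiv.symm

end LocalRegularity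

section SecondOrder

variable {n : ℕ} {f g : Euc n × ℝ → ℝ} {U : Set (Euc n)} {I : Set ℝ}

theorem fderiv_fderiv_apply_comm {ρ : Euc n → ℝ} (hρ : ContDiff ℝ ∞ ρ) (a b : Euc n) :
    (fun x => fderiv ℝ (fun y => fderiv ℝ ρ y a) x b) =
      fun x => fderiv ℝ (fun y => fderiv ℝ ρ y b) x a := by
  ext x
  have hd : DifferentiableAt ℝ (fderiv ℝ ρ) x :=
    ((hρ.fderiv_right (m := ∞) (by simp)).differentiable (by simp)).differentiableAt
  have h := ((contDiff_infty.mp hρ 2).contDiffAt (x := x)).isSymmSndFDerivAt (by simp)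
  rw [fderiv_clm_apply hd (differentiableAt_const _), fderiv_clm_apply hd (differentiableAt_const _)]
  simpa using h b a

theorem contDiff_infty_fderiv_apply {ρ : Euc n → ℝ} (hρ : ContDiff ℝ ∞ ρ) (e : Euc n) :
    ContDiff ℝ ∞ fun y => fderiv ℝ ρ y e :=
  (hρ.fderiv_right (m := ∞) (by simp)).clm_apply contDiff_const

theorem contDiff_infty_lap {ρ : Euc n → ℝ} (hρ : ContDiff ℝ ∞ ρ) : ContDiff ℝ ∞ (lap ρ) := by
  unfold lap
  exact ContDiff.sum fun i _ =>
    contDiff_infty_fderiv_apply (contDiff_infty_fderiv_apply hρ _) _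

theorem lap_fderiv_apply {ρ : Euc n → ℝ} (hρ : ContDiff ℝ ∞ ρ) (e x : Euc n) :
    lap (fun y => fderiv ℝ ρ y e) x = fderiv ℝ (lap ρ) x e := by
  unfold lap
  rw [fderiv_fun_sum fun i _ => ((contDiff_infty_fderiv_apply (contDiff_infty_fderiv_apply hρ _)
    _).differentiable (by simp)).differentiableAt, _root_.sum_apply]
  refine Finset.sum_congr rfl fun i _ => ?_
  set v : Euc n := EuclideanSpace.single i 1
  rw [fderiv_fderiv_apply_comm hρ e v]
  exact congrFun (fderiv_fderiv_apply_comm (contDiff_infty_fderiv_apply hρ v) e v) x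

theorem tsupport_lap_subset (ρ : Euc n → ℝ) : tsupport (lap ρ) ⊆ tsupport ρ :=
  closure_minimal (fun x hx => by
    by_contra h; exact hx (lap_eq_zero_of_notMem_tsupport h)) (isClosed_tsupport _)

theorem integral_mul_fderiv_apply {ρ w : Euc n → ℝ} (hU : IsOpen U) (hρ : ContDiff ℝ ∞ ρ)
    (hc : HasCompactSupport ρ) (hs : tsupport ρ ⊆ U) (hw : ∀ x ∈ U, DifferentiableAt ℝ w x)
    (hw' : ContinuousOn (fderiv ℝ w) U) (e : Euc n) :
    ∫ x, ρ x * fderiv ℝ w x e = -∫ x, fderiv ℝ ρ x e * w x := by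
  have hwc : ContinuousOn w U := fun x hx => (hw x hx).continuousAt.continuousWithinAt
  have hi : ∀ {ψ v : Euc n → ℝ}, Continuous ψ → HasCompactSupport ψ → tsupport ψ ⊆ U →
      ContinuousOn v U → Integrable fun x => ψ x * v x := fun h1 h2 h3 h4 =>
    ((h1.continuousOn.mul h4).continuous_of_tsupport_subset hU
      ((tsupport_mul_subset_left).trans h3)).integrable_of_hasCompactSupport h2.mul_right
  refine integral_mul_fderiv_eq_neg_fderiv_mul_of_integrable ?_ ?_ ?_ ?_ ?_
  · exact hi (contDiff_infty_fderiv_apply hρ e).continuous (hc.fderiv_apply ℝ e)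
      ((tsupport_fderiv_apply_subset ℝ e).trans hs) hwc
  · exact hi hρ.continuous hc hs (hw'.clm_apply continuousOn_const)
  · exact hi hρ.continuous hc hs hwc
  · exact fun x _ => (hρ.differentiable (by simp)).differentiableAt
  · exact fun x hx => hw x (hs hx)

theorem continuousOn_section {F : Type*} [TopologicalSpace F] {G : Euc n × ℝ → F}
    (hG : ContinuousOn G (U ×ˢ I)) {t : ℝ} (ht : t ∈ I) : ContinuousOn (fun x => G (x, t)) U :=
  hG.comp (f := fun x => (x, t)) (by fun_prop) fun _ hx => ⟨hx, ht⟩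

/-- Directional derivatives of a weak solution are weak solutions. -/
theorem WeakHeat.fderiv_apply (hU : IsOpen U) (hI : IsOpen I) (hw : WeakHeat f g U I)
    (hf : ∀ x ∈ U, ∀ t ∈ I, DifferentiableAt ℝ (fun x => f (x, t)) x)
    (hf' : ContinuousOn (fun z : Euc n × ℝ => fderiv ℝ (fun x => f (x, z.2)) z.1) (U ×ˢ I))
    (hg : ∀ x ∈ U, ∀ t ∈ I, DifferentiableAt ℝ (fun x => g (x, t)) x)
    (hg' : ContinuousOn (fun z : Euc n × ℝ => fderiv ℝ (fun x => g (x, z.2)) z.1) (U ×ˢ I))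
    (e : Euc n) :
    WeakHeat (fun z => fderiv ℝ (fun x => f (x, z.2)) z.1 e)
      (fun z => fderiv ℝ (fun x => g (x, z.2)) z.1 e) U I := by
  intro ρ hρ hc hs t ht
  have h := (hw (fun y => fderiv ℝ ρ y e) (contDiff_infty_fderiv_apply hρ e) (hc.fderiv_apply ℝ e)
    ((tsupport_fderiv_apply_subset ℝ e).trans hs) t ht).neg
  have hF : ∀ s ∈ I, ∫ x, ρ x * fderiv ℝ (fun x => f (x, s)) x e =
      -∫ x, fderiv ℝ ρ x e * f (x, s) := fun s hsI =>
    integral_mul_fderiv_apply hU hρ hc hs (fun x hx => hf x hx s hsI) (continuousOn_section hf' hsI) e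
  have hG := integral_mul_fderiv_apply hU hρ hc hs (fun x hx => hg x hx t ht)
    (continuousOn_section hg' ht) e
  have hL := integral_mul_fderiv_apply hU (contDiff_infty_lap hρ) (hasCompactSupport_lap hc)
    ((tsupport_lap_subset ρ).trans hs) (fun x hx => hf x hx t ht) (continuousOn_section hf' ht) e
  simp only [lap_fderiv_apply hρ] at h
  refine (h.congr_of_eventuallyEq ?_).congr_deriv ?_
  · filter_upwards [hI.mem_nhds ht] with s hsI
    exact hF s hsI
  · change _ = (∫ x, lap ρ x * fderiv ℝ (fun x => f (x, t)) x e) +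
      ∫ x, ρ x * fderiv ℝ (fun x => g (x, t)) x e
    rw [hL, hG]
    ring

/-- A weak solution of the heat equation whose right-hand side is `C¹` in space is `C²` in space. -/
theorem WeakHeat.contDiffOn_two (hU : IsOpen U) (hI : IsOpen I) (hw : WeakHeat f g U I)
    (hf : ∀ x ∈ U, ∀ t ∈ I, DifferentiableAt ℝ (fun x => f (x, t)) x)
    (hf' : ContinuousOn (fun z : Euc n × ℝ => fderiv ℝ (fun x => f (x, z.2)) z.1) (U ×ˢ I))
    (hg : ∀ x ∈ U, ∀ t ∈ I, DifferentiableAt ℝ (fun x => g (x, t)) x)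
    (hg' : ContinuousOn (fun z : Euc n × ℝ => fderiv ℝ (fun x => g (x, z.2)) z.1) (U ×ˢ I)) :
    (∀ t ∈ I, ContDiffOn ℝ 2 (fun x => f (x, t)) U) ∧
      ContinuousOn (fun z : Euc n × ℝ => lap (fun x => f (x, z.2)) z.1) (U ×ˢ I) := by
  have key := fun e => (hw.fderiv_apply hU hI hf hf' hg hg' e).gradient hU hI
    (hf'.clm_apply continuousOn_const) (hg'.clm_apply continuousOn_const)
  constructor
  · intro t ht
    rw [show (2 : WithTop ℕ∞) = 1 + 1 by norm_num, contDiffOn_succ_iff_fderiv_of_isOpen hU]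
    refine ⟨fun x hx => (hf x hx t ht).differentiableWithinAt, by simp, contDiffOn_clm_apply.mpr fun e => ?_⟩
    rw [show (1 : WithTop ℕ∞) = 0 + 1 by norm_num, contDiffOn_succ_iff_fderiv_of_isOpen hU]
    refine ⟨fun x hx => ((key e).1 x hx t ht).differentiableWithinAt, by simp, ?_⟩
    rw [contDiffOn_zero]
    exact continuousOn_section (key e).2 ht
  · unfold lap
    exact continuousOn_finsetSum _ fun i _ => (key _).2.clm_apply continuousOn_const

end SecondOrder

section TimeDerivative

variable {n : ℕ} {f g : Euc n × ℝ → ℝ} {U : Set (Euc n)} {I : Set ℝ}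

theorem abs_integral_normed_sub_le {x₀ : Euc n} (b : ContDiffBump x₀) {w : Euc n → ℝ}
    (hw : ContinuousOn w (Metric.closedBall x₀ b.rOut)) {c ε : ℝ}
    (h : ∀ y ∈ Metric.closedBall x₀ b.rOut, |w y - c| ≤ ε) :
    |(∫ y, b.normed volume y * w y) - c| ≤ ε := by
  have hs : ∀ y, y ∉ Metric.closedBall x₀ b.rOut → b.normed volume y = 0 := fun y hy =>
    image_eq_zero_of_notMem_tsupport (by rwa [b.tsupport_normed_eq])
  have hρi : Integrable (b.normed (volume : Measure (Euc n))) := b.integrable_normed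
  have hi : Integrable fun y => b.normed volume y * w y := by
    rw [← integrableOn_iff_integrable_of_support_subset (s := Metric.closedBall x₀ b.rOut)]
    · exact ((b.contDiff_normed (n := 0)).continuous.continuousOn.mul hw).integrableOn_compact
        (isCompact_closedBall _ _)
    · intro y hy
      by_contra hy'
      exact hy (by simp [hs y hy'])
  have e : (∫ y, b.normed volume y * w y) - c = ∫ y, b.normed volume y * (w y - c) := by
    simp only [mul_sub]
    rw [integral_sub hi (hρi.mul_const c), integral_mul_const, b.integral_normed, one_mul]
  rw [e, ← Real.norm_eq_abs]
  refine (norm_integral_le_of_norm_le (hρi.mul_const ε) (Eventually.of_forall fun y => ?_)).trans ?_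
  · rw [norm_mul, Real.norm_of_nonneg (b.nonneg_normed y)]
    by_cases hy : y ∈ Metric.closedBall x₀ b.rOut
    · exact mul_le_mul_of_nonneg_left (h y hy) (b.nonneg_normed y)
    · rw [hs y hy, zero_mul, zero_mul]
  · rw [integral_mul_const, b.integral_normed, one_mul]

theorem integral_lap_mul_of_tsupport_subset {ρ w : Euc n → ℝ} (hU : IsOpen U) (hρ : ContDiff ℝ ∞ ρ)
    (hc : HasCompactSupport ρ) (hs : tsupport ρ ⊆ U) (hw : ContDiffOn ℝ 2 w U) :
    ∫ x, lap ρ x * w x = ∫ x, ρ x * lap w x := by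
  rw [show (2 : WithTop ℕ∞) = 1 + 1 by norm_num, contDiffOn_succ_iff_fderiv_of_isOpen hU] at hw
  have hd : ∀ x ∈ U, DifferentiableAt ℝ w x := fun x hx => hw.1.differentiableAt (hU.mem_nhds hx)
  have h1 : ∀ e, ContDiffOn ℝ (0 + 1) (fun x => fderiv ℝ w x e) U := by
    rw [zero_add]; exact contDiffOn_clm_apply.mp hw.2.2
  have hc1 : ContinuousOn (fderiv ℝ w) U := hw.2.2.continuousOn
  have h2 := fun e => (contDiffOn_succ_iff_fderiv_of_isOpen hU).mp (h1 e)
  have hd2 : ∀ e, ∀ x ∈ U, DifferentiableAt ℝ (fun x => fderiv ℝ w x e) x := fun e x hx =>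
    (h2 e).1.differentiableAt (hU.mem_nhds hx)
  have hc2 : ∀ e, ContinuousOn (fderiv ℝ fun x => fderiv ℝ w x e) U := fun e =>
    (h2 e).2.2.continuousOn
  have hi : ∀ {ψ v : Euc n → ℝ}, Continuous ψ → HasCompactSupport ψ → tsupport ψ ⊆ U →
      ContinuousOn v U → Integrable fun x => ψ x * v x := fun h1 h2 h3 h4 =>
    ((h1.continuousOn.mul h4).continuous_of_tsupport_subset hU
      ((tsupport_mul_subset_left).trans h3)).integrable_of_hasCompactSupport h2.mul_right
  unfold lap
  simp only [Finset.mul_sum, Finset.sum_mul]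
  have hs1 : ∀ e, tsupport (fun y => fderiv ℝ ρ y e) ⊆ U := fun e =>
    (tsupport_fderiv_apply_subset ℝ e).trans hs
  have hk1 : ∀ e, HasCompactSupport fun y => fderiv ℝ ρ y e := fun e => hc.fderiv_apply ℝ e
  have hsm := fun e => contDiff_infty_fderiv_apply hρ e
  rw [integral_finsetSum, integral_finsetSum]
  · refine Finset.sum_congr rfl fun i _ => ?_
    rw [integral_mul_fderiv_apply hU hρ hc hs (hd2 _) (hc2 _),
      integral_mul_fderiv_apply hU (hsm _) (hk1 _) (hs1 _) hd hc1, neg_neg]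
  · exact fun i _ => hi hρ.continuous hc hs ((hc2 _).clm_apply continuousOn_const)
  · exact fun i _ => hi (contDiff_infty_fderiv_apply (hsm _) _).continuous ((hk1 _).fderiv_apply ℝ _)
      ((tsupport_fderiv_apply_subset ℝ _).trans (hs1 _))
      fun x hx => (hd x hx).continuousAt.continuousWithinAt

/-- A weak solution that is `C²` in space is a classical solution. -/
theorem WeakHeat.hasDerivAt (hU : IsOpen U) (hI : IsOpen I) (hw : WeakHeat f g U I)
    (hf : ContinuousOn f (U ×ˢ I)) (hg : ContinuousOn g (U ×ˢ I))
    (hf2 : ∀ t ∈ I, ContDiffOn ℝ 2 (fun x => f (x, t)) U)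
    (hfl : ContinuousOn (fun z : Euc n × ℝ => lap (fun x => f (x, z.2)) z.1) (U ×ˢ I))
    {x₀ : Euc n} {t₀ : ℝ} (hx : x₀ ∈ U) (ht : t₀ ∈ I) :
    HasDerivAt (fun t => f (x₀, t)) (lap (fun x => f (x, t₀)) x₀ + g (x₀, t₀)) t₀ := by
  set h : Euc n × ℝ → ℝ := fun z => lap (fun x => f (x, z.2)) z.1 + g z with hh
  have hhc : ContinuousOn h (U ×ˢ I) := hfl.add hg
  have hder : ∀ ρ : Euc n → ℝ, ContDiff ℝ ∞ ρ → HasCompactSupport ρ → tsupport ρ ⊆ U → ∀ t ∈ I,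
      HasDerivAt (fun t => ∫ x, ρ x * f (x, t)) (∫ x, ρ x * h (x, t)) t := by
    intro ρ hρ hc hs t ht
    refine (hw ρ hρ hc hs t ht).congr_deriv ?_
    have hi : ∀ {v : Euc n → ℝ}, ContinuousOn v U → Integrable fun x => ρ x * v x := fun h4 =>
      ((hρ.continuous.continuousOn.mul h4).continuous_of_tsupport_subset hU
        ((tsupport_mul_subset_left).trans hs)).integrable_of_hasCompactSupport hc.mul_right
    rw [integral_lap_mul_of_tsupport_subset hU hρ hc hs (hf2 t ht),
      ← integral_add (hi (continuousOn_section hfl ht)) (hi (continuousOn_section hg ht))]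
    simp only [hh, mul_add]
  rw [hasDerivAt_iff_isLittleO, Asymptotics.isLittleO_iff]
  intro ε hε
  have hca : ContinuousAt h (x₀, t₀) := hhc.continuousAt ((hU.prod hI).mem_nhds ⟨hx, ht⟩)
  have hev : ∀ᶠ z in 𝓝 (x₀, t₀), |h z - h (x₀, t₀)| ≤ ε ∧ z ∈ U ×ˢ I := by
    filter_upwards [Metric.continuousAt_iff'.mp hca ε hε, (hU.prod hI).mem_nhds ⟨hx, ht⟩] with z hz hz2
    exact ⟨by rw [← Real.dist_eq]; exact hz.le, hz2⟩
  obtain ⟨δ, hδ, hball⟩ := Metric.eventually_nhds_iff_ball.mp hev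
  rw [← ball_prod_same] at hball
  have hsubU : Metric.ball x₀ δ ⊆ U := fun y hy => (hball (y, t₀) ⟨hy, Metric.mem_ball_self hδ⟩).2.1
  have hsubI : Metric.ball t₀ δ ⊆ I := fun s hs => (hball (x₀, s) ⟨Metric.mem_ball_self hδ, hs⟩).2.2
  filter_upwards [Metric.ball_mem_nhds t₀ hδ] with s hs
  rw [smul_eq_mul]
  change ‖f (x₀, s) - f (x₀, t₀) - (s - t₀) * h (x₀, t₀)‖ ≤ ε * ‖s - t₀‖
  refine le_of_forall_pos_le_add fun η hη => ?_
  have hclose : ∀ s ∈ Metric.ball t₀ δ, ∀ᶠ y in 𝓝 x₀, |f (y, s) - f (x₀, s)| ≤ η / 2 := by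
    intro s hs
    have hc1 : ContinuousAt (fun y => f (y, s)) x₀ :=
      (continuousOn_section hf (hsubI hs)).continuousAt (hU.mem_nhds hx)
    filter_upwards [Metric.continuousAt_iff'.mp hc1 (η / 2) (by positivity)] with y hy
    rw [← Real.dist_eq]; exact hy.le
  have ht₀ : t₀ ∈ Metric.ball t₀ δ := Metric.mem_ball_self hδ
  obtain ⟨δ', hδ', hb'⟩ := Metric.eventually_nhds_iff_ball.mp ((hclose s hs).and (hclose t₀ ht₀))
  set m := min δ δ' / 2 with hm
  have hm0 : 0 < m := by positivity
  have hmδ : m < δ := by have := min_le_left δ δ'; linarith [lt_min hδ hδ']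
  have hmδ' : m < δ' := by have := min_le_right δ δ'; linarith [lt_min hδ hδ']
  let b : ContDiffBump x₀ := ⟨m / 2, m, by positivity, by linarith⟩
  have hbo : b.rOut = m := rfl
  have hcb : Metric.closedBall x₀ m ⊆ U := (Metric.closedBall_subset_ball hmδ).trans hsubU
  have hΦ := hder (b.normed volume) b.contDiff_normed b.hasCompactSupport_normed
    (by rw [b.tsupport_normed_eq]; exact hcb)
  have hmvt := (convex_ball t₀ δ).norm_image_sub_le_of_norm_hasDerivWithin_le
    (f := fun t => (∫ x, b.normed volume x * f (x, t)) - t * h (x₀, t₀)) (C := ε)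
    (f' := fun t => (∫ x, b.normed volume x * h (x, t)) - h (x₀, t₀))
    (fun t ht => by
      have := (hΦ t (hsubI ht)).sub ((hasDerivAt_id t).mul_const (h (x₀, t₀)))
      rw [one_mul] at this
      exact this.hasDerivWithinAt)
    (fun t ht => abs_integral_normed_sub_le b ((continuousOn_section hhc (hsubI ht)).mono hcb)
      fun y hy => (hball (y, t) ⟨Metric.closedBall_subset_ball hmδ hy, ht⟩).1) ht₀ hs
  have ha : ∀ s ∈ Metric.ball t₀ δ, (∀ y ∈ Metric.ball x₀ δ', |f (y, s) - f (x₀, s)| ≤ η / 2) →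
      |(∫ x, b.normed volume x * f (x, s)) - f (x₀, s)| ≤ η / 2 := fun s hs hy =>
    abs_integral_normed_sub_le b ((continuousOn_section hf (hsubI hs)).mono hcb)
      fun y hy' => hy y (Metric.closedBall_subset_ball hmδ' hy')
  have ha1 := ha s hs fun y hy => (hb' y hy).1
  have ha2 := ha t₀ ht₀ fun y hy => (hb' y hy).2
  simp only [Real.norm_eq_abs] at hmvt ⊢
  rw [abs_le] at *
  constructor <;> linarith [hmvt.1, hmvt.2, ha1.1, ha1.2, ha2.1, ha2.2]

end TimeDerivative

section Classical

variable {n : ℕ} {S : Scheme n} {u : Euc n → ℝ → ℝ}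

theorem Scheme.weakHeat (hu : S.IsLimit u) :
    WeakHeat (fun z => u z.1 z.2) (fun z => S.react u z.1 z.2) S.Ω (Ioi 0) :=
  fun _ hρ hc hs _ ht => S.weak_form hu (contDiff_infty.mp hρ 2) hc hs ht

/-- A limit of the scheme is a classical solution when the reaction term is `C¹`. -/
theorem Scheme.classical (hu : S.IsLimit u) {R' : ℝ → ℝ → ℝ → ℝ}
    (hR : ∀ t w J, HasDerivAt (fun w => S.R t w J) (R' t w J) w)
    (hR' : Continuous fun z : ℝ × ℝ × ℝ => R' z.1 z.2.1 z.2.2) :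
    (∀ t, 0 < t → ContDiffOn ℝ 2 (fun x => u x t) S.Ω) ∧ ∀ x ∈ S.Ω, ∀ t, 0 < t →
      HasDerivAt (u x) (lap (fun y => u y t) x + S.react u x t) t := by
  have hw := Scheme.weakHeat hu
  have hf : ContinuousOn (fun z : Euc n × ℝ => u z.1 z.2) (S.Ω ×ˢ Ioi 0) := hu.cont.continuousOn
  have hg : ContinuousOn (fun z : Euc n × ℝ => S.react u z.1 z.2) (S.Ω ×ˢ Ioi 0) :=
    hu.continuous_react.continuousOn
  obtain ⟨h1, h1'⟩ := hw.gradient S.isOpen isOpen_Ioi hf hg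
  have hgd : ∀ x ∈ S.Ω, ∀ t ∈ Ioi (0 : ℝ), HasFDerivAt (fun x => S.react u x t)
      (R' (max t 0) (u x t) (S.mass fun y => u y t) • fderiv ℝ (fun x => u x t) x) x :=
    fun x hx t ht => (hR _ _ _).comp_hasFDerivAt x (h1 x hx t ht).hasFDerivAt
  have hmass : Continuous fun z : Euc n × ℝ => S.mass fun y => u y z.2 :=
    hu.continuous_mass.comp continuous_snd
  have hcoef : Continuous fun z : Euc n × ℝ => R' (max z.2 0) (u z.1 z.2) (S.mass fun y => u y z.2) :=
    hR'.comp ((continuous_snd.max continuous_const).prodMk (hu.cont.prodMk hmass))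
  obtain ⟨h2, h2'⟩ := hw.contDiffOn_two S.isOpen isOpen_Ioi h1 h1'
    (fun x hx t ht => (hgd x hx t ht).differentiableAt)
    ((hcoef.continuousOn.smul h1').congr fun z hz => (hgd z.1 hz.1 z.2 hz.2).fderiv)
  exact ⟨h2, fun x hx t ht => hw.hasDerivAt S.isOpen isOpen_Ioi hf hg h2 h2' hx ht⟩

end Classical

section Assembly

variable {n : ℕ} {Ω : Set (Euc n)}

theorem lap_const_mul (c : ℝ) (f : Euc n → ℝ) (x : Euc n) : lap (c • f) x = c * lap f x := by
  have e : ∀ v, (fun y => fderiv ℝ (c • f) y v) = c • fun y => fderiv ℝ f y v := fun v => by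
    ext y; simp [fderiv_const_smul_field]
  unfold lap
  rw [Finset.mul_sum]
  refine Finset.sum_congr rfl fun i _ => ?_
  rw [e, fderiv_const_smul_field]
  rfl

/-- A locally Hölder coefficient that depends on time only is continuous on `[0, ∞)`. -/
theorem LocHolder.continuous_max {a : Euc n → ℝ → ℝ} {A : ℝ → ℝ} (h : LocHolder Ω a)
    (hΩ : Ω.Nonempty) (ha : ∀ x t, a x t = A t) : Continuous fun t => A (max t 0) := by
  obtain ⟨x, hx⟩ := hΩ
  obtain ⟨α, hα, -, h⟩ := h
  refine continuous_iff_continuousAt.mpr fun t => ?_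
  obtain ⟨C, hC⟩ := h (max t 0 + 1) (by positivity)
  have hlim : Tendsto (fun s => C * |max s 0 - max t 0| ^ α) (𝓝 t) (𝓝 0) := by
    have hc : Continuous fun s => C * |max s 0 - max t 0| ^ α := by
      refine continuous_const.mul (Continuous.rpow_const (by fun_prop) fun _ => Or.inr hα.le)
    have := hc.tendsto t
    simpa [Real.zero_rpow hα.ne'] using this
  rw [ContinuousAt, tendsto_iff_dist_tendsto_zero]
  refine squeeze_zero' (Eventually.of_forall fun _ => dist_nonneg) ?_ hlim
  filter_upwards [gt_mem_nhds (show t < max t 0 + 1 by linarith [le_max_left t 0])] with s hs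
  have := hC x (subset_closure hx) x (subset_closure hx) (max s 0)
    ⟨le_max_right _ _, max_le hs.le (by positivity)⟩ (max t 0) ⟨le_max_right _ _, by linarith⟩
  rw [dist_self, zero_add, ha, ha] at this
  exact this

/-- The absorption dominates the nonlocal source below the level `m`. -/
theorem source_sub_absorption_nonpos {r p q B E V m w J : ℝ} (hq : 0 < q) (hrq : q ≤ r)
    (hB : 0 ≤ B) (hE : 0 ≤ E) (hm : 0 < m) (hEm : E * (V * m ^ (r + p - q)) ≤ 1)
    (hw : 0 ≤ w) (hwm : w ≤ m) (hJ : 0 ≤ J) (hJm : J ≤ V * m ^ p) :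
    E * B * w ^ r * J - B * w ^ q ≤ 0 := by
  have e1 : w ^ r = w ^ q * w ^ (r - q) := by
    rw [← Real.rpow_add_of_nonneg hw hq.le (by linarith)]; congr 1; ring
  have e2 : m ^ (r + p - q) = m ^ (r - q) * m ^ p := by
    rw [← Real.rpow_add hm]; congr 1; ring
  have h1 : w ^ (r - q) * J ≤ m ^ (r - q) * (V * m ^ p) :=
    mul_le_mul (Real.rpow_le_rpow hw hwm (by linarith)) hJm hJ (by positivity)
  have h2 : E * (w ^ (r - q) * J) ≤ 1 := by
    refine (mul_le_mul_of_nonneg_left h1 hE).trans (le_trans (le_of_eq ?_) hEm)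
    rw [e2]; ring
  have h3 : 0 ≤ B * w ^ q := by positivity
  have : E * B * w ^ r * J - B * w ^ q = B * w ^ q * (E * (w ^ (r - q) * J) - 1) := by
    rw [e1]; ring
  rw [this]
  exact mul_nonpos_of_nonneg_of_nonpos h3 (by linarith)

theorem exists_small_level {γ V Φ s : ℝ} (hγ : 0 < γ) (hV : 0 ≤ V) (hΦ : 0 < Φ) (hs : 0 < s) :
    ∃ β₀ > 0, ∀ β, 0 < β → β ≤ β₀ → γ * (V * (2 * β * Φ) ^ s) ≤ 1 := by
  have hc : 0 < γ * (V + 1) := by positivity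
  refine ⟨(γ * (V + 1))⁻¹ ^ s⁻¹ / (2 * Φ), by positivity, fun β hβ hβ' => ?_⟩
  have h1 : 2 * β * Φ ≤ (γ * (V + 1))⁻¹ ^ s⁻¹ := by
    rw [le_div_iff₀ (by positivity)] at hβ'
    linarith
  have h2 : (2 * β * Φ) ^ s ≤ (γ * (V + 1))⁻¹ := by
    refine (Real.rpow_le_rpow (by positivity) h1 hs.le).trans (le_of_eq ?_)
    rw [← Real.rpow_mul (by positivity), inv_mul_cancel₀ hs.ne', Real.rpow_one]
  calc γ * (V * (2 * β * Φ) ^ s) ≤ γ * ((V + 1) * (γ * (V + 1))⁻¹) := by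
        refine mul_le_mul_of_nonneg_left (mul_le_mul (by linarith) h2 (by positivity) (by positivity)) hγ.le
    _ = 1 := by field_simp

theorem level_decay {γ V c lam s t : ℝ} (hc : 0 < c) (h : γ * (V * c ^ s) ≤ 1) :
    γ * exp (lam * s * t) * (V * (c * exp (-lam * t)) ^ s) ≤ 1 := by
  rw [Real.mul_rpow hc.le (exp_pos _).le, ← Real.exp_mul]
  have e : exp (lam * s * t) * exp (-lam * t * s) = 1 := by
    rw [← Real.exp_add, ← Real.exp_zero]; congr 1; ring
  calc _ = γ * (V * c ^ s) * (exp (lam * s * t) * exp (-lam * t * s)) := by ring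
    _ ≤ 1 := by rw [e, mul_one]; exact h

theorem setIntegral_rpow_le {p m : ℝ} (hp : 0 ≤ p) (hΩb : Bornology.IsBounded Ω) {w : Euc n → ℝ}
    (hΩo : IsOpen Ω) (h0 : ∀ x ∈ Ω, 0 ≤ w x) (hm : ∀ x ∈ Ω, w x ≤ m) :
    0 ≤ ∫ y in Ω, w y ^ p ∧ ∫ y in Ω, w y ^ p ≤ volume.real Ω * m ^ p := by
  refine ⟨setIntegral_nonneg hΩo.measurableSet fun x hx => Real.rpow_nonneg (h0 x hx) _, ?_⟩
  have h := norm_setIntegral_le_of_norm_le_const (μ := volume) (f := fun y => w y ^ p) (C := m ^ p)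
    (s := Ω) hΩb.measure_lt_top fun x hx => by
      rw [Real.norm_of_nonneg (Real.rpow_nonneg (h0 x hx) _)]
      exact Real.rpow_le_rpow (h0 x hx) (hm x hx) hp
  rw [mul_comm]
  exact (le_abs_self _).trans h

theorem exists_lipschitz_of_hasDerivAt {R R' : ℝ → ℝ → ℝ → ℝ}
    (hR : ∀ t w J, HasDerivAt (fun w => R t w J) (R' t w J) w)
    (hR' : Continuous fun z : ℝ × ℝ × ℝ => R' z.1 z.2.1 z.2.2) (T M : ℝ) :
    ∃ L : ℝ, 0 ≤ L ∧ ∀ t ∈ Icc 0 T, ∀ J ∈ Icc 0 M, ∀ w ∈ Icc 0 M, ∀ w' ∈ Icc 0 M,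
      |R t w J - R t w' J| ≤ L * |w - w'| := by
  obtain ⟨L, hL⟩ := (isCompact_Icc (a := (0 : ℝ)) (b := T)).prod ((isCompact_Icc (a := (0 : ℝ)) (b := M)).prod
    (isCompact_Icc (a := (0 : ℝ)) (b := M))) |>.exists_bound_of_continuousOn hR'.continuousOn
  refine ⟨max L 0, le_max_right _ _, fun t ht J hJ w hw w' hw' => ?_⟩
  exact (convex_Icc (0 : ℝ) M).norm_image_sub_le_of_norm_hasDerivWithin_le
    (fun v _ => (hR t v J).hasDerivWithinAt)
    (fun v hv => (hL (t, v, J) ⟨ht, hv, hJ⟩).trans (le_max_left _ _)) hw' hw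

end Assembly

section Main

variable {n : ℕ} {Ω : Set (Euc n)}

theorem IsDirichletEigen.nonneg {lam : ℝ} {φ : Euc n → ℝ} (h : IsDirichletEigen Ω lam φ)
    (hΩ : IsOpen Ω) {x : Euc n} (hx : x ∈ closure Ω) : 0 ≤ φ x := by
  by_cases hxΩ : x ∈ Ω
  · exact (h.2.2.2.2 x hxΩ).le
  · exact (h.2.2.2.1 x (by rw [hΩ.frontier_eq]; exact ⟨hx, hxΩ⟩)).ge

theorem isSuperSol_decaying_eigenfunction {r p q l lam Φ β γ₀ T : ℝ} {φ u0 : Euc n → ℝ}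
    {a b : Euc n → ℝ → ℝ} {k : Euc n → Euc n → ℝ → ℝ} (hp : 1 ≤ p) (hq : 1 < q)
    (hrq : q ≤ r) (hΩo : IsOpen Ω) (hΩb : Bornology.IsBounded Ω)
    (heig : IsDirichletEigen Ω lam φ) (hΦ : 0 < Φ) (hφΦ : ∀ x ∈ Ω, φ x ≤ Φ)
    (hk : ∀ x y t, k x y t = 0) (hb : ∀ x ∈ Ω, ∀ t, 0 ≤ t → 0 ≤ b x t)
    (hab : ∀ x ∈ Ω, ∀ t, 0 ≤ t → a x t = γ₀ * exp (lam * (r + p - q) * t) * b x t) (hγ₀ : 0 < γ₀)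
    (hβ : 0 < β) (hsmall : γ₀ * (volume.real Ω * (2 * β * Φ) ^ (r + p - q)) ≤ 1)
    (hu0 : ∀ x ∈ closure Ω, u0 x ≤ β * φ x) :
    IsSuperSol r p q l Ω a b k u0 T fun x t => β * φ x * exp (-lam * t) := by
  have hsq : ∀ (x : Euc n) (t : ℝ), HasDerivAt (fun t => β * φ x * exp (-lam * t))
      (-lam * (β * φ x * exp (-lam * t))) t := fun x t => by
    have := (((hasDerivAt_id t).const_mul (-lam)).exp).const_mul (β * φ x)
    refine this.congr_deriv ?_
    simp; ring
  have hnn : ∀ x ∈ closure Ω, ∀ t, 0 ≤ β * φ x * exp (-lam * t) := fun x hx t => by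
    have := heig.nonneg hΩo hx
    positivity
  refine ⟨⟨?_, ?_, ?_⟩, fun x hx t _ => hnn x hx t, ?_, ?_, ?_⟩
  · refine ContinuousOn.mul (continuousOn_const.mul ?_) (by fun_prop)
    exact heig.1.comp continuousOn_fst fun z hz => hz.1
  · exact fun t _ => (contDiffOn_const.mul heig.2.1).mul contDiffOn_const
  · exact fun x _ t _ => (hsq x t).differentiableAt
  · intro x hx t ht
    have e : (fun y => β * φ y * exp (-lam * t)) = (β * exp (-lam * t)) • φ := by
      ext y; simp; ring
    have hle : ∀ y ∈ Ω, β * φ y * exp (-lam * t) ≤ 2 * β * Φ * exp (-lam * t) := fun y hy => by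
      refine mul_le_mul_of_nonneg_right ?_ (exp_pos _).le
      nlinarith [hφΦ y hy, mul_le_mul_of_nonneg_left (hφΦ y hy) hβ.le, mul_pos hβ hΦ]
    have hint := setIntegral_rpow_le (p := p) (by linarith) hΩb hΩo
      (fun y hy => hnn y (subset_closure hy) t) hle
    have hR := source_sub_absorption_nonpos (by linarith) hrq (hb x hx t ht.1.le)
      (by positivity) (by positivity)
      (level_decay (lam := lam) (t := t) (by positivity) hsmall) (hnn x (subset_closure hx) t)
      (hle x hx) hint.1 hint.2
    have hl := heig.2.2.1 x hx
    rw [(hsq x t).deriv, hab x hx t ht.1.le]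
    change _ ≥ lap (fun y => β * φ y * exp (-lam * t)) x + _ - _
    rw [e, lap_const_mul, show lap φ x = -lam * φ x by linarith]
    linarith
  · intro x hx t _
    simp only [hk, zero_mul, integral_zero]
    exact hnn x (frontier_subset_closure hx) t
  · intro x hx
    simpa using hu0 x (subset_closure hx)

/-- Existence of a global solution below the decaying eigenfunction. -/
theorem exists_global_solution {r p q l lam Φ β γ₀ : ℝ} {φ u0 : Euc n → ℝ} {A B : ℝ → ℝ}
    {a b : Euc n → ℝ → ℝ} {k : Euc n → Euc n → ℝ → ℝ} (hp : 1 ≤ p) (hq : 1 < q)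
    (hrq : q ≤ r) (hdata : GoodData Ω a b k)
    (heig : IsDirichletEigen Ω lam φ) (hΦ : 0 < Φ) (hφΦ : ∀ x ∈ Ω, φ x ≤ Φ)
    (hk : ∀ x y t, k x y t = 0) (ha : ∀ x t, a x t = A t) (hb : ∀ x t, b x t = B t)
    (hab : ∀ t, 0 ≤ t → A t = γ₀ * exp (lam * (r + p - q) * t) * B t) (hγ₀ : 0 < γ₀)
    (hβ : 0 < β) (hsmall : γ₀ * (volume.real Ω * (2 * β * Φ) ^ (r + p - q)) ≤ 1)
    (hu0 : ∀ x ∈ closure Ω, u0 x ≤ β * φ x) (hgood : GoodInit Ω k l u0) :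
    ∃ u : Euc n → ℝ → ℝ, ∀ T : ℝ, 0 < T → IsSol r p q l Ω a b k u0 T u := by
  obtain ⟨hΩo, hΩb, hΩn, hHa, hHb, hnn, -, -⟩ := hdata
  have hA := hHa.continuous_max hΩn ha
  have hB := hHb.continuous_max hΩn hb
  have hB0 : ∀ t, 0 ≤ t → 0 ≤ B t := fun t ht => by
    obtain ⟨x, hx⟩ := hΩn
    rw [← hb x t]
    exact (hnn x (subset_closure hx) t ht).2
  have hR : ∀ t w J, HasDerivAt (fun w : ℝ => A (max t 0) * w ^ r * J - B (max t 0) * w ^ q)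
      (A (max t 0) * (r * w ^ (r - 1)) * J - B (max t 0) * (q * w ^ (q - 1))) w := fun t w J =>
    (((Real.hasDerivAt_rpow_const (Or.inr (by linarith))).const_mul _).mul_const J).sub
      ((Real.hasDerivAt_rpow_const (Or.inr hq.le)).const_mul _)
  have hpow : ∀ s : ℝ, 0 ≤ s → Continuous fun z : ℝ × ℝ × ℝ => z.2.1 ^ s := fun s hs =>
    Continuous.rpow_const (by fun_prop) fun _ => Or.inr hs
  have hAz : Continuous fun z : ℝ × ℝ × ℝ => A (max z.1 0) := hA.comp continuous_fst
  have hBz : Continuous fun z : ℝ × ℝ × ℝ => B (max z.1 0) := hB.comp continuous_fst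
  have hJz : Continuous fun z : ℝ × ℝ × ℝ => z.2.2 := by fun_prop
  have hR' : Continuous fun z : ℝ × ℝ × ℝ => A (max z.1 0) * (r * z.2.1 ^ (r - 1)) * z.2.2 -
      B (max z.1 0) * (q * z.2.1 ^ (q - 1)) :=
    ((hAz.mul ((hpow _ (by linarith)).const_mul r)).mul hJz).sub
      (hBz.mul ((hpow _ (by linarith)).const_mul q))
  have hzero : ∀ x ∈ frontier Ω, u0 x = 0 := fun x hx => by
    rw [hgood.2.2 x hx]; simp [hk]
  let S : Scheme n :=
    { Ω := Ω
      φ := Ω.indicator φ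
      u0 := Ω.indicator u0
      lam := lam
      β := β
      Φ := Φ
      p := p
      R := fun t w J => A (max t 0) * w ^ r * J - B (max t 0) * w ^ q
      isOpen := hΩo
      bdd := hΩb
      cont_φ := continuous_indicator heig.2.2.2.1 heig.1
      φ_nonneg := indicator_nonneg fun x hx => (heig.2.2.2.2 x hx).le
      φ_zero := fun x hx => indicator_of_notMem hx _
      φ_le := fun x => indicator_le' hφΦ (fun _ _ => hΦ.le) x
      Φ_pos := hΦ
      φ_c2 := heig.2.1.congr fun x hx => indicator_of_mem hx _
      φ_eq := fun x hx => by
        have : Ω.indicator φ =ᶠ[𝓝 x] φ := by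
          filter_upwards [hΩo.mem_nhds hx] with y hy using indicator_of_mem hy _
        rw [lap_congr this, indicator_of_mem hx]
        exact heig.2.2.1 x hx
      cont_u0 := continuous_indicator hzero hgood.1
      u0_nonneg := indicator_nonneg fun x hx => hgood.2.1 x (subset_closure hx)
      u0_le := fun x => by
        by_cases hx : x ∈ Ω
        · simpa [hx] using hu0 x (subset_closure hx)
        · simp [hx]
      β_pos := hβ
      p_ge := hp
      cont_R := ((hAz.mul (hpow _ (by linarith))).mul hJz).sub (hBz.mul (hpow _ (by linarith)))
      R_zero := fun t J => by
        rw [Real.zero_rpow (by linarith), Real.zero_rpow (by linarith)]; ring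
      R_lip := exists_lipschitz_of_hasDerivAt hR hR'
      R_nonpos := fun t w J ht hw hwm hJ hJm => by
        simp only [max_eq_left ht, hab t ht]
        exact source_sub_absorption_nonpos (by linarith) hrq (hB0 t ht) (by positivity) (by positivity)
          (level_decay (lam := lam) (t := t) (by positivity) hsmall) hw hwm hJ hJm }
  obtain ⟨u, hu⟩ := S.exists_limit
  obtain ⟨h2, hd⟩ := Scheme.classical hu hR hR'
  have heq : ∀ x ∈ Ω, ∀ t, 0 < t → deriv (u x) t = lap (fun y => u y t) x
      + a x t * u x t ^ r * (∫ y in Ω, u y t ^ p) - b x t * u x t ^ q := fun x hx t ht => by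
    rw [(hd x hx t ht).deriv, ha, hb, add_sub_assoc]
    simp only [Scheme.react, Scheme.mass, S, max_eq_left ht.le]
  have hreg : ∀ T, RegQ Ω T u := fun T =>
    ⟨hu.cont.continuousOn, fun t ht => h2 t ht.1, fun x hx t ht => (hd x hx t ht.1).differentiableAt⟩
  have hbd : ∀ x ∈ frontier Ω, ∀ t, u x t = ∫ y in Ω, k x y t * u y t ^ l := fun x hx t => by
    have hx' : x ∉ S.Ω := fun h => by
      rw [hΩo.frontier_eq] at hx; exact hx.2 h
    rw [hu.zero x hx' t]; simp [hk]
  have hin : ∀ x ∈ Ω, u x 0 = u0 x := fun x hx => by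
    rw [hu.initial x 0 le_rfl]; exact indicator_of_mem hx _
  refine ⟨u, fun T _ => ⟨⟨hreg T, fun x _ t _ => hu.nonneg x t, fun x hx t ht => (heq x hx t ht.1).le,
    fun x hx t _ => (hbd x hx t).le, fun x hx => (hin x hx).le⟩,
    ⟨hreg T, fun x _ t _ => hu.nonneg x t, fun x hx t ht => (heq x hx t ht.1).ge,
    fun x hx t _ => (hbd x hx t).ge, fun x hx => (hin x hx).ge⟩⟩⟩

end Main

/-- **Sharpness of the condition `γ(t) → ∞`.** Suppose `p ≥ 1`, `r ≥ q > 1`, `k ≡ 0`,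
`a(x,t) ≡ a̲(t)`, `b(x,t) ≡ b̄(t)` with `a̲(t) = γ₀ exp[λ₁(r+p−q)t] b̄(t)` for a fixed
constant `γ₀ > 0`. Then for all sufficiently small `β > 0` the function
`ū(x,t) = β φ(x) e^{−λ₁t}` is a supersolution of (P) in `Q_T` for every `T > 0` whenever
`u₀ ≤ β φ`, and problem (P) has global solutions for such initial data. -/
theorem sharpness_gamma_bounded {n : ℕ} (r p q l : ℝ)
    (hl : 0 < l) (hp : 1 ≤ p) (hq : 1 < q) (hrq : q ≤ r)
    (Ω : Set (EuclideanSpace ℝ (Fin n)))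
    (a b : EuclideanSpace ℝ (Fin n) → ℝ → ℝ)
    (k : EuclideanSpace ℝ (Fin n) → EuclideanSpace ℝ (Fin n) → ℝ → ℝ)
    (hdata : GoodData Ω a b k)
    (lam : ℝ) (φ : EuclideanSpace ℝ (Fin n) → ℝ) (heig : IsFirstEigen Ω lam φ)
    (hφnorm : (∫ x in Ω, φ x) = 1)
    (hk : ∀ x y t, k x y t = 0)
    (abar bbar : ℝ → ℝ)
    (ha : ∀ x t, a x t = abar t) (hb : ∀ x t, b x t = bbar t)
    (γ₀ : ℝ) (hγ₀ : 0 < γ₀)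
    (hab : ∀ t : ℝ, 0 ≤ t → abar t = γ₀ * Real.exp (lam * (r + p - q) * t) * bbar t) :
    ∃ β₀ : ℝ, 0 < β₀ ∧ ∀ β : ℝ, 0 < β → β ≤ β₀ →
      ∀ u0 : EuclideanSpace ℝ (Fin n) → ℝ,
        (∀ x ∈ closure Ω, u0 x ≤ β * φ x) →
        (∀ T : ℝ, 0 < T → IsSuperSol r p q l Ω a b k u0 T
          (fun x t => β * φ x * Real.exp (-lam * t))) ∧
        (GoodInit Ω k l u0 →
          ∃ u : EuclideanSpace ℝ (Fin n) → ℝ → ℝ,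
            ∀ T : ℝ, 0 < T → IsSol r p q l Ω a b k u0 T u) := by
  obtain ⟨hΩo, hΩb, hΩn, -, -, hnn, -, -⟩ := id hdata
  have hE := heig.1
  obtain ⟨Φ₀, hΦ₀⟩ := hΩb.isCompact_closure.exists_bound_of_continuousOn hE.1
  set Φ := max Φ₀ 1
  have hΦ : 0 < Φ := lt_of_lt_of_le one_pos (le_max_right _ _)
  have hφΦ : ∀ x ∈ Ω, φ x ≤ Φ := fun x hx =>
    (le_abs_self _).trans ((hΦ₀ x (subset_closure hx)).trans (le_max_left _ _))
  obtain ⟨β₀, hβ₀, hsmall⟩ := exists_small_level (γ := γ₀) (V := volume.real Ω) (Φ := Φ)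
    (s := r + p - q) hγ₀ measureReal_nonneg hΦ (by linarith)
  refine ⟨β₀, hβ₀, fun β hβ hβ' u0 hu0 => ⟨fun T _ => ?_, fun hgood => ?_⟩⟩
  · exact isSuperSol_decaying_eigenfunction hp hq hrq hΩo hΩb hE hΦ hφΦ hk
      (fun x hx t ht => (hnn x (subset_closure hx) t ht).2)
      (fun x _ t ht => by rw [ha, hb, hab t ht]) hγ₀ hβ (hsmall β hβ hβ') hu0
  · exact exists_global_solution hp hq hrq hdata hE hΦ hφΦ hk ha hb hab hγ₀ hβ (hsmall β hβ hβ')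
      hu0 hgood
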